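/- Let ℓ ≥ 2 be an integer, c, c₁ ∈ (0,1), δ > 0, K ≥ 1, and let Λ ⊆ [2,∞) be compact; set θ(c,c₁) = min{c + c₁, 1/2 − 2c₁}. There exist C > 0 and ε₀ > 0 such that for every ε ∈ (0,ε₀), every λ ∈ Λ, and every interval I ⊆ [0,1] with K⁻¹·ε^c ≤ |I| ≤ K·ε^c, one has |G^{(2)}_{ℓ,I,ε}(λ) − (c_I·C(ℓ)/ℓ)·∫₀¹ ((1−u)/u)·ln(λ/(λ−u)) du| ≤ C·ε^{θ(c,c₁)−δ}, and the identical estimate holds with G^{(3)}_{ℓ,I,ε} in place of G^{(2)}_{ℓ,I,ε}. -/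

import Mathlib

open MeasureTheory Real Set Filter
open scoped ENNReal Pointwise

noncomputable def Cconst (l : ℕ) : ℝ :=
  ((Nat.totient l : ℝ) / l) * ∏' p : {p : ℕ // p.Prime ∧ ¬ p ∣ l}, (1 - 1 / (p.1 : ℝ) ^ 2)

def Zl (l : ℕ) : Set (ℝ × ℝ) :=
  {p | ∃ m n : ℤ, p = ((m : ℝ), (n : ℝ)) ∧ ¬ ((l : ℤ) ∣ (m - n))}

def Vseg (ε : ℝ) : Set (ℝ × ℝ) := {(0 : ℝ)} ×ˢ Set.Icc (-ε) ε

noncomputable def qfree (l : ℕ) (ε ω : ℝ) : ℝ≥0∞ :=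
  ⨅ q : {q : ℝ // 0 < q ∧ (q, q * Real.tan ω) ∈ Zl l + Vseg ε}, ENNReal.ofReal q.1

def FareyQ (Q : ℕ) : Set ℚ := {x | 0 < x ∧ x ≤ 1 ∧ x.den ≤ Q}

def FareyCong (l : ℕ) : Set ℚ := {x | 0 < x ∧ x ≤ 1 ∧ (l : ℤ) ∣ ((x.den : ℤ) - x.num)}

def ConsecFarey (Q : ℕ) (γ γ' : ℚ) : Prop :=
  γ ∈ FareyQ Q ∧ γ' ∈ FareyQ Q ∧ γ < γ' ∧ ∀ z ∈ FareyQ Q, ¬ (γ < z ∧ z < γ')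

/-- `G^{(2)}_{ℓ,I,ε}(λ)`: the measure of the set of `ω ∈ arctan I` with `q_{ℓ,ε}(ω) > λQ`
(`Q = ⌊1/ε⌋`) and `γ < tan ω < γ'` for some consecutive `γ, γ'` in `F_Q` with
`γ, γ' ∈ I` and `γ ∈ F^{(ℓ)}`. -/
noncomputable def Gmeas2 (l : ℕ) (I : Set ℝ) (ε lam : ℝ) : ℝ :=
  (volume {ω ∈ Real.arctan '' I |
    ENNReal.ofReal (lam * (⌊1 / ε⌋₊ : ℝ)) < qfree l ε ω ∧
    ∃ γ γ' : ℚ, ConsecFarey ⌊1 / ε⌋₊ γ γ' ∧ (γ : ℝ) ∈ I ∧ (γ' : ℝ) ∈ I ∧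
      γ ∈ FareyCong l ∧ (γ : ℝ) < Real.tan ω ∧ Real.tan ω < (γ' : ℝ)}).toReal

/-- `G^{(3)}_{ℓ,I,ε}(λ)`: same as `G^{(2)}_{ℓ,I,ε}(λ)` but with the condition
`γ' ∈ F^{(ℓ)}` instead of `γ ∈ F^{(ℓ)}`. -/
noncomputable def Gmeas3 (l : ℕ) (I : Set ℝ) (ε lam : ℝ) : ℝ :=
  (volume {ω ∈ Real.arctan '' I |
    ENNReal.ofReal (lam * (⌊1 / ε⌋₊ : ℝ)) < qfree l ε ω ∧
    ∃ γ γ' : ℚ, ConsecFarey ⌊1 / ε⌋₊ γ γ' ∧ (γ : ℝ) ∈ I ∧ (γ' : ℝ) ∈ I ∧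
      γ' ∈ FareyCong l ∧ (γ : ℝ) < Real.tan ω ∧ Real.tan ω < (γ' : ℝ)}).toReal

section Stepanov

open Polynomial

theorem exists_coeff_ne_zero_of_natDegree_injective {F ι : Type*} [Field F] [Fintype ι]
    (T : ι → F[X]) (hT : ∀ t, T t ≠ 0) (hinj : Function.Injective fun t => (T t).natDegree)
    (c : ι → F) (hc : c ≠ 0) : ∑ t, C (c t) * T t ≠ 0 := by
  classical
  obtain ⟨t₁, ht₁⟩ : ∃ t, c t ≠ 0 := by
    by_contra! h
    exact hc (funext h)
  obtain ⟨t₀, ht₀, hmax⟩ := Finset.exists_max_image (Finset.univ.filter fun t => c t ≠ 0)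
    (fun t => (T t).natDegree) ⟨t₁, by simpa using ht₁⟩
  intro h
  have h2 := congrArg (fun f => f.coeff (T t₀).natDegree) h
  simp only [finsetSum_coeff, coeff_C_mul, coeff_zero] at h2
  rw [Finset.sum_eq_single t₀] at h2
  · have : c t₀ ≠ 0 := by simpa using ht₀
    exact (mul_ne_zero this (leadingCoeff_ne_zero.mpr (hT t₀))) h2
  · intro t _ hne
    by_cases hct : c t = 0
    · simp [hct]
    · have h3 := hmax t (by simpa using hct)
      have h4 : (T t).natDegree ≠ (T t₀).natDegree := fun h => hne (hinj h)
      rw [coeff_eq_zero_of_natDegree_lt (lt_of_le_of_ne h3 h4), mul_zero]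
  · simp

/-- `X ^ p ^ m * (s - ∑_{i ≤ m} (X + a / X) ^ p ^ i)` as a polynomial. -/
noncomputable def artinSchreierNumerator {F : Type*} [Field F] (p m : ℕ) (a s : F) : F[X] :=
  C s * X ^ p ^ m - ∑ i ∈ Finset.range (m + 1),
    (X ^ (p ^ m + p ^ i) + C a * X ^ (p ^ m - p ^ i))

theorem artinSchreierNumerator_eval {F : Type*} [Field F] {p : ℕ} [Fact p.Prime] [CharP F p]
    (m : ℕ) {a s : F} (ha : a ^ p = a) {x : F} (hx : x ≠ 0) :
    (artinSchreierNumerator p m a s).eval x =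
      x ^ p ^ m * (s - ∑ i ∈ Finset.range (m + 1), (x + a / x) ^ p ^ i) := by
  have hai : ∀ i, a ^ p ^ i = a := by
    intro i
    induction i with
    | zero => simp
    | succ k ih => rw [pow_succ, pow_mul, ih, ha]
  simp only [artinSchreierNumerator, eval_sub, eval_mul, eval_C, eval_pow, eval_X,
    eval_finsetSum, eval_add, mul_sub, Finset.mul_sum]
  congr 1
  · ring
  refine Finset.sum_congr rfl fun i hi => ?_
  have hle : p ^ i ≤ p ^ m := Nat.pow_le_pow_right (Fact.out : p.Prime).pos
    (by simpa [Nat.lt_succ_iff] using hi)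
  rw [add_pow_char_pow, div_pow, hai, pow_add, pow_sub₀ _ hx hle]
  field_simp

theorem artinSchreierNumerator_natDegree {F : Type*} [Field F] {p : ℕ} (hp : p.Prime)
    (m : ℕ) (a s : F) : (artinSchreierNumerator p m a s).natDegree = 2 * p ^ m := by
  have h1 : artinSchreierNumerator p m a s = - X ^ (2 * p ^ m) + (C s * X ^ p ^ m -
      C a * X ^ (p ^ m - p ^ m) -
      ∑ i ∈ Finset.range m, (X ^ (p ^ m + p ^ i) + C a * X ^ (p ^ m - p ^ i))) := by
    rw [artinSchreierNumerator, Finset.sum_range_succ, two_mul]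
    ring
  have hP : 0 < p ^ m := pow_pos hp.pos m
  rw [h1]
  have hlt : (C s * X ^ p ^ m - C a * X ^ (p ^ m - p ^ m) -
      ∑ i ∈ Finset.range m, (X ^ (p ^ m + p ^ i) + C a * X ^ (p ^ m - p ^ i)) : F[X]).degree <
      ((2 * p ^ m : ℕ) : WithBot ℕ) := by
    have e1 : ∀ (b : F) (k : ℕ), k < 2 * p ^ m →
        (C b * X ^ k : F[X]) ∈ degreeLT F (2 * p ^ m) := by
      intro b k hk
      rw [mem_degreeLT]
      exact lt_of_le_of_lt (degree_C_mul_X_pow_le k b) (by exact_mod_cast hk)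
    rw [← mem_degreeLT]
    refine Submodule.sub_mem _ (Submodule.sub_mem _ (e1 _ _ (by omega)) (e1 _ _ (by omega)))
      (Submodule.sum_mem _ fun i hi => ?_)
    have : p ^ i < p ^ m := Nat.pow_lt_pow_right hp.one_lt (by simpa using hi)
    refine Submodule.add_mem _ ?_ (e1 _ _ (by omega))
    have := e1 1 (p ^ m + p ^ i) (by omega)
    simpa using this
  have hd : (-X ^ (2 * p ^ m) : F[X]).degree = ((2 * p ^ m : ℕ) : WithBot ℕ) := by
    rw [degree_neg, degree_X_pow]
  apply natDegree_eq_of_degree_eq_some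
  rw [degree_add_eq_left_of_degree_lt (by rw [hd]; exact hlt), hd]

theorem card_traceLevel_le {F : Type*} [Field F] [Fintype F] [DecidableEq F] {p : ℕ}
    [Fact p.Prime] [CharP F p] (ν : ℕ) (hF : Fintype.card F = p ^ (2 * ν + 3)) {a s : F}
    (ha : a ^ p = a) (hs : s ^ p = s) :
    (Finset.univ.filter fun x : F => x ≠ 0 ∧
      ∑ i ∈ Finset.range (2 * ν + 3), (x + a / x) ^ p ^ i = s).card ≤
      p ^ (2 * ν + 2) + 3 * p ^ (ν + 2) := by
  have hp : p.Prime := Fact.out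
  set P' := p ^ ν with hP'
  set P := p ^ (ν + 1) with hP
  set W := p ^ (ν + 2) with hW
  have hP'pos : 0 < P' := pow_pos hp.pos _
  have hPP' : P = p * P' := by rw [hP, hP']; ring
  have hWP : W = p * P := by rw [hP, hW]; ring
  have hp2 := hp.two_le
  have hPpos : 0 < P := pow_pos hp.pos _
  set J := P' + 2 with hJ
  have hkP' : ∀ k : Fin p, k.1 * P' + P' ≤ P := fun k => by
    rw [hPP', ← Nat.succ_mul]; exact Nat.mul_le_mul_right _ k.2
  have hkP : ∀ k : Fin p, k.1 * P + P ≤ W := fun k => by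
    rw [hWP, ← Nat.succ_mul]; exact Nat.mul_le_mul_right _ k.2
  have hxq : ∀ x : F, x ^ (p ^ (2 * ν + 3)) = x := fun x => by rw [← hF, FiniteField.pow_card]
  let ι := Fin P × Fin J × Fin p
  let T : ι → F[X] := fun t => X ^ (t.1.1 + t.2.1.1 * W + (W - t.2.2.1 * P)) *
    (artinSchreierNumerator p (ν + 1) a s) ^ t.2.2.1
  let V : ι → F[X] := fun t => X ^ (t.1.1 * P + t.2.1.1 + 1 + (P - t.2.2.1 * P')) *
    (-artinSchreierNumerator p ν a 0) ^ t.2.2.1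
  have hU0 : artinSchreierNumerator p (ν + 1) a s ≠ 0 := by
    intro h
    have := artinSchreierNumerator_natDegree hp (ν + 1) a s
    rw [h, natDegree_zero] at this
    omega
  have hT0 : ∀ t, T t ≠ 0 := fun t => mul_ne_zero (pow_ne_zero _ X_ne_zero) (pow_ne_zero _ hU0)
  have hTdeg : ∀ t, (T t).natDegree = t.1.1 + P * (t.2.2.1 + p * (t.2.1.1 + 1)) := by
    intro t
    have hk : t.2.2.1 * P ≤ W := (Nat.le_add_right _ _).trans (hkP _)
    simp only [T]
    rw [natDegree_mul (pow_ne_zero _ X_ne_zero) (pow_ne_zero _ hU0), natDegree_X_pow,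
      natDegree_pow, artinSchreierNumerator_natDegree hp]
    obtain ⟨r, hr⟩ := Nat.exists_eq_add_of_le hk
    have : W - t.2.2.1 * P = r := by omega
    rw [this]
    have h5 : P * (t.2.2.1 + p * (t.2.1.1 + 1)) = P * t.2.2.1 + t.2.1.1 * W + W := by
      rw [hWP]; ring
    rw [h5, ← hP]
    nlinarith
  have hTinj : Function.Injective fun t => (T t).natDegree := by
    rintro ⟨i, j, k⟩ ⟨i', j', k'⟩ h
    simp only [hTdeg] at h
    have e1 : i.1 = i'.1 := by
      have := congrArg (· % P) h
      simpa [Nat.add_mul_mod_self_left, Nat.mod_eq_of_lt i.2, Nat.mod_eq_of_lt i'.2] using this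
    rw [e1] at h
    have e2 := Nat.eq_of_mul_eq_mul_left hPpos (Nat.add_left_cancel h)
    have e3 : k.1 = k'.1 := by
      have := congrArg (· % p) e2
      simpa [Nat.add_mul_mod_self_left, Nat.mod_eq_of_lt k.2, Nat.mod_eq_of_lt k'.2] using this
    rw [e3] at e2
    have e4 := Nat.eq_of_mul_eq_mul_left hp.pos (Nat.add_left_cancel e2)
    have e5 : j.1 = j'.1 := by omega
    rw [Fin.ext e1, Fin.ext e3, Fin.ext e5]
  have hVdeg : ∀ t, V t ∈ degreeLT F (P * P + P + 3) := by
    intro t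
    rw [mem_degreeLT]
    have hk : t.2.2.1 * P' ≤ P := (Nat.le_add_right _ _).trans (hkP' _)
    have hk' := hkP' t.2.2
    have h1 : (V t).natDegree ≤
        (t.1.1 * P + t.2.1.1 + 1 + (P - t.2.2.1 * P')) + t.2.2.1 * (2 * P') := by
      simp only [V]
      refine natDegree_mul_le.trans ?_
      rw [natDegree_X_pow]
      refine Nat.add_le_add_left (natDegree_pow_le.trans ?_) _
      rw [natDegree_neg, artinSchreierNumerator_natDegree hp]
    have h2 : t.1.1 * P + P ≤ P * P := by
      rw [← Nat.succ_mul]; exact Nat.mul_le_mul_right _ t.1.2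
    have h3 := t.2.1.2
    refine lt_of_le_of_lt degree_le_natDegree ?_
    have h4 : (V t).natDegree < P * P + P + 3 := by
      have : t.2.2.1 * (2 * P') = 2 * (t.2.2.1 * P') := by ring
      omega
    exact_mod_cast h4
  let Φ : (ι → F) →ₗ[F] degreeLT F (P * P + P + 3) :=
    Fintype.linearCombination F (fun t => (⟨V t, hVdeg t⟩ : degreeLT F (P * P + P + 3)))
  obtain ⟨d, hd, hd0⟩ : ∃ d : ι → F, Φ d = 0 ∧ d ≠ 0 := by
    by_contra! h
    have hinj : Function.Injective Φ := (injective_iff_map_eq_zero Φ).mpr h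
    have : Module.Finite F (degreeLT F (P * P + P + 3)) :=
      Module.Finite.equiv (degreeLTEquiv F (P * P + P + 3)).symm
    have h1 := LinearMap.finrank_le_finrank_of_injective hinj
    rw [Module.finrank_fintype_fun_eq_card, (degreeLTEquiv F _).finrank_eq,
      Module.finrank_fintype_fun_eq_card] at h1
    simp only [ι, Fintype.card_prod, Fintype.card_fin] at h1
    have h2 : P * (J * p) = P * P + 2 * (p * P) := by rw [hJ]; nlinarith
    have h3 : 2 * P ≤ p * P := Nat.mul_le_mul_right _ hp2
    have h4 : 2 ≤ P := by rw [hPP']; nlinarith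
    omega
  have hd' : ∑ t, C (d t) * V t = 0 := by
    have := congrArg (Subtype.val) hd
    simpa [Φ, Fintype.linearCombination_apply, smul_eq_C_mul] using this
  set H : F[X] := ∑ t, C (d t ^ W) * T t with hH
  have hH0 : H ≠ 0 := by
    refine exists_coeff_ne_zero_of_natDegree_injective T hT0 hTinj _ fun h => hd0 ?_
    funext t
    have := congrFun h t
    exact (pow_eq_zero_iff (pow_pos hp.pos _).ne').mp this
  have hHdeg : H.natDegree < (J + 1) * W := by
    have hlt : H ∈ degreeLT F ((J + 1) * W) := by
      refine Submodule.sum_mem _ fun t _ => ?_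
      rw [← smul_eq_C_mul]
      refine Submodule.smul_mem _ _ ?_
      rw [mem_degreeLT, degree_eq_natDegree (hT0 t), hTdeg]
      have h1 := t.1.2
      have h2 := hkP t.2.2
      have h3 : (t.2.1.1 + 1) * W ≤ J * W := Nat.mul_le_mul_right _ t.2.1.2
      have h4 : t.1.1 + P * (t.2.2.1 + p * (t.2.1.1 + 1)) =
        t.1.1 + t.2.2.1 * P + (t.2.1.1 + 1) * W := by rw [hWP]; ring
      rw [h4]
      have h5 : t.1.1 + t.2.2.1 * P + (t.2.1.1 + 1) * W < (J + 1) * W := by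
        have : (J + 1) * W = J * W + W := by ring
        omega
      exact_mod_cast h5
    rw [mem_degreeLT, degree_eq_natDegree hH0] at hlt
    exact_mod_cast hlt
  have hroot : ∀ x : F, x ≠ 0 →
      ∑ i ∈ Finset.range (2 * ν + 3), (x + a / x) ^ p ^ i = s → H.eval x = 0 := by
    intro x hx hxs
    have hai : ∀ i, s ^ p ^ i = s := by
      intro i
      induction i with
      | zero => simp
      | succ k ih => rw [pow_succ, pow_mul, ih, hs]
    have key : (s - ∑ i ∈ Finset.range (ν + 1 + 1), (x + a / x) ^ p ^ i) ^ P =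
        ∑ i ∈ Finset.range (ν + 1), (x + a / x) ^ p ^ i := by
      rw [hP, sub_pow_char_pow, hai, sum_pow_char_pow]
      have e1 : 2 * ν + 3 = (ν + 1) + (ν + 1 + 1) := by ring
      rw [e1, Finset.sum_range_add] at hxs
      rw [sub_eq_iff_eq_add, ← hxs]
      congr 1
      refine Finset.sum_congr rfl fun i _ => ?_
      rw [← pow_mul, ← pow_add, add_comm i]
    have hT : ∀ t, ((d t) ^ W * (T t).eval x) ^ P * x ^ P = d t * (V t).eval x := by
      intro t
      have hk : t.2.2.1 * P' ≤ P := (Nat.le_add_right _ _).trans (hkP' _)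
      have hk2 : t.2.2.1 * P ≤ W := (Nat.le_add_right _ _).trans (hkP _)
      have hWPq : W * P = p ^ (2 * ν + 3) := by rw [hW, hP, ← pow_add]; congr 1; ring
      simp only [T, V, eval_mul, eval_pow, eval_X, eval_neg,
        artinSchreierNumerator_eval _ ha hx, zero_sub, mul_neg, neg_neg, ← hP, ← hP']
      have e0 : ((x ^ P * (s - ∑ i ∈ Finset.range (ν + 1 + 1), (x + a / x) ^ p ^ i)) ^ t.2.2.1) ^ P
          = ((x ^ P) ^ P) ^ t.2.2.1 *
            (∑ i ∈ Finset.range (ν + 1), (x + a / x) ^ p ^ i) ^ t.2.2.1 := by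
        rw [← pow_mul, mul_comm t.2.2.1 P, pow_mul, mul_pow, key, mul_pow]
      rw [mul_pow, mul_pow, e0, ← pow_mul (d t), hWPq, hxq,
        mul_pow (x ^ P') _ t.2.2.1]
      have e2 : (x ^ (t.1.1 + t.2.1.1 * W + (W - t.2.2.1 * P))) ^ P * ((x ^ P) ^ P) ^ t.2.2.1
          = x ^ (t.1.1 * P + t.2.1.1 + 1) := by
        rw [← pow_mul, ← pow_mul, ← pow_mul, ← pow_add]
        obtain ⟨r, hr⟩ := Nat.exists_eq_add_of_le hk2
        have : W - t.2.2.1 * P = r := by omega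
        rw [this]
        have e3 : (t.1.1 + t.2.1.1 * W + r) * P + P * (P * t.2.2.1) =
            t.1.1 * P + (W * P) * t.2.1.1 + W * P := by rw [hr]; ring
        rw [e3, hWPq, pow_add, pow_add, pow_mul x (p ^ _), hxq, pow_succ, pow_add]
      have e4 : x ^ (t.1.1 * P + t.2.1.1 + 1 + (P - t.2.2.1 * P')) * (x ^ P') ^ t.2.2.1 =
          x ^ (t.1.1 * P + t.2.1.1 + 1) * x ^ P := by
        rw [← pow_mul, ← pow_add, ← pow_add]
        congr 1
        rw [mul_comm P']
        omega
      calc _ = d t * ((x ^ (t.1.1 + t.2.1.1 * W + (W - t.2.2.1 * P))) ^ P *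
            ((x ^ P) ^ P) ^ t.2.2.1) * x ^ P *
            (∑ i ∈ Finset.range (ν + 1), (x + a / x) ^ p ^ i) ^ t.2.2.1 := by ring
        _ = _ := by rw [e2, mul_assoc (d t), ← e4]; ring
    have hsumP : ∀ f : ι → F, (∑ t, f t) ^ P = ∑ t, f t ^ P :=
      fun f => sum_pow_char_pow p (ν + 1) Finset.univ f
    have h1 : (H.eval x) ^ P * x ^ P = 0 := by
      rw [hH, eval_finsetSum, hsumP, Finset.sum_mul]
      have h2 := congrArg (eval x) hd'
      rw [eval_finsetSum, eval_zero] at h2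
      rw [← h2]
      refine Finset.sum_congr rfl fun t _ => ?_
      simp only [eval_mul, eval_C]
      exact hT t
    have h3 := (mul_eq_zero.mp h1).resolve_right (pow_ne_zero _ hx)
    exact pow_eq_zero_iff hPpos.ne' |>.mp h3
  have hsub : (Finset.univ.filter fun x : F => x ≠ 0 ∧
      ∑ i ∈ Finset.range (2 * ν + 3), (x + a / x) ^ p ^ i = s) ⊆ H.roots.toFinset := by
    intro x hx
    simp only [Finset.mem_filter, Finset.mem_univ, true_and] at hx
    rw [Multiset.mem_toFinset, mem_roots hH0]
    exact hroot x hx.1 hx.2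
  have h1 := (Finset.card_le_card hsub).trans
    ((Multiset.toFinset_card_le _).trans (card_roots' H))
  have h2 : (J + 1) * W = p ^ (2 * ν + 2) + 3 * p ^ (ν + 2) := by
    rw [hJ, hP', hW, add_mul, add_mul, ← pow_add]
    have : ν + (ν + 2) = 2 * ν + 2 := by ring
    rw [this]; ring
  omega

end Stepanov

section MonicPolynomials

open Polynomial

theorem finite_monic_natDegree_eq (k : Type*) [Field k] [Finite k] (d : ℕ) :
    {g : k[X] | g.Monic ∧ g.natDegree = d}.Finite := by
  have : Function.Injective
      (fun (g : {g : k[X] | g.Monic ∧ g.natDegree = d}) (i : Fin (d + 1)) => g.1.coeff i) := by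
    rintro ⟨g, hg, hgd⟩ ⟨h, hh, hhd⟩ hgh
    refine Subtype.ext (Polynomial.ext fun n => ?_)
    by_cases hn : n < d + 1
    · exact congrFun hgh ⟨n, hn⟩
    · show g.coeff n = h.coeff n
      rw [coeff_eq_zero_of_natDegree_lt (by rw [hgd]; omega),
        coeff_eq_zero_of_natDegree_lt (by rw [hhd]; omega)]
  have := Finite.of_injective _ this
  exact Set.toFinite _
  

/-- The monic polynomials of degree `d` over a finite field. -/
noncomputable def monicsOfDegree (k : Type*) [Field k] [Finite k] (d : ℕ) : Finset k[X] :=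
  (finite_monic_natDegree_eq k d).toFinset

theorem mem_monicsOfDegree {k : Type*} [Field k] [Finite k] {d : ℕ} {g : k[X]} :
    g ∈ monicsOfDegree k d ↔ g.Monic ∧ g.natDegree = d := by
  simp [monicsOfDegree]

/-- The irreducible monic polynomials of degree `d` over a finite field. -/
noncomputable def irreduciblesOfDegree (k : Type*) [Field k] [Finite k] (d : ℕ) : Finset k[X] :=
  ((finite_monic_natDegree_eq k d).subset
    (t := {g : k[X] | (g.Monic ∧ g.natDegree = d) ∧ Irreducible g}) fun _ h => h.1).toFinset

theorem mem_irreduciblesOfDegree {k : Type*} [Field k] [Finite k] {d : ℕ} {g : k[X]} :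
    g ∈ irreduciblesOfDegree k d ↔ (g.Monic ∧ g.natDegree = d) ∧ Irreducible g := by
  simp [irreduciblesOfDegree]

/-- The degree of a monic polynomial counted through its prime power divisors. -/
theorem natDegree_eq_sum_prime_pow_dvd {k : Type*} [Field k] [Finite k] {d : ℕ} {g : k[X]}
    (hg : g ∈ monicsOfDegree k d) [DecidableRel fun g h : k[X] => g ∣ h] :
    ∑ e ∈ Finset.Icc 1 d, ∑ P ∈ irreduciblesOfDegree k e, ∑ j ∈ Finset.Icc 1 d,
      (if P ^ j ∣ g then e else 0) = d := by
  classical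
  obtain ⟨hgm, hgd⟩ := mem_monicsOfDegree.1 hg
  have hg0 : g ≠ 0 := hgm.ne_zero
  open UniqueFactorizationMonoid in
  have hcount : ∀ P : k[X], P.Monic → Irreducible P → ∀ j,
      P ^ j ∣ g ↔ j ≤ (normalizedFactors g).count P := by
    intro P hPm hP j
    have h1 := emultiplicity_eq_count_normalizedFactors hP hg0
    rw [hPm.normalize_eq_self] at h1
    rw [pow_dvd_iff_le_emultiplicity, h1]
    exact Nat.cast_le
  open UniqueFactorizationMonoid in
  have hdeg : ∑ P ∈ (normalizedFactors g).toFinset, (normalizedFactors g).count P * P.natDegree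
      = d := by
    have h2 : (normalizedFactors g).prod = g := by
      have := prod_normalizedFactors_eq hg0
      rw [this, hgm.normalize_eq_self]
    rw [← hgd]
    conv_rhs => rw [← h2]
    rw [natDegree_multiset_prod _ (zero_notMem_normalizedFactors g),
      Finset.sum_multiset_map_count]
    simp
  open UniqueFactorizationMonoid in
  have hmem : ∀ P : k[X], P ∈ normalizedFactors g ↔ P.Monic ∧ Irreducible P ∧ P ∣ g := by
    intro P
    constructor
    · intro h
      have h3 := normalize_normalized_factor P h
      have h4 := irreducible_of_normalized_factor P h
      exact ⟨by rw [← h3]; exact monic_normalize h4.ne_zero, h4, dvd_of_mem_normalizedFactors h⟩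
    · rintro ⟨h1, h2, h3⟩
      rw [mem_normalizedFactors_iff' hg0]
      exact ⟨h2, h1.normalize_eq_self, h3⟩
  open UniqueFactorizationMonoid in
  have hin : ∀ e ∈ Finset.Icc 1 d, ∀ P ∈ irreduciblesOfDegree k e,
      ∑ j ∈ Finset.Icc 1 d, (if P ^ j ∣ g then e else 0) =
        (normalizedFactors g).count P * P.natDegree := by
    intro e he P hP
    obtain ⟨⟨hPm, hPd⟩, hPi⟩ := mem_irreduciblesOfDegree.1 hP
    rw [Finset.mem_Icc] at he
    rw [← Finset.sum_filter, Finset.sum_const, smul_eq_mul, hPd]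
    congr 1
    have : Finset.filter (fun j => P ^ j ∣ g) (Finset.Icc 1 d) =
        Finset.Icc 1 ((normalizedFactors g).count P) := by
      ext j
      simp only [Finset.mem_filter, Finset.mem_Icc, hcount P hPm hPi]
      constructor
      · tauto
      · rintro ⟨h1, h2⟩
        refine ⟨⟨h1, ?_⟩, h2⟩
        have h5 := natDegree_le_of_dvd ((hcount P hPm hPi j).2 h2) hg0
        rw [natDegree_pow, hPd, hgd] at h5
        nlinarith
    rw [this]; simp
  rw [Finset.sum_congr rfl fun e he => Finset.sum_congr rfl (hin e he)]
  rw [Finset.sum_sigma', ← hdeg]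
  symm
  refine Finset.sum_of_injOn (fun P => ⟨P.natDegree, P⟩) ?_ ?_ ?_ ?_
  · intro P _ Q _ h
    exact eq_of_heq (Sigma.mk.inj h).2
  · intro P hP
    have hP' := (hmem P).1 (Multiset.mem_toFinset.1 (Finset.mem_coe.1 hP))
    simp only [Finset.coe_sigma, Set.mem_sigma_iff, Finset.mem_coe, Finset.mem_Icc,
      mem_irreduciblesOfDegree]
    have := natDegree_le_of_dvd hP'.2.2 hg0
    exact ⟨⟨hP'.2.1.natDegree_pos, by omega⟩, ⟨hP'.1, trivial⟩, hP'.2.1⟩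
  · rintro ⟨e, P⟩ hP hn
    simp only [Finset.mem_sigma, mem_irreduciblesOfDegree] at hP
    rw [Multiset.count_eq_zero_of_notMem, zero_mul]
    intro hPg
    apply hn
    refine ⟨P, Finset.mem_coe.2 (Multiset.mem_toFinset.2 hPg), ?_⟩
    obtain ⟨_, ⟨_, rfl⟩, _⟩ := hP
    rfl
  · intro P _; rfl

/-- Newton's identities for the sums of a completely multiplicative function over monic
polynomials. -/
theorem newton_monic_sums {k : Type*} [Field k] [Finite k] (f : k[X] → ℂ) (hf1 : f 1 = 1)
    (hf : ∀ g h : k[X], g.Monic → h.Monic → f (g * h) = f g * f h) (d : ℕ) :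
    (d : ℂ) * ∑ g ∈ monicsOfDegree k d, f g =
      ∑ j ∈ Finset.Icc 1 d,
        (∑ e ∈ j.divisors, (e : ℂ) * ∑ P ∈ irreduciblesOfDegree k e, f P ^ (j / e)) *
          ∑ g ∈ monicsOfDegree k (d - j), f g := by
  classical
  have hpow : ∀ P : k[X], P.Monic → ∀ j, f (P ^ j) = f P ^ j := by
    intro P hP j
    induction j with
    | zero => simp [hf1]
    | succ j ih => rw [pow_succ, hf _ _ (hP.pow j) hP, ih, pow_succ]
  have h1 : (d : ℂ) * ∑ g ∈ monicsOfDegree k d, f g =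
      ∑ e ∈ Finset.Icc 1 d, ∑ P ∈ irreduciblesOfDegree k e, ∑ j ∈ Finset.Icc 1 d,
        (e : ℂ) * ∑ g ∈ monicsOfDegree k d, if P ^ j ∣ g then f g else 0 := by
    have : ∀ g ∈ monicsOfDegree k d, (d : ℂ) * f g =
        ∑ e ∈ Finset.Icc 1 d, ∑ P ∈ irreduciblesOfDegree k e, ∑ j ∈ Finset.Icc 1 d,
          (e : ℂ) * if P ^ j ∣ g then f g else 0 := by
      intro g hg
      conv_lhs => rw [← natDegree_eq_sum_prime_pow_dvd hg]
      push_cast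
      simp only [Finset.sum_mul]
      refine Finset.sum_congr rfl fun e _ => Finset.sum_congr rfl fun P _ =>
        Finset.sum_congr rfl fun j _ => ?_
      split_ifs <;> simp
    rw [Finset.mul_sum, Finset.sum_congr rfl this, Finset.sum_comm]
    refine Finset.sum_congr rfl fun e _ => ?_
    rw [Finset.sum_comm]
    refine Finset.sum_congr rfl fun P _ => ?_
    rw [Finset.sum_comm]
    refine Finset.sum_congr rfl fun j _ => ?_
    rw [Finset.mul_sum]
  have h2 : ∀ e ∈ Finset.Icc 1 d, ∀ P ∈ irreduciblesOfDegree k e, ∀ j ∈ Finset.Icc 1 d,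
      (∑ g ∈ monicsOfDegree k d, if P ^ j ∣ g then f g else 0) =
        if e * j ≤ d then f P ^ j * ∑ g ∈ monicsOfDegree k (d - e * j), f g else 0 := by
    intro e he P hP j hj
    obtain ⟨⟨hPm, hPd⟩, hPi⟩ := mem_irreduciblesOfDegree.1 hP
    have hPj : (P ^ j).natDegree = e * j := by rw [natDegree_pow, hPd, mul_comm]
    rw [← Finset.sum_filter]
    split_ifs with hd
    · rw [Finset.mul_sum]
      symm
      refine Finset.sum_bij (fun g _ => P ^ j * g) ?_ ?_ ?_ ?_
      · intro g hg
        rw [mem_monicsOfDegree] at hg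
        rw [Finset.mem_filter, mem_monicsOfDegree]
        refine ⟨⟨(hPm.pow j).mul hg.1, ?_⟩, dvd_mul_right _ _⟩
        rw [(hPm.pow j).natDegree_mul hg.1, hPj, hg.2]; omega
      · intro g _ h _ hgh
        exact mul_left_cancel₀ (hPm.pow j).ne_zero hgh
      · intro g hg
        rw [Finset.mem_filter, mem_monicsOfDegree] at hg
        obtain ⟨⟨hgm, hgd⟩, h, rfl⟩ := hg
        have hh : h.Monic := (hPm.pow j).of_mul_monic_left hgm
        refine ⟨h, ?_, rfl⟩
        rw [mem_monicsOfDegree]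
        rw [(hPm.pow j).natDegree_mul hh, hPj] at hgd
        exact ⟨hh, by omega⟩
      · intro g hg
        rw [mem_monicsOfDegree] at hg
        rw [hf _ _ (hPm.pow j) hg.1, hpow P hPm]
    · rw [Finset.filter_false_of_mem, Finset.sum_empty]
      intro g hg hdvd
      rw [mem_monicsOfDegree] at hg
      have := natDegree_le_of_dvd hdvd hg.1.ne_zero
      omega
  rw [h1, Finset.sum_congr rfl fun e he => Finset.sum_congr rfl fun P hP =>
    Finset.sum_congr rfl fun j hj => by rw [h2 e he P hP j hj]]
  have h3 : ∀ e ∈ Finset.Icc 1 d, (∑ P ∈ irreduciblesOfDegree k e, ∑ j ∈ Finset.Icc 1 d,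
      (e : ℂ) * if e * j ≤ d then f P ^ j * ∑ g ∈ monicsOfDegree k (d - e * j), f g else 0) =
      ∑ j ∈ Finset.Icc 1 d, if e * j ≤ d then
        ((e : ℂ) * ∑ P ∈ irreduciblesOfDegree k e, f P ^ j) *
          ∑ g ∈ monicsOfDegree k (d - e * j), f g else 0 := by
    intro e he
    rw [Finset.sum_comm]
    refine Finset.sum_congr rfl fun j _ => ?_
    split_ifs
    · rw [mul_assoc, Finset.sum_mul, Finset.mul_sum]
    · simp
  rw [Finset.sum_congr rfl h3, Finset.sum_sigma']
  simp only [Finset.sum_mul, Finset.sum_sigma']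
  rw [← Finset.sum_filter]
  symm
  refine Finset.sum_bij (fun x _ => ⟨x.2, x.1 / x.2⟩) ?_ ?_ ?_ ?_
  · rintro ⟨j, e⟩ h
    simp only [Finset.mem_sigma, Finset.mem_Icc, Nat.mem_divisors, Finset.mem_filter] at h ⊢
    obtain ⟨⟨h1, h2⟩, ⟨m, rfl⟩, h4⟩ := h
    have he : 0 < e := Nat.pos_of_ne_zero (by rintro rfl; simp at h4)
    have hm : 0 < m := Nat.pos_of_ne_zero (by rintro rfl; simp at h4)
    rw [Nat.mul_div_cancel_left _ he]
    refine ⟨⟨⟨he, ?_⟩, hm, ?_⟩, h2⟩ <;> nlinarith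
  · rintro ⟨j, e⟩ h ⟨j', e'⟩ h' heq
    simp only [Finset.mem_sigma, Nat.mem_divisors] at h h'
    simp only [Sigma.mk.injEq, heq_eq_eq] at heq
    obtain ⟨rfl, h5⟩ := heq
    have : j = j' := by
      rw [← Nat.mul_div_cancel' h.2.1, h5, Nat.mul_div_cancel' h'.2.1]
    subst this; rfl
  · rintro ⟨e, m⟩ h
    simp only [Finset.mem_sigma, Finset.mem_Icc, Finset.mem_filter] at h
    obtain ⟨⟨⟨h1, h2⟩, h3, h4⟩, h5⟩ := h
    refine ⟨⟨e * m, e⟩, ?_, ?_⟩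
    · simp only [Finset.mem_sigma, Finset.mem_Icc, Nat.mem_divisors]
      refine ⟨⟨?_, h5⟩, dvd_mul_right _ _, ?_⟩
      · exact Nat.mul_pos h1 h3
      · exact (Nat.mul_pos h1 h3).ne'
    · simp [Nat.mul_div_cancel_left _ h1]
  · rintro ⟨j, e⟩ h
    simp only [Finset.mem_sigma, Nat.mem_divisors] at h
    simp only [Nat.mul_div_cancel' h.2.1]

end MonicPolynomials

section MonicPolynomials

open Polynomial

theorem card_minpoly_fiber {k F : Type*} [Field k] [Finite k] [Field F] [Fintype F] [Algebra k F]
    [DecidableEq k[X]] {e : ℕ} {P : k[X]} (hP : P ∈ irreduciblesOfDegree k e)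
    (he : e ∣ Module.finrank k F) :
    (Finset.univ.filter fun x : F => minpoly k x = P).card = e := by
  obtain ⟨⟨hPm, hPd⟩, hPi⟩ := mem_irreduciblesOfDegree.1 hP
  have : Fact (Irreducible P) := ⟨hPi⟩
  have hfr : Module.finrank k (AdjoinRoot P) = e := by
    rw [(AdjoinRoot.powerBasis hPi.ne_zero).finrank, AdjoinRoot.powerBasis_dim, hPd]
  have : Module.Finite k (AdjoinRoot P) := PowerBasis.finite (AdjoinRoot.powerBasis hPi.ne_zero)
  have : Finite (AdjoinRoot P) := Module.finite_of_finite k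
  have h1 := FiniteField.natCard_algHom_of_finrank_dvd (F := k) (K := AdjoinRoot P) (L := F)
    (by rw [hfr]; exact he)
  rw [hfr, Nat.card_congr (AdjoinRoot.equiv F k P hPi.ne_zero)] at h1
  classical
  rw [← h1, Nat.card_eq_fintype_card, Fintype.card_subtype]
  congr 1
  ext x
  simp only [Finset.mem_filter, Finset.mem_univ, true_and, mem_aroots]
  constructor
  · rintro rfl
    exact ⟨hPi.ne_zero, minpoly.aeval k x⟩
  · rintro ⟨_, h⟩
    exact (minpoly.eq_of_irreducible_of_monic hPi h hPm).symm

theorem sum_minpoly_eq {k F : Type*} [Field k] [Finite k] [Field F] [Fintype F] [Algebra k F]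
    (f : k[X] → ℂ) {j : ℕ} (hj : Module.finrank k F = j) :
    ∑ x : F, f (minpoly k x) ^ (j / (minpoly k x).natDegree) =
      ∑ e ∈ j.divisors, (e : ℂ) * ∑ P ∈ irreduciblesOfDegree k e, f P ^ (j / e) := by
  classical
  have hj0 : j ≠ 0 := by rw [← hj]; exact Module.finrank_pos.ne'
  have hx_int : ∀ x : F, IsIntegral k x := fun x => Algebra.IsIntegral.isIntegral x
  simp only [Finset.mul_sum, Finset.sum_sigma']
  rw [← Finset.sum_fiberwise_of_maps_to (s := Finset.univ)
    (t := j.divisors.sigma fun e => irreduciblesOfDegree k e)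
    (g := fun x : F => (⟨(minpoly k x).natDegree, minpoly k x⟩ : (_ : ℕ) × k[X]))]
  · refine Finset.sum_congr rfl ?_
    rintro ⟨e, P⟩ h
    simp only [Finset.mem_sigma, Nat.mem_divisors] at h
    have hd := (mem_irreduciblesOfDegree.1 h.2).1.2
    have : (Finset.univ.filter fun x : F =>
        (⟨(minpoly k x).natDegree, minpoly k x⟩ : (_ : ℕ) × k[X]) = ⟨e, P⟩) =
        Finset.univ.filter fun x : F => minpoly k x = P := by
      ext x
      simp only [Finset.mem_filter, Finset.mem_univ, true_and, Sigma.mk.injEq, heq_eq_eq]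
      constructor
      · exact fun h => h.2
      · rintro rfl; exact ⟨hd, rfl⟩
    rw [this, Finset.sum_congr rfl (g := fun _ => f P ^ (j / e)), Finset.sum_const,
      card_minpoly_fiber h.2 (by rw [hj]; exact h.1.1), nsmul_eq_mul]
    intro x hx
    rw [(Finset.mem_filter.1 hx).2, hd]
  · intro x _
    simp only [Finset.mem_sigma, Nat.mem_divisors, mem_irreduciblesOfDegree]
    refine ⟨⟨?_, hj0⟩, ⟨minpoly.monic (hx_int x), trivial⟩, minpoly.irreducible (hx_int x)⟩
    rw [← hj]
    exact minpoly.degree_dvd (hx_int x)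

open IntermediateField in
theorem nextCoeff_minpoly_inv {k F : Type*} [Field k] [Field F] [Algebra k F]
    {x : F} (hx : x ≠ 0) (hi : IsIntegral k x) :
    (minpoly k x⁻¹).nextCoeff = (minpoly k x).coeff 1 / (minpoly k x).coeff 0 := by
  have hc0 := minpoly.coeff_zero_ne_zero hi hx
  have hi' : IsIntegral k x⁻¹ := hi.inv
  have hdeg : (minpoly k x⁻¹).natDegree = (minpoly k x).natDegree := by
    rw [← adjoin.finrank hi, ← adjoin.finrank hi']
    have : k⟮x⁻¹⟯ = k⟮x⟯ := by
      apply le_antisymm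
      · rw [adjoin_simple_le_iff]
        exact inv_mem (mem_adjoin_simple_self k x)
      · rw [adjoin_simple_le_iff]
        have := inv_mem (mem_adjoin_simple_self k x⁻¹)
        rwa [inv_inv] at this
    rw [this]
  set P := minpoly k x with hP
  have htr : P.natTrailingDegree = 0 := natTrailingDegree_eq_zero.2 (Or.inr hc0)
  have htc : P.trailingCoeff = P.coeff 0 := by rw [trailingCoeff, htr]
  have hrd : P.reverse.natDegree = P.natDegree := by rw [reverse_natDegree, htr, Nat.sub_zero]
  have hQm : (P.reverse * C (P.coeff 0)⁻¹).Monic := by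
    rw [Monic, leadingCoeff_mul, reverse_leadingCoeff, htc, leadingCoeff_C, mul_inv_cancel₀ hc0]
  have hroot : aeval x⁻¹ (P.reverse * C (P.coeff 0)⁻¹) = 0 := by
    rw [map_mul]
    have : aeval x⁻¹ P.reverse = 0 := by
      have hinv : Invertible x := invertibleOfNonzero hx
      have h1 := eval₂_reverse_mul_pow (algebraMap k F) x P
      rw [← aeval_def, ← aeval_def, hP, minpoly.aeval, ← hP, invOf_eq_inv] at h1
      exact (mul_eq_zero.1 h1).resolve_right (pow_ne_zero _ hx)
    rw [this, zero_mul]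
  have hQ : P.reverse * C (P.coeff 0)⁻¹ = minpoly k x⁻¹ := by
    refine eq_of_monic_of_dvd_of_natDegree_le (minpoly.monic hi') hQm (minpoly.dvd _ _ hroot) ?_
    rw [hdeg, natDegree_mul_C (inv_ne_zero hc0), hrd]
  have hpos : 0 < P.natDegree := minpoly.natDegree_pos hi
  rw [nextCoeff_of_natDegree_pos (by rw [hdeg]; exact hpos), hdeg, ← hQ, coeff_mul_C,
    coeff_reverse, revAt_le (by omega), Nat.sub_sub_self hpos, div_eq_mul_inv]

/-- The multiplicative function on monic polynomials attached to a Kloosterman sum. -/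
noncomputable def kloostermanWeight {k : Type*} [Field k] (ψ : AddChar k ℂ) (a : k) (g : k[X]) :
    ℂ :=
  open Classical in
  if g.coeff 0 = 0 then 0 else ψ (-g.nextCoeff - a * (g.coeff 1 / g.coeff 0))

theorem kloostermanWeight_one {k : Type*} [Field k] (ψ : AddChar k ℂ) (a : k) :
    kloostermanWeight ψ a 1 = 1 := by
  simp [kloostermanWeight, nextCoeff, coeff_one]

theorem kloostermanWeight_mul {k : Type*} [Field k] (ψ : AddChar k ℂ) (a : k) (g h : k[X])
    (hg : g.Monic) (hh : h.Monic) :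
    kloostermanWeight ψ a (g * h) = kloostermanWeight ψ a g * kloostermanWeight ψ a h := by
  unfold kloostermanWeight
  rw [mul_coeff_zero]
  by_cases h1 : g.coeff 0 = 0
  · simp [h1]
  by_cases h2 : h.coeff 0 = 0
  · simp [h2]
  rw [if_neg (mul_ne_zero h1 h2), if_neg h1, if_neg h2, ← AddChar.map_add_eq_mul,
    hg.nextCoeff_mul hh, mul_coeff_one]
  congr 1
  field_simp
  ring

theorem kloostermanWeight_minpoly {k F : Type*} [Field k] [Field F] [Algebra k F]
    [FiniteDimensional k F] (ψ : AddChar k ℂ) (a : k) (x : F) :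
    kloostermanWeight ψ a (minpoly k x) ^ (Module.finrank k F / (minpoly k x).natDegree) =
      open Classical in
      if x = 0 then 0 else ψ (Algebra.trace k F (x + algebraMap k F a / x)) := by
  classical
  have hx_int : ∀ x : F, IsIntegral k x := fun x => Algebra.IsIntegral.isIntegral x
  unfold kloostermanWeight
  split_ifs with h0 hx hx
  · subst hx
    simp only [minpoly.zero, natDegree_X, Nat.div_one]
    exact zero_pow Module.finrank_pos.ne'
  · exact absurd h0 (minpoly.coeff_zero_ne_zero (hx_int x) hx)
  · subst hx; simp at h0
  · have hfr : Module.finrank k F / (minpoly k x).natDegree =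
        Module.finrank (IntermediateField.adjoin k {x}) F := by
      rw [← IntermediateField.adjoin.finrank (hx_int x),
        ← Module.finrank_mul_finrank k (IntermediateField.adjoin k {x}) F]
      exact Nat.mul_div_cancel_left _ Module.finrank_pos
    have hfr' : Module.finrank (IntermediateField.adjoin k {x⁻¹}) F =
        Module.finrank (IntermediateField.adjoin k {x}) F := by
      have : IntermediateField.adjoin k {x⁻¹} = IntermediateField.adjoin k {x} := by
        apply le_antisymm
        · rw [IntermediateField.adjoin_simple_le_iff]
          exact inv_mem (IntermediateField.mem_adjoin_simple_self k x)
        · rw [IntermediateField.adjoin_simple_le_iff]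
          have := inv_mem (IntermediateField.mem_adjoin_simple_self k x⁻¹)
          rwa [inv_inv] at this
      rw [this]
    have htr : Algebra.trace k F (x + algebraMap k F a / x) =
        Algebra.trace k F x + a * Algebra.trace k F x⁻¹ := by
      rw [map_add, div_eq_mul_inv, ← Algebra.smul_def, map_smul, smul_eq_mul]
    rw [htr, ← AddChar.map_nsmul_eq_pow, hfr, trace_eq_finrank_mul_minpoly_nextCoeff,
      trace_eq_finrank_mul_minpoly_nextCoeff, hfr', nextCoeff_minpoly_inv hx (hx_int x)]
    congr 1
    rw [nsmul_eq_mul]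
    ring

end MonicPolynomials

section MonicPolynomials

open Polynomial

theorem sum_monicsOfDegree_zero {k : Type*} [Field k] [Finite k] (f : k[X] → ℂ) :
    ∑ g ∈ monicsOfDegree k 0, f g = f 1 := by
  have : monicsOfDegree k 0 = {1} := by
    ext g
    rw [mem_monicsOfDegree, Finset.mem_singleton]
    constructor
    · rintro ⟨h1, h2⟩; exact h1.natDegree_eq_zero.1 h2
    · rintro rfl; exact ⟨monic_one, natDegree_one⟩
  rw [this, Finset.sum_singleton]

theorem sum_kloostermanWeight_eq_zero {k : Type*} [Field k] [Finite k] {ψ : AddChar k ℂ}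
    (hψ : ψ ≠ 1) (a : k) {d : ℕ} (hd : 3 ≤ d) :
    ∑ g ∈ monicsOfDegree k d, kloostermanWeight ψ a g = 0 := by
  obtain ⟨t, ht⟩ := AddChar.ne_one_iff.1 hψ
  have hdeg : ∀ s : k, (C s * X ^ (d - 1) : k[X]).degree < d := fun s =>
    (degree_C_mul_X_pow_le _ _).trans_lt (by exact_mod_cast (by omega : d - 1 < d))
  have hmem : ∀ s : k, ∀ g ∈ monicsOfDegree k d, g + C s * X ^ (d - 1) ∈ monicsOfDegree k d := by
    intro s g hg
    rw [mem_monicsOfDegree] at hg ⊢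
    have hgd : g.degree = d := by rw [degree_eq_natDegree hg.1.ne_zero, hg.2]
    have : (C s * X ^ (d - 1) : k[X]).degree < g.degree := by rw [hgd]; exact hdeg s
    exact ⟨hg.1.add_of_left this, by rw [natDegree_add_eq_left_of_degree_lt this, hg.2]⟩
  have key : ∑ g ∈ monicsOfDegree k d, kloostermanWeight ψ a g =
      ∑ g ∈ monicsOfDegree k d, ψ t * kloostermanWeight ψ a g := by
    symm
    refine Finset.sum_bij (fun g _ => g + C (-t) * X ^ (d - 1)) (hmem _) ?_ ?_ ?_
    · intro g _ h _ hgh; simpa using hgh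
    · intro g hg
      refine ⟨g + C t * X ^ (d - 1), hmem t g hg, ?_⟩
      simp
    · intro g hg
      have hg' := hmem (-t) g hg
      rw [mem_monicsOfDegree] at hg hg'
      unfold kloostermanWeight
      have h0 : (g + C (-t) * X ^ (d - 1)).coeff 0 = g.coeff 0 := by
        rw [coeff_add, coeff_C_mul_X_pow, if_neg (by omega), add_zero]
      have h1 : (g + C (-t) * X ^ (d - 1)).coeff 1 = g.coeff 1 := by
        rw [coeff_add, coeff_C_mul_X_pow, if_neg (by omega), add_zero]
      have h2 : (g + C (-t) * X ^ (d - 1)).nextCoeff = g.nextCoeff - t := by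
        rw [nextCoeff_of_natDegree_pos (by omega), nextCoeff_of_natDegree_pos (by omega), hg.2,
          hg'.2, coeff_add, coeff_C_mul_X_pow, if_pos rfl, sub_eq_add_neg]
      rw [h0, h1, h2]
      split_ifs
      · simp
      · rw [← AddChar.map_add_eq_mul]; congr 1; ring
  rw [← Finset.mul_sum] at key
  have : (1 - ψ t) * ∑ g ∈ monicsOfDegree k d, kloostermanWeight ψ a g = 0 := by
    rw [sub_mul, one_mul, ← key, sub_self]
  exact (mul_eq_zero.1 this).resolve_left (sub_ne_zero.2 (Ne.symm ht))

theorem sum_kloostermanWeight_two {k : Type*} [Field k] [Fintype k] {ψ : AddChar k ℂ}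
    (hψ : ψ ≠ 1) {a : k} (ha : a ≠ 0) :
    ∑ g ∈ monicsOfDegree k 2, kloostermanWeight ψ a g = Fintype.card k := by
  classical
  have hform : ∀ b c : k, (X ^ 2 + C b * X + C c : k[X]) ∈ monicsOfDegree k 2 := by
    intro b c
    rw [mem_monicsOfDegree]
    have : (X ^ 2 + C b * X + C c : k[X]) = C 1 * X ^ 2 + C b * X + C c := by simp
    rw [this]
    refine ⟨?_, natDegree_quadratic one_ne_zero⟩
    rw [Monic, leadingCoeff_quadratic one_ne_zero]
  have h1 : ∑ g ∈ monicsOfDegree k 2, kloostermanWeight ψ a g =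
      ∑ c : k, ∑ b : k, if c = 0 then 0 else ψ (b * (-1 - a / c)) := by
    rw [← Finset.sum_product']
    symm
    refine Finset.sum_bij (fun x _ => X ^ 2 + C x.2 * X + C x.1) (fun x _ => hform _ _) ?_ ?_ ?_
    · rintro ⟨c, b⟩ _ ⟨c', b'⟩ _ h
      have h0 := congrArg (fun g => coeff g 0) h
      have h1 := congrArg (fun g => coeff g 1) h
      simp [coeff_X, coeff_C] at h0 h1
      rw [h0, h1]
    · intro g hg
      rw [mem_monicsOfDegree] at hg
      refine ⟨(g.coeff 0, g.coeff 1), Finset.mem_product.2 ⟨Finset.mem_univ _, Finset.mem_univ _⟩, ?_⟩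
      have := hg.1.as_sum
      rw [hg.2, Finset.sum_range_succ, Finset.sum_range_one] at this
      conv_rhs => rw [this]
      simp only [pow_zero, mul_one, pow_one]
      ring
    · rintro ⟨c, b⟩ _
      have h2 := (mem_monicsOfDegree.1 (hform b c)).2
      unfold kloostermanWeight
      rw [nextCoeff_of_natDegree_pos (by rw [h2]; norm_num), h2]
      have h3 : (X ^ 2 + C b * X + C c : k[X]).coeff 0 = c := by simp
      have h4 : (X ^ 2 + C b * X + C c : k[X]).coeff 1 = b := by simp [coeff_C]
      rw [h3, show 2 - 1 = 1 from rfl, h4]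
      split_ifs
      · rfl
      · congr 1; ring
  have hprim : ∀ t : k, ∑ b : k, ψ (b * t) = if t = 0 then (Fintype.card k : ℂ) else 0 := by
    intro t
    have := AddChar.sum_mulShift t (AddChar.IsPrimitive.of_ne_one hψ)
    exact_mod_cast this
  rw [h1, Finset.sum_eq_single (-a)]
  · rw [Finset.sum_congr rfl (g := fun _ => (1 : ℂ))]
    · simp
    · intro b _
      rw [if_neg (neg_ne_zero.2 ha), show (-1 - a / -a : k) = 0 by field_simp; ring, mul_zero,
        AddChar.map_zero_eq_one]
  · intro c _ hc
    split_ifs with h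
    · simp
    · rw [hprim, if_neg]
      intro h5
      apply hc
      field_simp at h5
      linear_combination -h5
  · simp

/-- The Kloosterman sum over the extension of degree `j`. -/
noncomputable def kloostermanExt {k : Type*} [Field k] [Finite k] (ψ : AddChar k ℂ) (a : k)
    (j : ℕ) : ℂ :=
  ∑ e ∈ j.divisors, (e : ℂ) * ∑ P ∈ irreduciblesOfDegree k e, kloostermanWeight ψ a P ^ (j / e)

theorem kloostermanExt_eq {k F : Type*} [Field k] [Finite k] [Field F] [Fintype F] [Algebra k F]
    [DecidableEq F] (ψ : AddChar k ℂ) (a : k) {j : ℕ} (hj : Module.finrank k F = j) :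
    kloostermanExt ψ a j = ∑ x : F,
      if x = 0 then 0 else ψ (Algebra.trace k F (x + algebraMap k F a / x)) := by
  rw [kloostermanExt, ← sum_minpoly_eq _ hj]
  refine Finset.sum_congr rfl fun x _ => ?_
  rw [← hj, kloostermanWeight_minpoly]
  congr

theorem kloostermanExt_two {k : Type*} [Field k] [Fintype k] {ψ : AddChar k ℂ}
    (hψ : ψ ≠ 1) {a : k} (ha : a ≠ 0) :
    kloostermanExt ψ a 2 = 2 * Fintype.card k - kloostermanExt ψ a 1 ^ 2 := by
  have h1 := newton_monic_sums (kloostermanWeight ψ a) (kloostermanWeight_one ψ a)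
    (kloostermanWeight_mul ψ a) 1
  have h2 := newton_monic_sums (kloostermanWeight ψ a) (kloostermanWeight_one ψ a)
    (kloostermanWeight_mul ψ a) 2
  rw [show Finset.Icc 1 1 = {1} from rfl, Finset.sum_singleton, Nat.sub_self,
    sum_monicsOfDegree_zero, kloostermanWeight_one] at h1
  rw [show Finset.Icc 1 2 = {1, 2} from rfl, Finset.sum_pair (by norm_num), Nat.sub_self,
    sum_monicsOfDegree_zero, kloostermanWeight_one, sum_kloostermanWeight_two hψ ha,
    show 2 - 1 = 1 from rfl] at h2
  change _ = kloostermanExt ψ a 1 * 1 at h1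
  change _ = kloostermanExt ψ a 1 * _ + kloostermanExt ψ a 2 * 1 at h2
  rw [Nat.cast_one, one_mul, mul_one] at h1
  rw [h1] at h2
  push_cast at h2
  linear_combination -h2

theorem kloostermanExt_add_three {k : Type*} [Field k] [Fintype k] {ψ : AddChar k ℂ}
    (hψ : ψ ≠ 1) {a : k} (ha : a ≠ 0) (n : ℕ) :
    kloostermanExt ψ a (n + 3) = -kloostermanExt ψ a 1 * kloostermanExt ψ a (n + 2)
      - Fintype.card k * kloostermanExt ψ a (n + 1) := by
  have h1 := newton_monic_sums (kloostermanWeight ψ a) (kloostermanWeight_one ψ a)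
    (kloostermanWeight_mul ψ a) 1
  have h2 := newton_monic_sums (kloostermanWeight ψ a) (kloostermanWeight_one ψ a)
    (kloostermanWeight_mul ψ a) (n + 3)
  rw [show Finset.Icc 1 1 = {1} from rfl, Finset.sum_singleton, Nat.sub_self,
    sum_monicsOfDegree_zero, kloostermanWeight_one] at h1
  rw [Finset.sum_Icc_succ_top (by omega), Finset.sum_Icc_succ_top (by omega),
    Finset.sum_Icc_succ_top (by omega), Nat.sub_self, sum_monicsOfDegree_zero,
    kloostermanWeight_one, sum_kloostermanWeight_eq_zero hψ a (by omega),
    show n + 3 - (n + 1) = 2 by omega, show n + 3 - (n + 2) = 1 by omega,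
    sum_kloostermanWeight_two hψ ha, Finset.sum_eq_zero] at h2
  · change _ = kloostermanExt ψ a 1 * 1 at h1
    change _ = 0 + kloostermanExt ψ a (n + 1) * _ + kloostermanExt ψ a (n + 2) * _ +
      kloostermanExt ψ a (n + 3) * 1 at h2
    rw [Nat.cast_one, one_mul, mul_one] at h1
    rw [h1] at h2
    linear_combination -h2
  · intro j hj
    rw [Finset.mem_Icc] at hj
    rw [sum_kloostermanWeight_eq_zero hψ a (by omega), mul_zero]

end MonicPolynomials

section WeilBound

theorem norm_kloostermanExt_le {p : ℕ} [Fact p.Prime] {ψ : AddChar (ZMod p) ℂ} (hψ : ψ ≠ 1)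
    (a : ZMod p) (ν : ℕ) :
    ‖kloostermanExt ψ a (2 * ν + 3)‖ ≤ 4 * (p : ℝ) ^ (ν + 3) := by
  classical
  have hp : p.Prime := Fact.out
  let F := GaloisField p (2 * ν + 3)
  have hfr : Module.finrank (ZMod p) F = 2 * ν + 3 := GaloisField.finrank p (by omega)
  have : Fintype F := Fintype.ofFinite F
  have hcard : Fintype.card F = p ^ (2 * ν + 3) := by
    rw [← Nat.card_eq_fintype_card]; exact GaloisField.card p _ (by omega)
  have : CharP F p := inferInstanceAs (CharP (GaloisField p (2 * ν + 3)) p)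
  set T : F → ZMod p := fun x => Algebra.trace (ZMod p) F (x + algebraMap (ZMod p) F a / x) with hT
  set N : ZMod p → ℕ := fun s => (Finset.univ.filter fun x : F => x ≠ 0 ∧ T x = s).card with hN
  have hNle : ∀ s, N s ≤ p ^ (2 * ν + 2) + 3 * p ^ (ν + 2) := by
    intro s
    have h1 := card_traceLevel_le (F := F) (p := p) ν hcard (a := algebraMap (ZMod p) F a)
      (s := algebraMap (ZMod p) F s) (by rw [← map_pow, ZMod.pow_card])
      (by rw [← map_pow, ZMod.pow_card])
    refine le_trans (le_of_eq ?_) h1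
    simp only [hN]
    congr 1
    ext x
    simp only [Finset.mem_filter, Finset.mem_univ, true_and]
    refine and_congr_right fun _ => ?_
    have h2 := FiniteField.algebraMap_trace_eq_sum_pow (ZMod p) F
      (x + algebraMap (ZMod p) F a / x)
    rw [hfr, Nat.card_zmod] at h2
    rw [← h2]
    exact (FaithfulSMul.algebraMap_injective (ZMod p) F).eq_iff.symm
  have hNsum : ∑ s, N s + 1 = p ^ (2 * ν + 3) := by
    have h3 : ∑ s, N s = (Finset.univ.filter fun x : F => x ≠ 0).card := by
      rw [Finset.card_eq_sum_card_fiberwise (f := T) (t := Finset.univ) (by simp)]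
      refine Finset.sum_congr rfl fun s _ => ?_
      rw [Finset.filter_filter]
    rw [h3, Finset.filter_ne', Finset.card_erase_of_mem (Finset.mem_univ _), Finset.card_univ,
      hcard]
    have := pow_pos hp.pos (2 * ν + 3)
    omega
  have hK : kloostermanExt ψ a (2 * ν + 3) = ∑ s, (N s : ℂ) * ψ s := by
    rw [kloostermanExt_eq ψ a hfr]
    have h4 : ∀ s, (N s : ℂ) * ψ s = ∑ x : F with T x = s, if x = 0 then 0 else ψ (T x) := by
      intro s
      rw [Finset.sum_congr rfl (g := fun x => if x ≠ 0 then ψ s else 0)]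
      · rw [← Finset.sum_filter, Finset.filter_filter, Finset.sum_const, nsmul_eq_mul]
        simp only [hN, and_comm]
      · intro x hx
        rw [(Finset.mem_filter.1 hx).2]
        by_cases hx0 : x = 0 <;> simp [hx0]
    rw [Finset.sum_congr rfl fun s _ => h4 s, Finset.sum_fiberwise]
  set B : ℕ := p ^ (2 * ν + 2) + 3 * p ^ (ν + 2) with hB
  have hsum0 : ∑ s, ψ s = 0 := AddChar.sum_eq_zero_of_ne_one hψ
  have hK' : kloostermanExt ψ a (2 * ν + 3) = -∑ s, ((B : ℂ) - N s) * ψ s := by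
    rw [hK]
    simp only [sub_mul, Finset.sum_sub_distrib, ← Finset.mul_sum, hsum0]
    ring
  rw [hK', norm_neg]
  calc ‖∑ s, ((B : ℂ) - N s) * ψ s‖ ≤ ∑ s, ((B : ℝ) - N s) := by
        refine (norm_sum_le _ _).trans (Finset.sum_le_sum fun s _ => ?_)
        rw [norm_mul, AddChar.norm_apply, mul_one]
        have h5 : ((B : ℂ) - N s) = (((B : ℝ) - N s : ℝ) : ℂ) := by push_cast; rfl
        rw [h5, Complex.norm_real, Real.norm_of_nonneg]
        exact sub_nonneg.2 (by exact_mod_cast hNle s)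
    _ = p * B - (p ^ (2 * ν + 3) - 1) := by
        rw [Finset.sum_sub_distrib, Finset.sum_const, Finset.card_univ, ZMod.card, nsmul_eq_mul]
        congr 1
        rw [eq_sub_iff_add_eq]
        exact_mod_cast hNsum
    _ = 3 * (p : ℝ) ^ (ν + 3) + 1 := by
        rw [hB]; push_cast; ring
    _ ≤ 4 * (p : ℝ) ^ (ν + 3) := by
        have : (1 : ℝ) ≤ (p : ℝ) ^ (ν + 3) := one_le_pow₀ (by exact_mod_cast hp.one_le)
        linarith

/-- A linear recurrence of order two with growth at most that of conjugate roots has a nonpositive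
discriminant. -/
theorem sq_le_of_recurrence {v : ℕ → ℝ} {κ P B : ℝ} (hP : 0 < P) (h1 : v 1 = κ)
    (h2 : v 2 = κ ^ 2 - 2 * P) (h3 : ∀ n, v (n + 3) = κ * v (n + 2) - P * v (n + 1))
    (hv : ∀ n, |v (2 * n + 3)| ≤ B * P ^ n) : κ ^ 2 ≤ 4 * P := by
  by_contra! hlt
  set D := √(κ ^ 2 - 4 * P) with hD
  have hDsq : D ^ 2 = κ ^ 2 - 4 * P := Real.sq_sqrt (by linarith)
  have hDpos : 0 < D := Real.sqrt_pos.2 (by linarith)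
  obtain ⟨α, β, hsum, hprod, hgt⟩ : ∃ α β : ℝ, α + β = κ ∧ α * β = P ∧ P < α ^ 2 := by
    rcases le_or_gt 0 κ with h | h
    · refine ⟨(κ + D) / 2, (κ - D) / 2, by ring, by linear_combination -hDsq / 4, ?_⟩
      nlinarith [mul_nonneg h hDpos.le]
    · refine ⟨(κ - D) / 2, (κ + D) / 2, by ring, by linear_combination -hDsq / 4, ?_⟩
      nlinarith [mul_pos_of_neg_of_neg h (neg_lt_zero.2 hDpos)]
  have hform : ∀ n, v (n + 1) = α ^ (n + 1) + β ^ (n + 1) ∧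
      v (n + 2) = α ^ (n + 2) + β ^ (n + 2) := by
    intro n
    induction n with
    | zero =>
      refine ⟨by rw [h1, ← hsum]; ring, ?_⟩
      rw [h2, ← hsum, ← hprod]; ring
    | succ n ih =>
      refine ⟨ih.2, ?_⟩
      rw [show n + 1 + 2 = n + 3 by ring, h3, ih.1, ih.2, ← hsum, ← hprod]
      ring
  have hα0 : α ≠ 0 := by rintro rfl; simp at hgt; linarith
  have hβ : β = P / α := by rw [← hprod]; field_simp
  have hlow : ∀ n, |α| ^ 3 * (α ^ 2) ^ n ≤ B * P ^ n := by
    intro n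
    refine le_trans ?_ (hv n)
    have h4 := (hform (2 * n + 2)).1
    rw [show 2 * n + 2 + 1 = 2 * n + 3 by ring] at h4
    have h5 : v (2 * n + 3) * α ≥ |α| ^ 3 * (α ^ 2) ^ n * |α| := by
      have h6 : |α| ^ 3 * (α ^ 2) ^ n * |α| = α ^ (2 * n + 4) := by
        rw [mul_right_comm, ← pow_succ, show 3 + 1 = 2 * 2 by norm_num, pow_mul, sq_abs,
          ← pow_mul, ← pow_mul, ← pow_add]
        congr 1; ring
      rw [h6, h4, add_mul, ← pow_succ]
      have h7 : 0 ≤ β ^ (2 * n + 3) * α := by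
        rw [show 2 * n + 3 = 2 * (n + 1) + 1 by ring, pow_succ, mul_assoc, mul_comm β α, hprod,
          pow_mul]
        positivity
      linarith
    have h8 : v (2 * n + 3) * α ≤ |v (2 * n + 3)| * |α| := by
      rw [← abs_mul]; exact le_abs_self _
    exact le_of_mul_le_mul_right (h5.le.trans h8) (abs_pos.2 hα0)
  have hratio : 1 < α ^ 2 / P := by rw [lt_div_iff₀ hP]; linarith
  obtain ⟨n, hn⟩ := pow_unbounded_of_one_lt (B / |α| ^ 3) hratio
  rw [div_pow, div_lt_div_iff₀ (by positivity) (by positivity)] at hn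
  linarith [hlow n, mul_comm (|α| ^ 3) ((α ^ 2) ^ n)]

theorem norm_kloosterman_prime_le {p : ℕ} [Fact p.Prime] {ψ : AddChar (ZMod p) ℂ} (hψ : ψ ≠ 1)
    {a : ZMod p} (ha : a ≠ 0) :
    ‖∑ x : ZMod p, if x = 0 then 0 else ψ (x + a / x)‖ ≤ 2 * √p := by
  have hp : p.Prime := Fact.out
  have hK1 : kloostermanExt ψ a 1 = ∑ x : ZMod p, if x = 0 then 0 else ψ (x + a / x) := by
    rw [kloostermanExt_eq (F := ZMod p) ψ a (Module.finrank_self _)]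
    simp
  rw [← hK1]
  have hreal : (starRingEnd ℂ) (kloostermanExt ψ a 1) = kloostermanExt ψ a 1 := by
    rw [hK1, map_sum, ← Equiv.sum_comp (Equiv.neg (ZMod p))]
    refine Finset.sum_congr rfl fun x _ => ?_
    simp only [Equiv.neg_apply, neg_eq_zero]
    split_ifs
    · simp
    · rw [← AddChar.map_neg_eq_conj]
      congr 1
      rw [div_neg]; ring
  obtain ⟨r, hr⟩ := Complex.conj_eq_iff_real.1 hreal
  have hcard : Fintype.card (ZMod p) = p := ZMod.card p
  have hre : ∀ n, (kloostermanExt ψ a (n + 1) = ((kloostermanExt ψ a (n + 1)).re : ℂ)) ∧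
      (kloostermanExt ψ a (n + 2) = ((kloostermanExt ψ a (n + 2)).re : ℂ)) := by
    intro n
    induction n with
    | zero =>
      refine ⟨by rw [zero_add, hr, Complex.ofReal_re], ?_⟩
      rw [zero_add, kloostermanExt_two hψ ha, hr, hcard]
      have : (2 * (p : ℂ) - (r : ℂ) ^ 2) = ((2 * p - r ^ 2 : ℝ) : ℂ) := by push_cast; rfl
      rw [this, Complex.ofReal_re]
    | succ n ih =>
      refine ⟨ih.2, ?_⟩
      rw [show n + 1 + 2 = n + 3 by ring, kloostermanExt_add_three hψ ha, ih.1, ih.2, hr, hcard]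
      have : ∀ x y : ℝ, (-(r : ℂ) * x - p * y) = ((-r * x - p * y : ℝ) : ℂ) := by
        intro x y; push_cast; rfl
      rw [this, Complex.ofReal_re]
  have key := sq_le_of_recurrence (v := fun n => -(kloostermanExt ψ a n).re) (κ := -r) (P := p)
    (B := 4 * p ^ 3) (by exact_mod_cast hp.pos) ?_ ?_ ?_ ?_
  · rw [hr, Complex.norm_real, Real.norm_eq_abs]
    apply abs_le_of_sq_le_sq' _ (by positivity) |> abs_le.2
    rw [mul_pow, Real.sq_sqrt (by positivity)]
    linarith
  · simp [hr]
  · rw [kloostermanExt_two hψ ha, hr, hcard]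
    have : (2 * (p : ℂ) - (r : ℂ) ^ 2) = ((2 * p - r ^ 2 : ℝ) : ℂ) := by push_cast; rfl
    simp only [this, Complex.ofReal_re]
    ring
  · intro n
    have h := kloostermanExt_add_three hψ ha n
    rw [(hre n).1, (hre n).2, (hre (n + 1)).2, hr, hcard] at h
    have h' : ((kloostermanExt ψ a (n + 3)).re : ℂ) = ((-r * (kloostermanExt ψ a (n + 2)).re -
      p * (kloostermanExt ψ a (n + 1)).re : ℝ) : ℂ) := by
      rw [show n + 3 = n + 1 + 2 by ring, h]; push_cast; rfl
    have h'' := Complex.ofReal_injective h'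
    simp only [h'']
    ring
  · intro n
    rw [abs_neg]
    refine (Complex.abs_re_le_norm _).trans ((norm_kloostermanExt_le hψ a n).trans (le_of_eq ?_))
    ring

end WeilBound

section CompositeKloosterman

/-- The Kloosterman sum of an additive character of a finite commutative ring. -/
noncomputable def kloostermanSum {R : Type*} [CommRing R] [Fintype Rˣ] (ψ : AddChar R ℂ)
    (m n : R) : ℂ :=
  ∑ u : Rˣ, ψ (m * u + n * (u⁻¹ : Rˣ))

theorem norm_kloostermanSum_le_card {R : Type*} [CommRing R] [Finite R] [Fintype Rˣ]
    (ψ : AddChar R ℂ) (m n : R) : ‖kloostermanSum ψ m n‖ ≤ Fintype.card Rˣ := by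
  refine (norm_sum_le _ _).trans ?_
  simp [AddChar.norm_apply]

theorem kloostermanSum_ringEquiv {R S : Type*} [CommRing R] [CommRing S] [Fintype Rˣ]
    [Fintype Sˣ] (φ : S ≃+* R) (ψ : AddChar R ℂ) (m n : S) :
    kloostermanSum ψ (φ m) (φ n) =
      kloostermanSum (ψ.compAddMonoidHom (φ : S →+ R)) m n := by
  unfold kloostermanSum
  rw [← Equiv.sum_comp (Units.mapEquiv (φ : S ≃* R)).toEquiv]
  refine Finset.sum_congr rfl fun u _ => ?_
  simp only [MulEquiv.toEquiv_eq_coe, EquivLike.coe_coe, AddChar.compAddMonoidHom_apply]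
  have h : (((Units.mapEquiv (φ : S ≃* R)) u)⁻¹ : Rˣ) = Units.mapEquiv (φ : S ≃* R) u⁻¹ :=
    (map_inv _ _).symm
  rw [h]
  simp
  rfl

theorem kloostermanSum_prod {R S : Type*} [CommRing R] [CommRing S] [Fintype Rˣ]
    [Fintype Sˣ] [Fintype (R × S)ˣ] (ψ : AddChar (R × S) ℂ) (m n : R × S) :
    kloostermanSum ψ m n =
      kloostermanSum (ψ.compAddMonoidHom (AddMonoidHom.inl R S)) m.1 n.1 *
      kloostermanSum (ψ.compAddMonoidHom (AddMonoidHom.inr R S)) m.2 n.2 := by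
  unfold kloostermanSum
  rw [Finset.sum_mul_sum, ← Finset.sum_product', Finset.univ_product_univ,
    ← Equiv.sum_comp (MulEquiv.prodUnits (M := R) (N := S)).symm.toEquiv]
  refine Finset.sum_congr rfl fun u _ => ?_
  simp only [AddChar.compAddMonoidHom_apply, ← AddChar.map_add_eq_mul]
  congr 1
  ext
  · simp [MulEquiv.prodUnits]
  · simp [MulEquiv.prodUnits]

theorem AddChar.IsPrimitive.comp_inl {R S : Type*} [CommRing R] [CommRing S]
    {ψ : AddChar (R × S) ℂ} (hψ : ψ.IsPrimitive) :
    (ψ.compAddMonoidHom (AddMonoidHom.inl R S)).IsPrimitive := by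
  intro t ht h
  refine hψ (a := (t, 0)) (by simpa using ht) ?_
  ext x
  have := congrArg (fun χ => χ x.1) h
  have hx : ((t, 0) : R × S) * x = (t * x.1, 0) := Prod.ext rfl (zero_mul _)
  simpa [AddChar.mulShift_apply, hx] using this

theorem AddChar.IsPrimitive.comp_inr {R S : Type*} [CommRing R] [CommRing S]
    {ψ : AddChar (R × S) ℂ} (hψ : ψ.IsPrimitive) :
    (ψ.compAddMonoidHom (AddMonoidHom.inr R S)).IsPrimitive := by
  intro t ht h
  refine hψ (a := (0, t)) (by simpa using ht) ?_
  ext x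
  have := congrArg (fun χ => χ x.2) h
  have hx : ((0, t) : R × S) * x = (0, t * x.2) := Prod.ext (zero_mul _) rfl
  simpa [AddChar.mulShift_apply, hx] using this

theorem AddChar.IsPrimitive.comp_ringEquiv {R S : Type*} [CommRing R] [CommRing S]
    {ψ : AddChar R ℂ} (hψ : ψ.IsPrimitive) (φ : S ≃+* R) :
    (ψ.compAddMonoidHom (φ : S →+ R)).IsPrimitive := by
  intro t ht h
  refine hψ (a := φ t) (by simpa using ht) ?_
  ext x
  have := congrArg (fun χ => χ (φ.symm x)) h
  simpa [AddChar.mulShift_apply] using this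

theorem norm_kloostermanSum_prime_le {p : ℕ} [Fact p.Prime] {ψ : AddChar (ZMod p) ℂ}
    (hψ : ψ.IsPrimitive) (m n : ZMod p) :
    ‖kloostermanSum ψ m n‖ ≤ 2 * √p * √(n.val.gcd p) := by
  classical
  have hp : p.Prime := Fact.out
  have hp1 : (1 : ℝ) ≤ p := by exact_mod_cast hp.one_le
  have hsq : √(p : ℝ) * √p = p := Real.mul_self_sqrt (by linarith)
  have hs1 : 1 ≤ √(p : ℝ) := Real.one_le_sqrt.2 hp1
  have hψ1 : ∀ t : ZMod p, t ≠ 0 → ψ.mulShift t ≠ 1 := fun t ht => hψ ht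
  by_cases hn : n = 0
  · subst hn
    rw [ZMod.val_zero, Nat.gcd_zero_left, mul_assoc, hsq]
    refine (norm_kloostermanSum_le_card _ _ _).trans ?_
    have : (Fintype.card (ZMod p)ˣ : ℝ) ≤ p := by
      rw [ZMod.card_units]; exact_mod_cast Nat.sub_le _ _
    linarith
  have hg : n.val.gcd p = 1 := by
    have h1 : ¬ p ∣ n.val := by
      rw [← ZMod.natCast_eq_zero_iff, ZMod.natCast_zmod_val]; exact hn
    exact ((Nat.Prime.coprime_iff_not_dvd hp).2 h1).symm
  rw [hg, Nat.cast_one, Real.sqrt_one, mul_one]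
  have hsum : ∀ g : ZMod p → ℂ, ∑ u : (ZMod p)ˣ, g u = ∑ x : ZMod p, if x = 0 then 0 else g x := by
    intro g
    rw [Finset.sum_ite, Finset.sum_const_zero, zero_add]
    symm
    refine Finset.sum_bij (fun x hx => Units.mk0 x (by simpa using hx)) (by simp) ?_ ?_ ?_
    · intro x hx y hy h
      simpa using congrArg Units.val h
    · intro u _
      exact ⟨u, by simp, by simp⟩
    · intro x hx; simp
  by_cases hm : m = 0
  · subst hm
    have h2 : kloostermanSum ψ 0 n = -1 := by
      unfold kloostermanSum
      rw [← Equiv.sum_comp (Equiv.inv (ZMod p)ˣ)]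
      simp only [zero_mul, zero_add, Equiv.inv_apply, inv_inv]
      rw [hsum fun x => ψ (n * x)]
      have h3 := AddChar.sum_eq_zero_of_ne_one (hψ1 n hn)
      rw [Finset.sum_eq_add_sum_sdiff_singleton_of_mem (Finset.mem_univ 0)] at h3
      simp only [AddChar.mulShift_apply, AddChar.map_zero_eq_one] at h3
      rw [Finset.sum_eq_add_sum_sdiff_singleton_of_mem (Finset.mem_univ 0), if_pos rfl, zero_add]
      rw [Finset.sum_congr rfl (g := fun x => ψ (n * x))]
      · linear_combination h3
      · intro x hx
        rw [if_neg (by simpa using hx)]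
    rw [h2, norm_neg, norm_one]
    linarith
  · have h4 := norm_kloosterman_prime_le (hψ1 m hm) (a := n / m) (div_ne_zero hn hm)
    refine le_trans (le_of_eq ?_) h4
    congr 1
    unfold kloostermanSum
    simp only [Units.val_inv_eq_inv_val]
    rw [hsum fun x => ψ (m * x + n * x⁻¹)]
    refine Finset.sum_congr rfl fun x _ => ?_
    split_ifs with hx
    · rfl
    · rw [AddChar.mulShift_apply]
      congr 1
      field_simp

/-- A Weil type bound for Kloosterman sums to arbitrary moduli, which is nontrivial except
for a powerful part of the modulus. -/
theorem exists_kloostermanSum_bound (q : ℕ) (hq : 0 < q) :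
    ∃ r a c : ℕ, q = r * (a ^ 2 * c ^ 3) ∧
      ∀ [Fintype (ZMod q)ˣ] (ψ : AddChar (ZMod q) ℂ), ψ.IsPrimitive → ∀ m n : ZMod q,
        ‖kloostermanSum ψ m n‖ ≤
          q.divisors.card * (√r * (a ^ 2 * c ^ 3)) * √(n.val.gcd q) := by
  classical
  induction q using Nat.recOnPrimeCoprime with
  | zero => exact absurd hq (lt_irrefl 0)
  | prime_pow p k hp =>
    have : Fact p.Prime := ⟨hp⟩
    have hp1 : (1 : ℝ) ≤ p := by exact_mod_cast hp.one_le
    have htriv : ∀ [Fintype (ZMod (p ^ k))ˣ] (ψ : AddChar (ZMod (p ^ k)) ℂ),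
        ∀ m n : ZMod (p ^ k), ‖kloostermanSum ψ m n‖ ≤
          (p ^ k).divisors.card * (p ^ k : ℝ) * √(n.val.gcd (p ^ k)) := by
      intro _ ψ m n
      have : NeZero (p ^ k) := ⟨hq.ne'⟩
      refine (norm_kloostermanSum_le_card _ _ _).trans ?_
      have h1 : (Fintype.card (ZMod (p ^ k))ˣ : ℝ) ≤ (p ^ k : ℝ) := by
        have : Fintype.card (ZMod (p ^ k))ˣ ≤ p ^ k := by
          rw [ZMod.card_units_eq_totient]; exact Nat.totient_le _
        exact_mod_cast this
      have h2 : (1 : ℝ) ≤ (p ^ k).divisors.card := by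
        exact_mod_cast Finset.card_pos.2 ⟨1, Nat.one_mem_divisors.2 hq.ne'⟩
      have h3 : (1 : ℝ) ≤ √(n.val.gcd (p ^ k)) := by
        rw [Real.one_le_sqrt]
        exact_mod_cast Nat.gcd_pos_of_pos_right _ hq
      calc _ ≤ 1 * (p ^ k : ℝ) * 1 := by simpa using h1
        _ ≤ _ := by gcongr
    rcases k with _ | _ | k
    · refine ⟨1, 1, 1, by simp, fun ψ _ m n => ?_⟩
      simpa using htriv ψ m n
    · refine ⟨p, 1, 1, by simp, fun ψ hψ m n => ?_⟩
      have hd : (p ^ (0 + 1)).divisors.card = 2 := by simp [hp.divisors, hp.one_lt.ne]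
      rw [hd]
      have hgen : ∀ N, N = p → ∀ [Fintype (ZMod N)ˣ] (ψ : AddChar (ZMod N) ℂ), ψ.IsPrimitive →
          ∀ m n : ZMod N, ‖kloostermanSum ψ m n‖ ≤ 2 * √p * √(n.val.gcd N) := by
        rintro N rfl _ ψ hψ m n
        convert norm_kloostermanSum_prime_le hψ m n
      refine (hgen _ (by simp) ψ hψ m n).trans (le_of_eq ?_)
      simp
    · rcases Nat.even_or_odd k with ⟨j, hj⟩ | ⟨j, hj⟩
      · refine ⟨1, p ^ (j + 1), 1, ?_, fun ψ _ m n => ?_⟩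
        · rw [hj]; ring
        · have h1 : (p : ℝ) ^ (k + 1 + 1) = (√(1 : ℕ) * (((p ^ (j + 1) : ℕ) : ℝ) ^ 2 *
              ((1 : ℕ) : ℝ) ^ 3)) := by
            rw [hj]; push_cast; rw [Real.sqrt_one]; ring
          rw [← h1]; exact htriv ψ m n
      · refine ⟨1, p ^ j, p, ?_, fun ψ _ m n => ?_⟩
        · rw [hj]; ring
        · have h1 : (p : ℝ) ^ (k + 1 + 1) = (√(1 : ℕ) * (((p ^ j : ℕ) : ℝ) ^ 2 *
              (p : ℝ) ^ 3)) := by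
            rw [hj]; push_cast; rw [Real.sqrt_one]; ring
          rw [← h1]; exact htriv ψ m n
  | coprime q₁ q₂ h₁ h₂ hco ih₁ ih₂ =>
    obtain ⟨r₁, a₁, c₁, e₁, b₁⟩ := ih₁ (by omega)
    obtain ⟨r₂, a₂, c₂, e₂, b₂⟩ := ih₂ (by omega)
    have : NeZero q₁ := ⟨by omega⟩
    have : NeZero q₂ := ⟨by omega⟩
    have : NeZero (q₁ * q₂) := ⟨hq.ne'⟩
    refine ⟨r₁ * r₂, a₁ * a₂, c₁ * c₂, by rw [e₁, e₂]; ring, fun ψ hψ m n => ?_⟩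
    let φ := ZMod.chineseRemainder hco
    have h3 := kloostermanSum_ringEquiv φ.symm ψ (φ m) (φ n)
    rw [φ.symm_apply_apply, φ.symm_apply_apply, kloostermanSum_prod] at h3
    have hψ' := hψ.comp_ringEquiv φ.symm
    have g : n.val.gcd (q₁ * q₂) = (φ n).1.val.gcd q₁ * (φ n).2.val.gcd q₂ := by
      rw [Nat.Coprime.gcd_mul _ hco]
      have hn1 : (φ n).1 = ((n.val : ℕ) : ZMod q₁) := by
        conv_lhs => rw [← ZMod.natCast_zmod_val n, map_natCast]
        simp
      have hn2 : (φ n).2 = ((n.val : ℕ) : ZMod q₂) := by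
        conv_lhs => rw [← ZMod.natCast_zmod_val n, map_natCast]
        simp
      rw [hn1, hn2, ZMod.val_natCast, ZMod.val_natCast, ← Nat.gcd_rec, ← Nat.gcd_rec,
        Nat.gcd_comm q₁, Nat.gcd_comm q₂]
    rw [h3, norm_mul, g, hco.card_divisors_mul]
    push_cast
    rw [Real.sqrt_mul (by positivity), Real.sqrt_mul (by positivity)]
    calc _ ≤ _ := mul_le_mul (b₁ _ hψ'.comp_inl _ _) (b₂ _ hψ'.comp_inr _ _) (norm_nonneg _)
          (by positivity)
      _ = _ := by ring

end CompositeKloosterman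

section CyclicKoksma

open scoped ZMod

theorem four_mul_min_le_norm_stdAddChar_sub_one {q : ℕ} [NeZero q] (k : ZMod q) :
    4 * (min k.val (q - k.val) : ℕ) / (q : ℝ) ≤ ‖ZMod.stdAddChar k - 1‖ := by
  have hq : (0 : ℝ) < q := by exact_mod_cast Nat.pos_of_ne_zero (NeZero.ne q)
  have h1 : (ZMod.stdAddChar k : ℂ) = Complex.exp (Complex.I * ((2 * π * (k.val / q) : ℝ) : ℂ)) := by
    have := ZMod.stdAddChar_coe (N := q) (k.val : ℤ)
    rw [Int.cast_natCast, ZMod.natCast_zmod_val] at this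
    rw [this]
    congr 1
    push_cast
    ring
  rw [h1, Complex.norm_exp_I_mul_ofReal_sub_one]
  have hlt : k.val < q := ZMod.val_lt k
  have hv : ((k.val : ℕ) : ℝ) ≤ q := by exact_mod_cast hlt.le
  have hsin : ∀ t : ℝ, 0 ≤ t → t ≤ 1 / 2 → 2 * t ≤ Real.sin (π * t) := by
    intro t h0 h2
    have := Real.mul_le_sin (x := π * t) (by positivity) (by nlinarith [Real.pi_pos])
    have h3 : 2 / π * (π * t) = 2 * t := by field_simp
    rwa [h3] at this
  rw [Real.norm_eq_abs, abs_mul, abs_two]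
  have h4 : 2 * π * (k.val / q) / 2 = π * (k.val / q : ℝ) := by ring
  rw [h4]
  have h5 : 4 * (min k.val (q - k.val) : ℕ) / (q : ℝ) =
      2 * (2 * ((min k.val (q - k.val) : ℕ) / (q : ℝ))) := by ring
  rw [h5]
  gcongr
  rcases le_total (2 * k.val) q with h | h
  · rw [min_eq_left (by omega)]
    refine (hsin _ (by positivity) ?_).trans (le_abs_self _)
    rw [div_le_iff₀ hq]
    have : (2 * k.val : ℝ) ≤ q := by exact_mod_cast h
    linarith
  · rw [min_eq_right (by omega)]
    have h6 : Real.sin (π * (k.val / q)) = Real.sin (π * (((q - k.val : ℕ) : ℝ) / q)) := by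
      rw [← Real.sin_pi_sub]
      congr 1
      rw [Nat.cast_sub hlt.le]
      field_simp
    rw [h6]
    refine (hsin _ (by positivity) ?_).trans (le_abs_self _)
    rw [div_le_iff₀ hq, Nat.cast_sub hlt.le]
    have : (q : ℝ) ≤ 2 * k.val := by exact_mod_cast h
    linarith

/-- The normalized Fourier coefficients on `ZMod q`. -/
noncomputable def fourierCoeffZMod {q : ℕ} [NeZero q] (f : ZMod q → ℂ) (k : ZMod q) : ℂ :=
  (q : ℂ)⁻¹ * ∑ x, ZMod.stdAddChar (-(k * x)) * f x

theorem sum_fourierCoeffZMod {q : ℕ} [NeZero q] (f : ZMod q → ℂ) (x : ZMod q) :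
    ∑ k, fourierCoeffZMod f k * ZMod.stdAddChar (k * x) = f x := by
  classical
  have hq : (q : ℂ) ≠ 0 := by exact_mod_cast NeZero.ne q
  unfold fourierCoeffZMod
  have : ∀ y, ∑ k : ZMod q, ZMod.stdAddChar (k * (x - y)) = if x = y then (q : ℂ) else 0 := by
    intro y
    have := AddChar.sum_mulShift (x - y) (ZMod.isPrimitive_stdAddChar q)
    rw [this, ZMod.card]
    simp [sub_eq_zero]
  calc _ = ∑ k : ZMod q, ∑ y, (q : ℂ)⁻¹ * f y * ZMod.stdAddChar (k * (x - y)) := by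
        refine Finset.sum_congr rfl fun k _ => ?_
        rw [Finset.mul_sum, Finset.sum_mul]
        refine Finset.sum_congr rfl fun y _ => ?_
        rw [show k * (x - y) = -(k * y) + k * x by ring, AddChar.map_add_eq_mul]
        ring
    _ = f x := by
        rw [Finset.sum_comm]
        simp only [← Finset.mul_sum, this]
        simp
        field_simp

theorem fourierCoeffZMod_zero {q : ℕ} [NeZero q] (f : ZMod q → ℂ) :
    fourierCoeffZMod f 0 = (q : ℂ)⁻¹ * ∑ x, f x := by
  simp [fourierCoeffZMod]

theorem norm_fourierCoeffZMod_zero_le {q : ℕ} [NeZero q] (f : ZMod q → ℂ) {B : ℝ}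
    (hB : ∀ x, ‖f x‖ ≤ B) : ‖fourierCoeffZMod f 0‖ ≤ B := by
  have hq : (0 : ℝ) < q := by exact_mod_cast Nat.pos_of_ne_zero (NeZero.ne q)
  rw [fourierCoeffZMod_zero, norm_mul, norm_inv, Complex.norm_natCast, inv_mul_le_iff₀ hq]
  refine (norm_sum_le _ _).trans ((Finset.sum_le_sum fun x _ => hB x).trans (le_of_eq ?_))
  simp [ZMod.card]

theorem norm_fourierCoeffZMod_le {q : ℕ} [NeZero q] (f : ZMod q → ℂ) {V : ℝ}
    (hV : ∑ x, ‖f x - f (x - 1)‖ ≤ V) {k : ZMod q} (hk : k ≠ 0) :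
    ‖fourierCoeffZMod f k‖ ≤ V / 4 * (1 / (min k.val (q - k.val) : ℕ)) := by
  have hq : (0 : ℝ) < q := by exact_mod_cast Nat.pos_of_ne_zero (NeZero.ne q)
  have hlt : k.val < q := ZMod.val_lt k
  have hpos : 0 < k.val := Nat.pos_of_ne_zero (by rwa [Ne, ZMod.val_eq_zero])
  have hm : (0 : ℝ) < (min k.val (q - k.val) : ℕ) := by
    exact_mod_cast (lt_min hpos (by omega))
  have h1 : (1 - ZMod.stdAddChar (-k)) * fourierCoeffZMod f k =
      (q : ℂ)⁻¹ * ∑ x, ZMod.stdAddChar (-(k * x)) * (f x - f (x - 1)) := by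
    unfold fourierCoeffZMod
    rw [mul_left_comm]
    congr 1
    simp only [mul_sub, Finset.sum_sub_distrib]
    rw [sub_mul, one_mul]
    congr 1
    rw [← Equiv.sum_comp (Equiv.addRight (1 : ZMod q)) fun x =>
      ZMod.stdAddChar (-(k * x)) * f (x - 1), Finset.mul_sum]
    refine Finset.sum_congr rfl fun x _ => ?_
    simp only [Equiv.coe_addRight, add_sub_cancel_right]
    rw [show -(k * (x + 1)) = -k + -(k * x) by ring, AddChar.map_add_eq_mul, mul_assoc]
  have h2 : ‖(1 : ℂ) - ZMod.stdAddChar (-k)‖ = ‖(ZMod.stdAddChar k : ℂ) - 1‖ := by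
    have : (ZMod.stdAddChar k : ℂ) - 1 = ZMod.stdAddChar k * (1 - ZMod.stdAddChar (-k)) := by
      rw [mul_sub, mul_one, ← AddChar.map_add_eq_mul, add_neg_cancel, AddChar.map_zero_eq_one]
    rw [this, norm_mul, AddChar.norm_apply, one_mul]
  have h3 := congrArg norm h1
  rw [norm_mul, h2, norm_mul, norm_inv, Complex.norm_natCast] at h3
  have h4 : ‖∑ x, ZMod.stdAddChar (-(k * x)) * (f x - f (x - 1))‖ ≤ V := by
    refine (norm_sum_le _ _).trans (le_trans (le_of_eq ?_) hV)
    simp [AddChar.norm_apply]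
  have h5 := mul_le_mul_of_nonneg_right (four_mul_min_le_norm_stdAddChar_sub_one k)
    (norm_nonneg (fourierCoeffZMod f k))
  rw [h3, div_mul_eq_mul_div, div_le_iff₀ hq] at h5
  have h6 : (q : ℝ)⁻¹ * ‖∑ x, ZMod.stdAddChar (-(k * x)) * (f x - f (x - 1))‖ * q ≤ V := by
    rw [mul_comm, ← mul_assoc, mul_inv_cancel₀ hq.ne', one_mul]; exact h4
  rw [mul_one_div, le_div_iff₀ hm]
  linarith

theorem sum_one_div_le_one_add_log (q : ℕ) :
    ∑ v ∈ Finset.Ico 1 q, 1 / (v : ℝ) ≤ 1 + Real.log q := by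
  have h := harmonic_le_one_add_log q
  rw [harmonic_eq_sum_Icc] at h
  push_cast at h
  refine le_trans ?_ h
  simp only [one_div]
  exact Finset.sum_le_sum_of_subset_of_nonneg
    (fun x hx => by simp at hx ⊢; omega) fun _ _ _ => by positivity

theorem sum_sqrt_gcd_div_le {q : ℕ} (hq : 0 < q) :
    ∑ v ∈ Finset.Ico 1 q, √(v.gcd q) / (v : ℝ) ≤ q.divisors.card * (1 + Real.log q) := by
  have h1 : ∀ v ∈ Finset.Ico 1 q, √(v.gcd q) / (v : ℝ) ≤
      ∑ d ∈ q.divisors, if d ∣ v then √d / (v : ℝ) else 0 := by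
    intro v hv
    refine le_trans (le_of_eq ?_) (Finset.single_le_sum (f := fun d : ℕ =>
      if d ∣ v then √d / (v : ℝ) else 0) (fun d _ => by split_ifs <;> positivity)
      (Nat.mem_divisors.2 ⟨Nat.gcd_dvd_right v q, hq.ne'⟩))
    simp [Nat.gcd_dvd_left]
  refine (Finset.sum_le_sum h1).trans ?_
  rw [Finset.sum_comm, ← nsmul_eq_mul]
  refine Finset.sum_le_card_nsmul _ _ _ fun d hd => ?_
  have hdpos : 0 < d := Nat.pos_of_mem_divisors hd
  have hd1 : (1 : ℝ) ≤ d := by exact_mod_cast hdpos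
  rw [← Finset.sum_filter]
  have h2 : ∑ v ∈ Finset.Ico 1 q with d ∣ v, √d / (v : ℝ) ≤
      ∑ w ∈ Finset.Ico 1 q, √d / ((d * w : ℕ) : ℝ) := by
    have himg : ((Finset.Ico 1 q).filter (d ∣ ·)) ⊆ (Finset.Ico 1 q).image (d * ·) := by
      intro v hv
      simp only [Finset.mem_filter, Finset.mem_Ico, Finset.mem_image] at hv ⊢
      obtain ⟨⟨h1, h2⟩, w, rfl⟩ := hv
      refine ⟨w, ⟨Nat.pos_of_ne_zero (by rintro rfl; simp at h1), ?_⟩, rfl⟩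
      nlinarith
    refine (Finset.sum_le_sum_of_subset_of_nonneg himg fun _ _ _ => by positivity).trans ?_
    rw [Finset.sum_image]
    intro a _ b _ h
    exact Nat.eq_of_mul_eq_mul_left hdpos h
  refine h2.trans (le_trans (Finset.sum_le_sum fun w hw => ?_) (sum_one_div_le_one_add_log q))
  rw [Finset.mem_Ico] at hw
  have hw1 : (1 : ℝ) ≤ w := by exact_mod_cast hw.1
  push_cast
  rw [div_le_div_iff₀ (by positivity) (by positivity), one_mul]
  have : √(d : ℝ) ≤ d := by
    rw [Real.sqrt_le_left (by positivity)]; nlinarith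
  nlinarith

theorem sum_zmod_min_le {q : ℕ} [NeZero q] (g : ℕ → ℝ) (hg : ∀ v, 0 ≤ g v) {B : ℝ}
    (hsymm : ∀ v, v ≤ q → g (q - v) = g v) (hB : ∑ v ∈ Finset.Ico 1 q, g v / (v : ℝ) ≤ B) :
    ∑ k : ZMod q with k ≠ 0, g k.val * (1 / (min k.val (q - k.val) : ℕ)) ≤ 2 * B := by
  have h1 : ∑ k : ZMod q with k ≠ 0, g k.val * (1 / ((min k.val (q - k.val) : ℕ) : ℝ)) =
      ∑ v ∈ Finset.Ico 1 q, g v * (1 / ((min v (q - v) : ℕ) : ℝ)) := by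
    refine Finset.sum_bij (fun k _ => k.val) ?_ ?_ ?_ ?_
    · intro k hk
      rw [Finset.mem_Ico]
      have : k ≠ 0 := by simpa using hk
      exact ⟨Nat.pos_of_ne_zero (by rwa [Ne, ZMod.val_eq_zero]), ZMod.val_lt k⟩
    · intro k _ l _ h; exact ZMod.val_injective q h
    · intro v hv
      rw [Finset.mem_Ico] at hv
      refine ⟨v, ?_, ZMod.val_cast_of_lt hv.2⟩
      simp only [Finset.mem_filter, Finset.mem_univ, true_and]
      intro h
      have := ZMod.val_cast_of_lt hv.2
      rw [h, ZMod.val_zero] at this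
      omega
    · intros; rfl
  rw [h1]
  have h2 : ∀ v ∈ Finset.Ico 1 q, g v * (1 / ((min v (q - v) : ℕ) : ℝ)) ≤
      g v / (v : ℝ) + g (q - v) / ((q - v : ℕ) : ℝ) := by
    intro v hv
    rw [Finset.mem_Ico] at hv
    rw [hsymm v hv.2.le, mul_one_div]
    have a1 : 0 ≤ g v / (v : ℝ) := div_nonneg (hg v) (by positivity)
    have a2 : 0 ≤ g v / ((q - v : ℕ) : ℝ) := div_nonneg (hg v) (by positivity)
    rcases min_choice v (q - v) with h | h <;> rw [h] <;> linarith
  refine (Finset.sum_le_sum h2).trans ?_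
  rw [Finset.sum_add_distrib]
  have h3 : ∑ v ∈ Finset.Ico 1 q, g (q - v) / ((q - v : ℕ) : ℝ) =
      ∑ v ∈ Finset.Ico 1 q, g v / (v : ℝ) := by
    refine Finset.sum_bij' (fun v _ => q - v) (fun v _ => q - v) ?_ ?_ ?_ ?_ ?_
    all_goals intro v hv; simp only [Finset.mem_Ico] at hv ⊢
    all_goals omega
  rw [h3]; linarith

/-- A Koksma type inequality for pairs `(u, c u⁻¹)` of units. -/
theorem norm_sum_units_mul_inv_sub_le {q : ℕ} [NeZero q] [Fintype (ZMod q)ˣ] {W : ℝ} (hW0 : 0 ≤ W)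
    (hW : ∀ m n : ZMod q, ‖kloostermanSum (ZMod.stdAddChar (N := q)) m n‖ ≤ W * √(n.val.gcd q))
    (f h : ZMod q → ℂ) (c : (ZMod q)ˣ) {B V V' : ℝ} (hB : ∀ x, ‖f x‖ ≤ B)
    (hV : ∑ x, ‖f x - f (x - 1)‖ ≤ V) (hV' : ∑ x, ‖h x - h (x - 1)‖ ≤ V') :
    ‖∑ u : (ZMod q)ˣ, f u * h (c * (u⁻¹ : (ZMod q)ˣ)) -
        ((q : ℂ)⁻¹ * ∑ x, h x) * ∑ u : (ZMod q)ˣ, f u‖ ≤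
      W * (B + V / 2 * (1 + Real.log q)) * (V' / 2 * (q.divisors.card * (1 + Real.log q))) := by
  classical
  have hq : 0 < q := Nat.pos_of_ne_zero (NeZero.ne q)
  have hVnn : 0 ≤ V := le_trans (Finset.sum_nonneg fun _ _ => norm_nonneg _) hV
  have hVnn' : 0 ≤ V' := le_trans (Finset.sum_nonneg fun _ _ => norm_nonneg _) hV'
  set F := fourierCoeffZMod f with hF
  set H := fourierCoeffZMod h with hH
  have h1 : ∑ u : (ZMod q)ˣ, f u * h (c * (u⁻¹ : (ZMod q)ˣ)) =
      ∑ n, H n * ∑ k, F k * kloostermanSum (ZMod.stdAddChar (N := q)) k (n * (c : ZMod q)) := by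
    have : ∀ u : (ZMod q)ˣ, f u * h (c * (u⁻¹ : (ZMod q)ˣ)) =
        ∑ n : ZMod q, H n * ∑ k : ZMod q, F k *
        ZMod.stdAddChar (k * (u : ZMod q) + n * (c : ZMod q) * ((u⁻¹ : (ZMod q)ˣ) : ZMod q)) := by
      intro u
      rw [← sum_fourierCoeffZMod f u, ← sum_fourierCoeffZMod h (c * ((u⁻¹ : (ZMod q)ˣ) : ZMod q)),
        Finset.sum_mul_sum,
        Finset.sum_comm]
      refine Finset.sum_congr rfl fun n _ => ?_
      rw [Finset.mul_sum]
      refine Finset.sum_congr rfl fun k _ => ?_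
      rw [AddChar.map_add_eq_mul, mul_assoc n]
      ring
    rw [Finset.sum_congr rfl fun u _ => this u, Finset.sum_comm]
    refine Finset.sum_congr rfl fun n _ => ?_
    rw [← Finset.mul_sum, Finset.sum_comm]
    simp only [← Finset.mul_sum, kloostermanSum]
  have h2 : ((q : ℂ)⁻¹ * ∑ x, h x) * ∑ u : (ZMod q)ˣ, f u =
      H 0 * ∑ k, F k * kloostermanSum (ZMod.stdAddChar (N := q)) k (0 * (c : ZMod q)) := by
    rw [hH, fourierCoeffZMod_zero]
    congr 1
    simp only [kloostermanSum, Finset.mul_sum]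
    rw [Finset.sum_comm]
    refine Finset.sum_congr rfl fun u _ => ?_
    rw [← sum_fourierCoeffZMod f u]
    simp [hF]
  have h3 : ∑ k, ‖F k‖ ≤ B + V / 2 * (1 + Real.log q) := by
    rw [← Finset.add_sum_erase _ _ (Finset.mem_univ (0 : ZMod q)), ← Finset.filter_ne']
    refine add_le_add (norm_fourierCoeffZMod_zero_le f hB) ?_
    have h4 := sum_zmod_min_le (q := q) (fun _ => 1) (fun _ => zero_le_one) (fun _ _ => rfl)
      (sum_one_div_le_one_add_log q)
    calc ∑ k with k ≠ 0, ‖F k‖ ≤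
        ∑ k : ZMod q with k ≠ 0, V / 4 * (1 * (1 / ((min k.val (q - k.val) : ℕ) : ℝ))) := by
          refine Finset.sum_le_sum fun k hk => ?_
          rw [one_mul]
          exact norm_fourierCoeffZMod_le f hV (by simpa using hk)
      _ ≤ V / 4 * (2 * (1 + Real.log q)) := by
          rw [← Finset.mul_sum]; gcongr
      _ = _ := by ring
  have hgcd : ∀ n : ZMod q, (n * (c : ZMod q)).val.gcd q = n.val.gcd q := by
    intro n
    rw [ZMod.val_mul, ← Nat.gcd_rec, Nat.gcd_comm, Nat.Coprime.gcd_mul_right_cancel _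
      (ZMod.val_coe_unit_coprime c)]
  have h5 : ∑ n with n ≠ 0, ‖H n‖ * √(n.val.gcd q) ≤
      V' / 2 * (q.divisors.card * (1 + Real.log q)) := by
    have h6 := sum_zmod_min_le (q := q) (fun v => √(v.gcd q)) (fun _ => Real.sqrt_nonneg _)
      (fun v hv => by simp only [Nat.gcd_comm _ q, Nat.gcd_self_sub_right hv])
      (sum_sqrt_gcd_div_le hq)
    calc ∑ n with n ≠ 0, ‖H n‖ * √(n.val.gcd q) ≤ ∑ n : ZMod q with n ≠ 0,
          V' / 4 * (√(n.val.gcd q) * (1 / ((min n.val (q - n.val) : ℕ) : ℝ))) := by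
          refine Finset.sum_le_sum fun n hn => ?_
          refine (mul_le_mul_of_nonneg_right (norm_fourierCoeffZMod_le h hV' (by simpa using hn))
            (Real.sqrt_nonneg _)).trans (le_of_eq (by ring))
      _ ≤ V' / 4 * (2 * (q.divisors.card * (1 + Real.log q))) := by
          rw [← Finset.mul_sum]; gcongr
      _ = _ := by ring
  rw [h1, h2, ← Finset.add_sum_erase _ _ (Finset.mem_univ (0 : ZMod q)), add_sub_cancel_left,
    ← Finset.filter_ne']
  have hS0 : 0 ≤ ∑ k, ‖F k‖ := Finset.sum_nonneg fun _ _ => norm_nonneg _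
  calc _ ≤ ∑ n with n ≠ 0, ‖H n‖ * ((∑ k, ‖F k‖) * (W * √(n.val.gcd q))) := by
        refine (norm_sum_le _ _).trans (Finset.sum_le_sum fun n _ => ?_)
        rw [norm_mul]
        gcongr
        rw [Finset.sum_mul]
        refine (norm_sum_le _ _).trans (Finset.sum_le_sum fun k _ => ?_)
        rw [norm_mul]
        gcongr
        rw [← hgcd n]
        exact hW _ _
    _ = W * (∑ k, ‖F k‖) * ∑ n with n ≠ 0, ‖H n‖ * √(n.val.gcd q) := by
        rw [Finset.mul_sum]
        exact Finset.sum_congr rfl fun n _ => by ring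
    _ ≤ _ := by
        have h0 : 0 ≤ ∑ n : ZMod q with n ≠ 0, ‖H n‖ * √(n.val.gcd q) :=
          Finset.sum_nonneg fun _ _ => by positivity
        have h7 : 0 ≤ B + V / 2 * (1 + Real.log q) := hS0.trans h3
        gcongr

end CyclicKoksma

lemma sum_zmod_val {q : ℕ} [NeZero q] (F : ℕ → ℝ) :
    ∑ x : ZMod q, F x.val = ∑ v ∈ Finset.range q, F v := by
  obtain ⟨n, rfl⟩ : ∃ n, q = n + 1 := Nat.exists_eq_succ_of_ne_zero (NeZero.ne q)
  exact Fin.sum_univ_eq_sum_range F (n + 1)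

/-- The cyclic variation of a function on `ZMod q` that is monotone in the canonical
representative. -/
lemma sum_abs_sub_val_le {q : ℕ} [NeZero q] (g : ℕ → ℝ) (hg : ∀ i, i + 1 < q → g i ≤ g (i + 1)) :
    ∑ x : ZMod q, |g x.val - g (x - 1).val| ≤ 2 * (g (q - 1) - g 0) := by
  have hq := Nat.pos_of_ne_zero (NeZero.ne q)
  let F : ℕ → ℝ := fun v => if v = 0 then |g 0 - g (q - 1)| else |g v - g (v - 1)|
  have h1 : ∀ x : ZMod q, |g x.val - g (x - 1).val| = F x.val := by
    intro x
    by_cases hx : x = 0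
    · subst hx
      obtain ⟨n, rfl⟩ : ∃ n, q = n + 1 := Nat.exists_eq_succ_of_ne_zero (NeZero.ne q)
      simp [F, ZMod.val_neg_one]
    · have h0 : x.val ≠ 0 := by simpa using hx
      have h2 : (x - 1).val = x.val - 1 := by
        have hx2 : x - 1 = ((x.val - 1 : ℕ) : ZMod q) := by
          rw [Nat.cast_sub (by omega)]; simp
        rw [hx2, ZMod.val_cast_of_lt (by have := ZMod.val_lt x; omega)]
      simp [F, h0, h2]
  rw [Finset.sum_congr rfl fun x _ => h1 x, sum_zmod_val F]
  obtain ⟨n, rfl⟩ : ∃ n, q = n + 1 := ⟨q - 1, by omega⟩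
  rw [Finset.sum_range_succ']
  simp only [F, Nat.add_eq_zero_iff, one_ne_zero, and_false, if_false, if_true, Nat.add_sub_cancel]
  have h3 : ∀ m ≤ n, ∑ i ∈ Finset.range m, |g (i + 1) - g i| = g m - g 0 ∧ g 0 ≤ g m := by
    intro m
    induction m with
    | zero => intro _; simp
    | succ m ih =>
      intro hm
      obtain ⟨h4, h5⟩ := ih (by omega)
      have h6 := hg m (by omega)
      rw [Finset.sum_range_succ, h4, abs_of_nonneg (by linarith)]
      constructor <;> linarith
  obtain ⟨h4, h5⟩ := h3 n le_rfl
  rw [h4, abs_of_nonpos (by linarith)]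
  linarith

/-- The largest natural number `z ≤ T` with `z * (l * b) ≡ e` modulo `q`, if `l * b` is prime
to `q`. -/
def lastDenom (T : ℕ) (e : ℤ) (l q b : ℕ) : ℕ :=
  T - ((T : ZMod q) - (e : ZMod q) * ((l * b : ℕ) : ZMod q)⁻¹).val

lemma sum_units_indicator {q : ℕ} [NeZero q] [Fintype (ZMod q)ˣ] (g : ZMod q → ℂ) {N : ℕ}
    (hN : N ≤ q) :
    ∑ u : (ZMod q)ˣ, (if (u : ZMod q).val < N then (1 : ℂ) else 0) * g u =
      ∑ b ∈ Finset.range N with b.Coprime q, g (b : ZMod q) := by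
  simp only [ite_mul, one_mul, zero_mul]
  rw [← Finset.sum_filter]
  refine Finset.sum_bij (fun u _ => (u : ZMod q).val) ?_ ?_ ?_ ?_
  · intro u hu
    simp only [Finset.mem_filter, Finset.mem_univ, true_and, Finset.mem_range] at hu ⊢
    exact ⟨hu, ZMod.val_coe_unit_coprime u⟩
  · intro u _ v _ h
    exact Units.ext (ZMod.val_injective q h)
  · intro b hb
    simp only [Finset.mem_filter, Finset.mem_range] at hb
    refine ⟨ZMod.unitOfCoprime b hb.2, ?_, ?_⟩
    · simp [ZMod.val_cast_of_lt (hb.1.trans_le hN), hb.1]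
    · simp [ZMod.val_cast_of_lt (hb.1.trans_le hN)]
  · intro u _
    simp

/-- Equidistribution of the inverses of `l * b` modulo `q` for `b` in an initial segment. -/
theorem abs_sum_inv_lastDenom_sub_le {q Q T l N : ℕ} {e : ℤ} (hq : 0 < q) (hqQ : q ≤ Q)
    (hT : 2 * Q ≤ T) (hl : l.Coprime q) (he : e = 1 ∨ e = -1) (hN : N ≤ q) {W : ℝ} (hW0 : 0 ≤ W)
    (hW : ∀ [Fintype (ZMod q)ˣ] (ψ : AddChar (ZMod q) ℂ), ψ.IsPrimitive → ∀ m n : ZMod q,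
      ‖kloostermanSum ψ m n‖ ≤ W * √(n.val.gcd q)) :
    |∑ b ∈ Finset.range N with b.Coprime q, (1 : ℝ) / lastDenom T e l q b -
        ((q : ℝ)⁻¹ * ∑ v ∈ Finset.range q, 1 / ((T : ℝ) - v)) *
          ((Finset.range N).filter (fun b => b.Coprime q)).card| ≤
      W * (2 + Real.log q) * (1 / Q * (q.divisors.card * (1 + Real.log q))) := by
  classical
  have : NeZero q := ⟨hq.ne'⟩
  have hTq : ∀ x : ZMod q, ((T - x.val : ℕ) : ℝ) = (T : ℝ) - x.val := fun x =>
    Nat.cast_sub (by have := ZMod.val_lt x; omega)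
  have hQ0 : (0 : ℝ) < Q := by exact_mod_cast hq.trans_le hqQ
  have hTQ : 2 * (Q : ℝ) ≤ T := by exact_mod_cast hT
  set c : (ZMod q)ˣ := (if e = 1 then 1 else -1) * (ZMod.unitOfCoprime l hl)⁻¹ with hc
  have hce : (c : ZMod q) = (e : ZMod q) * (l : ZMod q)⁻¹ := by
    rw [hc]
    have h0 : (((ZMod.unitOfCoprime l hl)⁻¹ : (ZMod q)ˣ) : ZMod q) = (l : ZMod q)⁻¹ := by
      rw [← ZMod.inv_coe_unit, ZMod.coe_unitOfCoprime]
    rcases he with rfl | rfl <;> simp [h0]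
  let k : ℕ → ℝ := fun v => 1 / ((T : ℝ) - v)
  let h : ZMod q → ℂ := fun x => ((k ((T : ZMod q) - x).val : ℝ) : ℂ)
  let f : ZMod q → ℂ := fun x => if x.val < N then 1 else 0
  have hk : ∀ i, i + 1 < q → k i ≤ k (i + 1) := by
    intro i hi
    have hi' : (i : ℝ) + 1 < q := by exact_mod_cast hi
    have hqQ' : (q : ℝ) ≤ Q := by exact_mod_cast hqQ
    simp only [k]
    apply one_div_le_one_div_of_le
    · push_cast; linarith
    · push_cast; linarith
  have hV' : ∑ x, ‖h x - h (x - 1)‖ ≤ 2 / Q := by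
    calc ∑ x, ‖h x - h (x - 1)‖ = ∑ x : ZMod q, |k x.val - k (x - 1).val| := by
          refine Fintype.sum_equiv (Equiv.subLeft ((T : ZMod q) + 1)) _ _ fun x => ?_
          simp only [h, Equiv.subLeft_apply]
          rw [← Complex.ofReal_sub, Complex.norm_real, Real.norm_eq_abs, abs_sub_comm]
          congr 4 <;> ring_nf
      _ ≤ 2 * (k (q - 1) - k 0) := sum_abs_sub_val_le k hk
      _ ≤ 2 / Q := by
          have h1 : 0 ≤ k 0 := by simp [k]
          have h2 : k (q - 1) ≤ 1 / Q := by
            simp only [k]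
            have hqQ' : (q : ℝ) ≤ Q := by exact_mod_cast hqQ
            apply one_div_le_one_div_of_le hQ0
            rw [Nat.cast_sub hq]; push_cast; linarith
          have : 2 / (Q : ℝ) = 2 * (1 / Q) := by ring
          rw [this]; linarith
  have hV : ∑ x, ‖f x - f (x - 1)‖ ≤ 2 := by
    let g : ℕ → ℝ := fun v => if v < N then -1 else 0
    calc ∑ x, ‖f x - f (x - 1)‖ = ∑ x : ZMod q, |g x.val - g (x - 1).val| := by
          refine Finset.sum_congr rfl fun x _ => ?_
          have : ∀ x : ZMod q, f x = ((-(g x.val) : ℝ) : ℂ) := by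
            intro x; simp only [f, g]; split_ifs <;> simp
          rw [this, this, ← Complex.ofReal_sub, Complex.norm_real, Real.norm_eq_abs, abs_sub_comm]
          congr 1; ring
      _ ≤ 2 * (g (q - 1) - g 0) := sum_abs_sub_val_le g (by
          intro i _; simp only [g]; split_ifs <;> first | omega | norm_num)
      _ ≤ 2 := by simp only [g]; split_ifs <;> norm_num
  have hB : ∀ x, ‖f x‖ ≤ 1 := by intro x; simp only [f]; split_ifs <;> simp
  have key := norm_sum_units_mul_inv_sub_le hW0 (hW (ZMod.stdAddChar (N := q))
    (ZMod.isPrimitive_stdAddChar q)) f h c hB hV hV'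
  have h1 : ∑ u : (ZMod q)ˣ, f u * h (c * ((u⁻¹ : (ZMod q)ˣ) : ZMod q)) =
      ((∑ b ∈ Finset.range N with b.Coprime q, (1 : ℝ) / lastDenom T e l q b : ℝ) : ℂ) := by
    have := sum_units_indicator (fun x : ZMod q => h ((c : ZMod q) * x⁻¹)) hN
    simp only [f]
    convert this using 2
    · rw [← ZMod.inv_coe_unit]
    · rw [Complex.ofReal_sum]
      refine Finset.sum_congr rfl fun b hb => ?_
      simp only [h, k, lastDenom]
      rw [hce, hTq]
      have hb' : ((l * b : ℕ) : ZMod q)⁻¹ = (l : ZMod q)⁻¹ * (b : ZMod q)⁻¹ := by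
        simp only [Finset.mem_filter] at hb
        have h5 := ZMod.coe_mul_inv_eq_one l hl
        have h6 := ZMod.coe_mul_inv_eq_one b hb.2
        have h7 := ZMod.coe_mul_inv_eq_one (l * b) (hl.mul_left hb.2)
        push_cast at h7 ⊢
        linear_combination (-(l * b : ZMod q)⁻¹ ) * h5 * 1 + (-(l * b : ZMod q)⁻¹ * (l * (l : ZMod q)⁻¹)) * h6 + ((l : ZMod q)⁻¹ * (b : ZMod q)⁻¹) * h7
      rw [hb', mul_assoc]
  have h2 : (q : ℂ)⁻¹ * ∑ x, h x =
      (((q : ℝ)⁻¹ * ∑ v ∈ Finset.range q, 1 / ((T : ℝ) - v) : ℝ) : ℂ) := by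
    have : ∑ x, h x = ((∑ x : ZMod q, k x.val : ℝ) : ℂ) := by
      push_cast
      exact Fintype.sum_equiv (Equiv.subLeft (T : ZMod q)) _ _ fun x => rfl
    rw [this, sum_zmod_val]
    simp only [k]
    push_cast; rfl
  have h3 : ∑ u : (ZMod q)ˣ, f u =
      ((((Finset.range N).filter (fun b => b.Coprime q)).card : ℝ) : ℂ) := by
    have := sum_units_indicator (fun _ : ZMod q => (1 : ℂ)) hN
    simp only [mul_one, Finset.sum_const, nsmul_eq_mul] at this
    simp only [f]
    rw [this]; simp
  rw [h1, h2, h3, ← Complex.ofReal_mul, ← Complex.ofReal_sub, Complex.norm_real,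
    Real.norm_eq_abs] at key
  refine key.trans (le_of_eq ?_)
  ring

/-- The divisor bound. -/
lemma exists_card_divisors_le {δ : ℝ} (hδ : 0 < δ) :
    ∃ C : ℝ, 1 ≤ C ∧ ∀ n : ℕ, 0 < n → (n.divisors.card : ℝ) ≤ C * (n : ℝ) ^ δ := by
  have hln := Real.log_pos (one_lt_two)
  set A : ℝ := 1 + 1 / (δ * Real.log 2) with hA
  have hA1 : 1 ≤ A := by rw [hA]; have : 0 ≤ 1 / (δ * Real.log 2) := by positivity
                         linarith
  set P : ℕ := ⌈(2 : ℝ) ^ (1 / δ)⌉₊ with hP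
  refine ⟨A ^ P, one_le_pow₀ hA1, fun n hn => ?_⟩
  have hfac : ∀ p : ℕ, p.Prime → ∀ v : ℕ,
      (v : ℝ) + 1 ≤ (if p < P then A else 1) * ((p : ℝ) ^ v) ^ δ := by
    intro p hp v
    have hp2 : (2 : ℝ) ≤ p := by exact_mod_cast hp.two_le
    split_ifs with h
    · have h1 : 1 + v * (δ * Real.log 2) ≤ ((p : ℝ) ^ v) ^ δ := by
        calc 1 + v * (δ * Real.log 2) ≤ Real.exp (v * (δ * Real.log 2)) := by
              linarith [Real.add_one_le_exp (v * (δ * Real.log 2))]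
          _ = ((2 : ℝ) ^ v) ^ δ := by
              rw [Real.rpow_def_of_pos (by positivity), Real.log_pow]; ring_nf
          _ ≤ ((p : ℝ) ^ v) ^ δ := by gcongr
      calc (v : ℝ) + 1 ≤ A * (1 + v * (δ * Real.log 2)) := by
            have h2 : A * (1 + v * (δ * Real.log 2)) =
              1 + 1 / (δ * Real.log 2) + v * (δ * Real.log 2) + v := by
              rw [hA]; field_simp; ring
            have : 0 ≤ 1 / (δ * Real.log 2) := by positivity
            have : 0 ≤ v * (δ * Real.log 2) := by positivity
            linarith
        _ ≤ _ := by gcongr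
    · have h1 : (2 : ℝ) ≤ (p : ℝ) ^ δ := by
        have : (2 : ℝ) ^ (1 / δ) ≤ p :=
          (Nat.le_ceil _).trans (by exact_mod_cast (not_lt.mp h))
        calc (2 : ℝ) = ((2 : ℝ) ^ (1 / δ)) ^ δ := by
              rw [← Real.rpow_mul (by norm_num), one_div_mul_cancel hδ.ne', Real.rpow_one]
          _ ≤ _ := by gcongr
      rw [one_mul, ← Real.rpow_natCast, ← Real.rpow_mul (by positivity), mul_comm (v : ℝ),
        Real.rpow_mul (by positivity), Real.rpow_natCast]
      calc (v : ℝ) + 1 ≤ 2 ^ v := by exact_mod_cast Nat.lt_two_pow_self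
        _ ≤ _ := by gcongr
  have hn' : (n : ℝ) = ∏ p ∈ n.primeFactors, (p : ℝ) ^ n.factorization p := by
    conv_lhs => rw [← Nat.prod_factorization_pow_eq_self hn.ne']
    rw [Finsupp.prod]; push_cast; rfl
  rw [Nat.card_divisors hn.ne', hn', ← Real.finsetProd_rpow _ _ (fun _ _ => by positivity)]
  push_cast
  calc ∏ p ∈ n.primeFactors, ((n.factorization p : ℝ) + 1) ≤
        ∏ p ∈ n.primeFactors, ((if p < P then A else 1) * ((p : ℝ) ^ n.factorization p) ^ δ) :=
        Finset.prod_le_prod (fun _ _ => by positivity)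
          fun p hp => hfac p (Nat.prime_of_mem_primeFactors hp) _
    _ = (∏ p ∈ n.primeFactors, (if p < P then A else 1)) *
          ∏ p ∈ n.primeFactors, ((p : ℝ) ^ n.factorization p) ^ δ := Finset.prod_mul_distrib
    _ ≤ _ := by
        refine mul_le_mul_of_nonneg_right ?_ (Finset.prod_nonneg fun _ _ => by positivity)
        rw [← Finset.prod_filter, Finset.prod_const]
        refine pow_le_pow_right₀ hA1 ?_
        calc _ ≤ (Finset.range P).card := Finset.card_le_card fun x hx => by
              simpa using (Finset.mem_filter.mp hx).2
          _ = P := Finset.card_range P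

lemma one_add_log_le_rpow {δ x : ℝ} (hδ : 0 < δ) (hx : 1 ≤ x) :
    1 + Real.log x ≤ (1 + 1 / δ) * x ^ δ := by
  have h1 := Real.log_le_rpow_div (by linarith : 0 ≤ x) hδ
  have h2 := Real.one_le_rpow hx hδ.le
  have h3 : (1 + 1 / δ) * x ^ δ = x ^ δ + x ^ δ / δ := by ring
  linarith

lemma sum_inv_sqrt_le (n : ℕ) : ∑ r ∈ Finset.Icc 1 n, 1 / √(r : ℝ) ≤ 2 * √n := by
  induction n with
  | zero => simp
  | succ n ih =>
    rw [Finset.sum_Icc_succ_top (by omega)]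
    have h1 : 0 < √((n + 1 : ℕ) : ℝ) := Real.sqrt_pos.mpr (by positivity)
    have h2 : √((n + 1 : ℕ) : ℝ) ^ 2 = n + 1 := by rw [Real.sq_sqrt (by positivity)]; push_cast; rfl
    have h3 : √(n : ℝ) ^ 2 = n := Real.sq_sqrt (by positivity)
    have h4 : 1 / √((n + 1 : ℕ) : ℝ) ≤ 2 * √((n + 1 : ℕ) : ℝ) - 2 * √(n : ℝ) := by
      rw [div_le_iff₀ h1]
      nlinarith [sq_nonneg (√((n + 1 : ℕ) : ℝ) - √(n : ℝ))]
    linarith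

lemma sum_Icc_one_div_le (Q : ℕ) :
    ∑ v ∈ Finset.Icc 1 Q, 1 / (v : ℝ) ≤ 1 + Real.log Q := by
  have h := harmonic_le_one_add_log Q
  rw [harmonic_eq_sum_Icc] at h
  push_cast at h
  simpa [one_div] using h

lemma sum_one_div_sqrt_le {r a c : ℕ → ℕ} (h : ∀ q, 0 < q → q = r q * (a q ^ 2 * c q ^ 3))
    {Q : ℕ} (hQ : 0 < Q) :
    ∑ q ∈ Finset.Icc 1 Q, 1 / √(r q : ℝ) ≤ 2 * √Q * (1 + Real.log Q) ^ 2 := by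
  classical
  have hpos : ∀ q, 0 < q → 0 < r q ∧ 0 < a q ∧ 0 < c q := by
    intro q hq
    have := h q hq
    refine ⟨Nat.pos_of_ne_zero fun h0 => ?_, Nat.pos_of_ne_zero fun h0 => ?_,
      Nat.pos_of_ne_zero fun h0 => ?_⟩ <;> rw [h0] at this <;> simp at this <;> omega
  let S : Finset (Σ _ : ℕ × ℕ, ℕ) :=
    (Finset.Icc 1 Q ×ˢ Finset.Icc 1 Q).sigma fun p => Finset.Icc 1 (Q / (p.1 ^ 2 * p.2 ^ 3))
  have h1 : ∑ q ∈ Finset.Icc 1 Q, 1 / √(r q : ℝ) ≤ ∑ x ∈ S, 1 / √(x.2 : ℝ) := by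
    have hinj : Set.InjOn (fun q => (⟨(a q, c q), r q⟩ : Σ _ : ℕ × ℕ, ℕ))
        (Finset.Icc 1 Q : Finset ℕ) := by
      intro q hq q' hq' he
      simp only [Finset.coe_Icc, Set.mem_Icc] at hq hq'
      simp only [Sigma.mk.injEq, Prod.mk.injEq, heq_eq_eq] at he
      rw [h q (by omega), h q' (by omega), he.1.1, he.1.2, he.2]
    rw [← Finset.sum_image (f := fun x : (Σ _ : ℕ × ℕ, ℕ) => 1 / √(x.2 : ℝ)) hinj]
    refine Finset.sum_le_sum_of_subset_of_nonneg ?_ fun _ _ _ => by positivity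
    intro x hx
    simp only [Finset.mem_image, Finset.mem_Icc] at hx
    obtain ⟨q, hq, rfl⟩ := hx
    obtain ⟨h1, h2, h3⟩ := hpos q (by omega)
    have h4 := h q (by omega)
    have h5 : a q ≤ q := Nat.le_of_dvd (by omega) ⟨r q * a q * c q ^ 3, by
      conv_lhs => rw [h4]
      ring⟩
    have h6 : c q ≤ q := Nat.le_of_dvd (by omega) ⟨r q * a q ^ 2 * c q ^ 2, by
      conv_lhs => rw [h4]
      ring⟩
    simp only [S, Finset.mem_sigma, Finset.mem_product, Finset.mem_Icc]
    refine ⟨⟨⟨h2, by omega⟩, h3, by omega⟩, h1, ?_⟩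
    rw [Nat.le_div_iff_mul_le (by positivity), ← h4]
    exact hq.2
  refine h1.trans ?_
  rw [Finset.sum_sigma, Finset.sum_product]
  calc _ ≤ ∑ x ∈ Finset.Icc 1 Q, ∑ y ∈ Finset.Icc 1 Q, 2 * √Q * (1 / (x : ℝ) * (1 / (y : ℝ))) := by
        refine Finset.sum_le_sum fun x hx => Finset.sum_le_sum fun y hy => ?_
        simp only [Finset.mem_Icc] at hx hy
        have hx0 : (1 : ℝ) ≤ x := by exact_mod_cast hx.1
        have hy0 : (1 : ℝ) ≤ y := by exact_mod_cast hy.1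
        refine (sum_inv_sqrt_le _).trans ?_
        rw [mul_assoc 2]
        refine mul_le_mul_of_nonneg_left ?_ (by norm_num)
        have h2 : √((Q / (x ^ 2 * y ^ 3) : ℕ) : ℝ) ≤ √((Q : ℝ) / (x ^ 2 * y ^ 2)) := by
          apply Real.sqrt_le_sqrt
          refine Nat.cast_div_le.trans ?_
          push_cast
          gcongr
          · norm_num
        refine h2.trans (le_of_eq ?_)
        rw [Real.sqrt_div (by positivity), ← mul_pow, Real.sqrt_sq (by positivity)]
        field_simp
    _ = 2 * √Q * ((∑ x ∈ Finset.Icc 1 Q, 1 / (x : ℝ)) * ∑ y ∈ Finset.Icc 1 Q, 1 / (y : ℝ)) := by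
        rw [Finset.sum_mul_sum]
        simp only [Finset.mul_sum]
    _ ≤ _ := by
        have := sum_Icc_one_div_le Q
        rw [sq]
        gcongr

/-- Kloosterman sum bounds for all moduli, with a good average over the moduli. -/
theorem exists_kloosterman_weights : ∃ W : ℕ → ℝ,
    (∀ q, 0 < q → 0 ≤ W q ∧ ∀ [Fintype (ZMod q)ˣ] (ψ : AddChar (ZMod q) ℂ), ψ.IsPrimitive →
      ∀ m n : ZMod q, ‖kloostermanSum ψ m n‖ ≤ W q * √(n.val.gcd q)) ∧
    ∀ δ : ℝ, 0 < δ → ∃ C : ℝ, 0 ≤ C ∧ ∀ Q : ℕ, 0 < Q →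
      ∑ q ∈ Finset.Icc 1 Q, W q / q ≤ C * (√Q * (Q : ℝ) ^ δ) := by
  have key : ∀ q : ℕ, ∃ r a c : ℕ, 0 < q → q = r * (a ^ 2 * c ^ 3) ∧
      ∀ [Fintype (ZMod q)ˣ] (ψ : AddChar (ZMod q) ℂ), ψ.IsPrimitive → ∀ m n : ZMod q,
        ‖kloostermanSum ψ m n‖ ≤ q.divisors.card * (√r * (a ^ 2 * c ^ 3)) * √(n.val.gcd q) := by
    intro q
    by_cases hq : 0 < q
    · obtain ⟨r, a, c, h⟩ := exists_kloostermanSum_bound q hq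
      exact ⟨r, a, c, fun _ => ⟨h.1, h.2⟩⟩
    · exact ⟨0, 0, 0, fun h => absurd h hq⟩
  choose r a c h using key
  refine ⟨fun q => q.divisors.card * (√(r q : ℝ) * ((a q : ℝ) ^ 2 * (c q : ℝ) ^ 3)),
    fun q hq => ⟨mul_nonneg (Nat.cast_nonneg _) (mul_nonneg (Real.sqrt_nonneg _)
      (mul_nonneg (sq_nonneg _) (pow_nonneg (Nat.cast_nonneg _) _))), (h q hq).2⟩, fun δ hδ => ?_⟩
  obtain ⟨A, hA1, hA⟩ := exists_card_divisors_le (half_pos hδ)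
  set D := 1 + 1 / (δ / 4) with hD
  refine ⟨2 * A * D ^ 2, by positivity, fun Q hQ => ?_⟩
  have hQ1 : (1 : ℝ) ≤ Q := by exact_mod_cast hQ
  have hlog := one_add_log_le_rpow (δ := δ / 4) (by positivity) hQ1
  have hlog0 : 0 ≤ 1 + Real.log Q := by have := Real.log_nonneg hQ1; linarith
  calc _ ≤ ∑ q ∈ Finset.Icc 1 Q, A * (Q : ℝ) ^ (δ / 2) * (1 / √(r q : ℝ)) := by
        refine Finset.sum_le_sum fun q hq => ?_
        simp only [Finset.mem_Icc] at hq
        have hq0 : (0 : ℝ) < q := by exact_mod_cast hq.1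
        have h1 := (h q hq.1).1
        have hr0 : 0 < r q := Nat.pos_of_ne_zero fun h0 => by
          rw [h0] at h1; omega
        have hs : 0 < √(r q : ℝ) := Real.sqrt_pos.mpr (by exact_mod_cast hr0)
        have h2 : (q : ℝ) = √(r q : ℝ) ^ 2 * ((a q : ℝ) ^ 2 * (c q : ℝ) ^ 3) := by
          rw [Real.sq_sqrt (by positivity)]
          exact_mod_cast h1
        have h3 : √(r q) * ((a q : ℝ) ^ 2 * (c q : ℝ) ^ 3) / q = 1 / √(r q : ℝ) := by
          rw [div_eq_div_iff hq0.ne' hs.ne']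
          linear_combination -h2
        rw [mul_div_assoc, h3]
        gcongr
        refine (hA q hq.1).trans ?_
        have : (q : ℝ) ≤ Q := by exact_mod_cast hq.2
        gcongr
    _ = A * (Q : ℝ) ^ (δ / 2) * ∑ q ∈ Finset.Icc 1 Q, 1 / √(r q : ℝ) := by rw [Finset.mul_sum]
    _ ≤ A * (Q : ℝ) ^ (δ / 2) * (2 * √Q * (D * (Q : ℝ) ^ (δ / 4)) ^ 2) := by
        refine mul_le_mul_of_nonneg_left ?_ (by positivity)
        refine (sum_one_div_sqrt_le (fun q hq => (h q hq).1) hQ).trans ?_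
        gcongr
    _ = _ := by
        have : (Q : ℝ) ^ δ = (Q : ℝ) ^ (δ / 2) * ((Q : ℝ) ^ (δ / 4)) ^ 2 := by
          rw [← Real.rpow_natCast, ← Real.rpow_mul (by positivity), ← Real.rpow_add (by positivity)]
          congr 1; push_cast; ring
        rw [this]; ring

lemma sum_moebius_indicator {b q : ℕ} (hq : 0 < q) :
    ∑ d ∈ q.divisors, (if d ∣ b then (ArithmeticFunction.moebius d : ℝ) else 0) =
      if b.Coprime q then 1 else 0 := by
  have hg : b.gcd q ≠ 0 := (Nat.gcd_pos_of_pos_right b hq).ne'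
  rw [← Finset.sum_filter]
  have h1 : q.divisors.filter (fun d => d ∣ b) = (b.gcd q).divisors := by
    ext d
    simp only [Finset.mem_filter, Nat.mem_divisors, Nat.dvd_gcd_iff]
    constructor
    · rintro ⟨⟨h1, h2⟩, h3⟩; exact ⟨⟨h3, h1⟩, hg⟩
    · rintro ⟨⟨h1, h2⟩, h3⟩; exact ⟨⟨h2, hq.ne'⟩, h1⟩
  rw [h1, ← Int.cast_sum, ← ArithmeticFunction.coe_zeta_mul_apply,
    ArithmeticFunction.coe_zeta_mul_moebius, ArithmeticFunction.one_apply]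
  simp [Nat.Coprime]

lemma abs_card_dvd_range_sub_le {d : ℕ} (hd : 0 < d) (N : ℕ) :
    |(((Finset.range N).filter (fun b => d ∣ b)).card : ℝ) - N / d| ≤ 1 := by
  have hd1 : (1 : ℝ) ≤ d := by exact_mod_cast hd
  rcases N with _ | N
  · simp
  · have h1 : (Finset.range (N + 1)).filter (fun b => d ∣ b) =
        insert 0 ((Finset.Ioc 0 N).filter (fun b => d ∣ b)) := by
      ext b
      simp only [Finset.mem_filter, Finset.mem_range, Finset.mem_insert, Finset.mem_Ioc]
      constructor
      · rintro ⟨h1, h2⟩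
        rcases Nat.eq_zero_or_pos b with h | h
        · exact Or.inl h
        · exact Or.inr ⟨⟨h, by omega⟩, h2⟩
      · rintro (rfl | ⟨⟨h1, h2⟩, h3⟩)
        · simp
        · exact ⟨by omega, h3⟩
    rw [h1, Finset.card_insert_of_notMem (by simp), Nat.Ioc_filter_dvd_card_eq_div]
    have h2 : ((N / d : ℕ) : ℝ) ≤ N / d := Nat.cast_div_le
    have h3 : (N : ℝ) < d * ((N / d : ℕ) + 1) := by
      exact_mod_cast Nat.lt_mul_div_succ N hd
    have h4 : ((N : ℝ) + 1) / d ≤ (N / d : ℕ) + 1 := by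
      rw [div_le_iff₀ (by linarith)]
      have : N + 1 ≤ (N / d + 1) * d := by
        have := Nat.lt_mul_div_succ N hd
        rw [mul_comm]; exact this
      exact_mod_cast this
    have h5 : ((N : ℝ) + 1) / d = N / d + 1 / d := by ring
    have h6 : 0 ≤ 1 / (d : ℝ) := by positivity
    have h7 : 1 / (d : ℝ) ≤ 1 := by rw [div_le_one (by linarith)]; exact hd1
    push_cast
    rw [abs_le]
    constructor <;> linarith

lemma card_coprime_range {q : ℕ} (hq : 0 < q) (N : ℕ) :
    (((Finset.range N).filter (fun b => b.Coprime q)).card : ℝ) =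
      ∑ d ∈ q.divisors, (ArithmeticFunction.moebius d : ℝ) *
        ((Finset.range N).filter (fun b => d ∣ b)).card := by
  calc _ = ∑ b ∈ Finset.range N, ∑ d ∈ q.divisors,
          (if d ∣ b then (ArithmeticFunction.moebius d : ℝ) else 0) := by
        simp_rw [sum_moebius_indicator hq]
        simp
    _ = _ := by
        rw [Finset.sum_comm]
        refine Finset.sum_congr rfl fun d _ => ?_
        rw [← Finset.sum_filter, Finset.sum_const, nsmul_eq_mul, mul_comm]

lemma totient_div_eq_sum {q : ℕ} (hq : 0 < q) :
    (q.totient : ℝ) / q = ∑ d ∈ q.divisors, (ArithmeticFunction.moebius d : ℝ) / d := by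
  have h1 : ((Finset.range q).filter (fun b => b.Coprime q)).card = q.totient := by
    rw [Nat.totient]; congr 1; ext b; simp [Nat.coprime_comm]
  have hq0 : (0 : ℝ) < q := by exact_mod_cast hq
  rw [← h1, card_coprime_range hq, Finset.sum_div]
  refine Finset.sum_congr rfl fun d hd => ?_
  obtain ⟨k, rfl⟩ := Nat.dvd_of_mem_divisors hd
  have hd0 : 0 < d := Nat.pos_of_mem_divisors hd
  have hk0 : 0 < k := Nat.pos_of_mul_pos_left hq
  have h2 : ((Finset.range (d * k)).filter (fun b => d ∣ b)).card = k := by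
    rw [← Finset.card_range k]
    refine Finset.card_bij' (fun b _ => b / d) (fun j _ => d * j) ?_ ?_ ?_ ?_
    · intro b hb
      simp only [Finset.mem_filter, Finset.mem_range, Finset.card_range] at hb ⊢
      exact Nat.div_lt_of_lt_mul hb.1
    · intro j hj
      simp only [Finset.mem_filter, Finset.mem_range, Finset.card_range] at hj ⊢
      exact ⟨Nat.mul_lt_mul_of_pos_left hj hd0, dvd_mul_right d j⟩
    · intro b hb
      simp only [Finset.mem_filter] at hb
      exact Nat.mul_div_cancel' hb.2
    · intro j _
      exact Nat.mul_div_cancel_left j hd0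
  rw [h2]
  have : (d : ℝ) ≠ 0 := by exact_mod_cast hd0.ne'
  have : (k : ℝ) ≠ 0 := by exact_mod_cast hk0.ne'
  push_cast
  field_simp

lemma abs_moebius_cast_le_one (d : ℕ) : |(ArithmeticFunction.moebius d : ℝ)| ≤ 1 := by
  exact_mod_cast ArithmeticFunction.abs_moebius_le_one (n := d)

lemma abs_card_coprime_range_sub_le {q : ℕ} (hq : 0 < q) (N : ℕ) :
    |(((Finset.range N).filter (fun b => b.Coprime q)).card : ℝ) - q.totient / q * N| ≤
      q.divisors.card := by
  rw [card_coprime_range hq, totient_div_eq_sum hq, Finset.sum_mul, ← Finset.sum_sub_distrib]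
  refine (Finset.abs_sum_le_sum_abs _ _).trans ?_
  rw [Finset.cast_card]
  refine Finset.sum_le_sum fun d hd => ?_
  have h1 := abs_card_dvd_range_sub_le (Nat.pos_of_mem_divisors hd) N
  have h2 := abs_moebius_cast_le_one d
  calc _ = |(ArithmeticFunction.moebius d : ℝ)| *
        |(((Finset.range N).filter (fun b => d ∣ b)).card : ℝ) - N / d| := by
        rw [← abs_mul]; congr 1; ring
    _ ≤ 1 * 1 := by gcongr
    _ = 1 := one_mul 1

/-- The coefficients `μ(d) / d²` restricted to `d` prime to `l`. -/
noncomputable def moebiusSq (l d : ℕ) : ℝ :=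
  if d.Coprime l then (ArithmeticFunction.moebius d : ℝ) / (d : ℝ) ^ 2 else 0

lemma abs_moebiusSq_le (l d : ℕ) : |moebiusSq l d| ≤ ((d : ℝ) ^ 2)⁻¹ := by
  unfold moebiusSq
  split_ifs
  · rw [abs_div, abs_of_nonneg (by positivity : (0 : ℝ) ≤ (d : ℝ) ^ 2), div_eq_mul_inv]
    exact mul_le_of_le_one_left (by positivity) (abs_moebius_cast_le_one d)
  · simp

lemma summable_moebiusSq (l : ℕ) : Summable (fun d => ‖moebiusSq l d‖) := by
  refine Summable.of_nonneg_of_le (fun _ => norm_nonneg _) (fun d => abs_moebiusSq_le l d) ?_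
  exact Real.summable_nat_pow_inv.mpr one_lt_two

lemma moebiusSq_tsum {l : ℕ} :
    ∑' d, moebiusSq l d = ∏' p : {p : ℕ // p.Prime ∧ ¬ p ∣ l}, (1 - 1 / (p.1 : ℝ) ^ 2) := by
  have h1 : moebiusSq l 1 = 1 := by simp [moebiusSq]
  have hmul : ∀ {m n : ℕ}, m.Coprime n → moebiusSq l (m * n) = moebiusSq l m * moebiusSq l n := by
    intro m n hmn
    simp only [moebiusSq, Nat.coprime_mul_iff_left]
    rw [ArithmeticFunction.isMultiplicative_moebius.map_mul_of_coprime hmn]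
    by_cases hm : m.Coprime l
    · by_cases hn : n.Coprime l
      · rw [if_pos ⟨hm, hn⟩, if_pos hm, if_pos hn]
        push_cast; ring
      · rw [if_neg (fun h => hn h.2), if_neg hn, mul_zero]
    · rw [if_neg (fun h => hm h.1), if_neg hm, zero_mul]
  have key := EulerProduct.eulerProduct_hasProd h1 hmul (summable_moebiusSq l) (by simp [moebiusSq])
  have h2 : ∀ p : Nat.Primes, ∑' e, moebiusSq l ((p : ℕ) ^ e) =
      if (p : ℕ) ∣ l then 1 else 1 - 1 / (p : ℝ) ^ 2 := by
    intro p
    have hp := p.2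
    rw [tsum_eq_sum (s := Finset.range 2)]
    · rw [Finset.sum_range_succ, Finset.sum_range_one, pow_zero, pow_one, h1]
      simp only [moebiusSq, hp.coprime_iff_not_dvd, ArithmeticFunction.moebius_apply_prime hp]
      by_cases h : (p : ℕ) ∣ l
      · simp [h]
      · simp only [h, not_false_eq_true, if_true, if_false]
        push_cast; ring
    · intro e he
      simp only [Finset.mem_range, not_lt] at he
      simp only [moebiusSq]
      rw [ArithmeticFunction.moebius_apply_prime_pow hp (by omega),
        if_neg (by omega : ¬ e = 1)]
      simp
  simp_rw [h2] at key
  symm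
  let i : {p : ℕ // p.Prime ∧ ¬ p ∣ l} → Nat.Primes := fun p => ⟨p.1, p.2.1⟩
  have hi : Function.Injective i := by
    intro p p' h
    exact Subtype.ext (congrArg (fun x : Nat.Primes => (x : ℕ)) h)
  have h3 := (hi.hasProd_iff (f := fun p : Nat.Primes =>
    if (p : ℕ) ∣ l then (1 : ℝ) else 1 - 1 / (p : ℝ) ^ 2) (by
      intro p hp
      by_contra h
      apply hp
      have : ¬ (p : ℕ) ∣ l := fun h' => h (if_pos h')
      exact ⟨⟨p, p.2, this⟩, rfl⟩)).mpr key
  rw [← h3.tprod_eq]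
  refine tprod_congr fun p => ?_
  exact (if_neg p.2.2).symm

lemma abs_sum_moebiusSq_sub_le (l n : ℕ) :
    |∑ d ∈ Finset.range (n + 1), moebiusSq l d - ∑' d, moebiusSq l d| ≤ 2 / ((n : ℝ) + 1) := by
  have h1 := (summable_moebiusSq l).of_norm.hasSum.tendsto_sum_nat
  have h2 : Tendsto (fun N => |∑ d ∈ Finset.range (n + 1), moebiusSq l d -
      ∑ d ∈ Finset.range N, moebiusSq l d|) atTop
      (nhds |∑ d ∈ Finset.range (n + 1), moebiusSq l d - ∑' d, moebiusSq l d|) :=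
    (tendsto_const_nhds.sub h1).abs
  refine le_of_tendsto h2 ?_
  filter_upwards [eventually_ge_atTop (n + 1)] with N hN
  rw [abs_sub_comm, ← Finset.sum_Ico_eq_sub _ hN]
  refine (Finset.abs_sum_le_sum_abs _ _).trans ?_
  refine (Finset.sum_le_sum fun d _ => abs_moebiusSq_le l d).trans ?_
  exact sum_Ioo_inv_sq_le n N

/-- The average of `φ(q) / q` over `q` prime to `l`. -/
theorem abs_sum_totient_div_sub_le {l : ℕ} (hl : 2 ≤ l) {n : ℕ} (hn : 0 < n) :
    |∑ q ∈ Finset.Icc 1 n with q.Coprime l, (q.totient : ℝ) / q - Cconst l * n| ≤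
      (l.divisors.card + 4) * (1 + Real.log n) := by
  have hl0 : (0 : ℝ) < l := by exact_mod_cast (by omega : 0 < l)
  have hphi : (l.totient : ℝ) / l ≤ 1 := by
    rw [div_le_one hl0]; exact_mod_cast Nat.totient_le l
  have hphi0 : 0 ≤ (l.totient : ℝ) / l := by positivity
  have hn1 : (1 : ℝ) ≤ n := by exact_mod_cast hn
  have hlog := Real.log_nonneg hn1
  have h1 : ∑ q ∈ Finset.Icc 1 n with q.Coprime l, (q.totient : ℝ) / q =
      ∑ d ∈ Finset.Icc 1 n, (if d.Coprime l then (ArithmeticFunction.moebius d : ℝ) / d *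
        ((Finset.Icc 1 (n / d)).filter (fun m => m.Coprime l)).card else 0) := by
    calc _ = ∑ q ∈ Finset.Icc 1 n with q.Coprime l, ∑ d ∈ Finset.Icc 1 n with d ∣ q,
          (ArithmeticFunction.moebius d : ℝ) / d := by
          refine Finset.sum_congr rfl fun q hq => ?_
          simp only [Finset.mem_filter, Finset.mem_Icc] at hq
          rw [totient_div_eq_sum (by omega)]
          refine Finset.sum_congr ?_ fun _ _ => rfl
          ext d
          simp only [Nat.mem_divisors, Finset.mem_filter, Finset.mem_Icc]
          constructor
          · rintro ⟨h, h'⟩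
            have := Nat.le_of_dvd (by omega) h
            have := Nat.pos_of_dvd_of_pos h (by omega)
            exact ⟨⟨by omega, by omega⟩, h⟩
          · rintro ⟨_, h⟩; exact ⟨h, by omega⟩
      _ = ∑ d ∈ Finset.Icc 1 n, ∑ q ∈ Finset.Icc 1 n with (q.Coprime l ∧ d ∣ q),
          (ArithmeticFunction.moebius d : ℝ) / d := by
          simp only [Finset.sum_filter]
          have : ∀ q : ℕ, (if q.Coprime l then ∑ d ∈ Finset.Icc 1 n, (if d ∣ q then
            (ArithmeticFunction.moebius d : ℝ) / d else 0) else 0) = ∑ d ∈ Finset.Icc 1 n,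
              (if q.Coprime l ∧ d ∣ q then (ArithmeticFunction.moebius d : ℝ) / d else 0) := by
            intro q
            by_cases h : q.Coprime l
            · rw [if_pos h]
              exact Finset.sum_congr rfl fun d _ => (if_congr (and_iff_right h) rfl rfl).symm
            · rw [if_neg h]
              exact (Finset.sum_eq_zero fun d _ => if_neg fun h' => h h'.1).symm
          rw [Finset.sum_congr rfl fun q _ => this q, Finset.sum_comm]
      _ = _ := by
          refine Finset.sum_congr rfl fun d hd => ?_
          simp only [Finset.mem_Icc] at hd
          rw [Finset.sum_const, nsmul_eq_mul, mul_comm]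
          split_ifs with hdl
          · congr 2
            refine Finset.card_bij' (fun q _ => q / d) (fun m _ => d * m) ?_ ?_ ?_ ?_
            · intro q hq
              simp only [Finset.mem_filter, Finset.mem_Icc] at hq ⊢
              obtain ⟨⟨h1, h2⟩, h3, k, rfl⟩ := hq
              rw [Nat.mul_div_cancel_left k (by omega)]
              refine ⟨⟨?_, ?_⟩, h3.coprime_mul_left⟩
              · exact Nat.pos_of_mul_pos_left h1
              · rw [Nat.le_div_iff_mul_le (by omega), mul_comm]; exact h2
            · intro m hm
              simp only [Finset.mem_filter, Finset.mem_Icc] at hm ⊢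
              obtain ⟨⟨h1, h2⟩, h3⟩ := hm
              rw [Nat.le_div_iff_mul_le (by omega), mul_comm] at h2
              exact ⟨⟨Nat.mul_pos (by omega) h1, h2⟩, hdl.mul_left h3, dvd_mul_right d m⟩
            · intro q hq
              simp only [Finset.mem_filter] at hq
              exact Nat.mul_div_cancel' hq.2.2
            · intro m _
              exact Nat.mul_div_cancel_left m (by omega)
          · have : (Finset.Icc 1 n).filter (fun q => q.Coprime l ∧ d ∣ q) = ∅ := by
              refine Finset.filter_eq_empty_iff.mpr fun q _ h => hdl ?_
              exact h.1.coprime_dvd_left h.2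
            rw [this]; simp
  have h2 : ∀ d ∈ Finset.Icc 1 n,
      |(((Finset.Icc 1 (n / d)).filter (fun m => m.Coprime l)).card : ℝ) -
        (l.totient : ℝ) / l * (n / d)| ≤ l.divisors.card + 2 := by
    intro d hd
    simp only [Finset.mem_Icc] at hd
    have h3 : (Finset.Icc 1 (n / d)).filter (fun m => m.Coprime l) =
        (Finset.range (n / d + 1)).filter (fun m => m.Coprime l) := by
      ext m
      simp only [Finset.mem_filter, Finset.mem_Icc, Finset.mem_range]
      constructor
      · rintro ⟨⟨h1, h2⟩, h3⟩; exact ⟨by omega, h3⟩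
      · rintro ⟨h1, h3⟩
        refine ⟨⟨Nat.pos_of_ne_zero fun h => ?_, by omega⟩, h3⟩
        rw [h, Nat.coprime_zero_left] at h3; omega
    rw [h3]
    have h4 := abs_card_coprime_range_sub_le (by omega : 0 < l) (n / d + 1)
    have hd0 : (0 : ℝ) < d := by exact_mod_cast hd.1
    have h5 : ((n / d : ℕ) : ℝ) ≤ n / d := Nat.cast_div_le
    have h6 : (n : ℝ) / d ≤ (n / d : ℕ) + 1 := by
      rw [div_le_iff₀ hd0]
      have := (Nat.lt_mul_div_succ n hd.1).le
      rw [mul_comm] at this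
      exact_mod_cast this
    push_cast at h4
    rw [abs_le] at h4 ⊢
    constructor <;> nlinarith
  have hC : Cconst l * n = (l.totient : ℝ) / l * n * ∑' d, moebiusSq l d := by
    rw [moebiusSq_tsum, Cconst]; ring
  have h3 : ∑ d ∈ Finset.Icc 1 n, (if d.Coprime l then (ArithmeticFunction.moebius d : ℝ) / d *
      ((l.totient : ℝ) / l * (n / d)) else 0) =
      (l.totient : ℝ) / l * n * ∑ d ∈ Finset.range (n + 1), moebiusSq l d := by
    rw [Finset.range_eq_Ico, Finset.sum_eq_sum_Ico_succ_bot (by omega)]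
    have : moebiusSq l 0 = 0 := by simp [moebiusSq]
    rw [this, zero_add, Finset.mul_sum]
    refine Finset.sum_congr rfl fun d _ => ?_
    unfold moebiusSq
    split_ifs
    · field_simp
    · simp
  have h4 : |∑ d ∈ Finset.Icc 1 n, (if d.Coprime l then (ArithmeticFunction.moebius d : ℝ) / d *
        ((Finset.Icc 1 (n / d)).filter (fun m => m.Coprime l)).card else 0) -
      ∑ d ∈ Finset.Icc 1 n, (if d.Coprime l then (ArithmeticFunction.moebius d : ℝ) / d *
      ((l.totient : ℝ) / l * (n / d)) else 0)| ≤ (l.divisors.card + 2) * (1 + Real.log n) := by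
    rw [← Finset.sum_sub_distrib]
    refine (Finset.abs_sum_le_sum_abs _ _).trans ?_
    calc _ ≤ ∑ d ∈ Finset.Icc 1 n, (l.divisors.card + 2) * (1 / (d : ℝ)) := by
          refine Finset.sum_le_sum fun d hd => ?_
          have hd0 : (0 : ℝ) ≤ d := Nat.cast_nonneg d
          split_ifs
          · rw [← mul_sub, abs_mul, abs_div, mul_comm, abs_of_nonneg hd0]
            have h5 := h2 d hd
            have h6 := abs_moebius_cast_le_one d
            gcongr
          · rw [sub_zero, abs_zero]; positivity
      _ ≤ _ := by
          rw [← Finset.mul_sum]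
          gcongr
          exact sum_Icc_one_div_le n
  have h5 : |(l.totient : ℝ) / l * n * ∑ d ∈ Finset.range (n + 1), moebiusSq l d -
      (l.totient : ℝ) / l * n * ∑' d, moebiusSq l d| ≤ 2 := by
    rw [← mul_sub, abs_mul, abs_of_nonneg (by positivity)]
    calc _ ≤ 1 * n * (2 / ((n : ℝ) + 1)) := by
          gcongr
          exact abs_sum_moebiusSq_sub_le l n
      _ ≤ 2 := by
          rw [one_mul, mul_div_assoc', div_le_iff₀ (by linarith)]; linarith
  rw [h1, hC]
  rw [h3] at h4
  have h6 := abs_sub_le (∑ d ∈ Finset.Icc 1 n, (if d.Coprime l then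
    (ArithmeticFunction.moebius d : ℝ) / d *
      ((Finset.Icc 1 (n / d)).filter (fun m => m.Coprime l)).card else 0))
    ((l.totient : ℝ) / l * n * ∑ d ∈ Finset.range (n + 1), moebiusSq l d)
    ((l.totient : ℝ) / l * n * ∑' d, moebiusSq l d)
  nlinarith

/-- The density `((1 - u) / u) log (lam / (lam - u))`. -/
noncomputable def kap (lam u : ℝ) : ℝ := ((1 - u) / u) * Real.log (lam / (lam - u))

lemma kap_nonneg {lam u : ℝ} (hlam : 2 ≤ lam) (hu : u ∈ Set.Ioc (0 : ℝ) 1) : 0 ≤ kap lam u := by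
  obtain ⟨h0, h1⟩ := hu
  refine mul_nonneg (div_nonneg (by linarith) h0.le) (Real.log_nonneg ?_)
  rw [le_div_iff₀ (by linarith)]; linarith

lemma kap_le_one {lam u : ℝ} (hlam : 2 ≤ lam) (hu : u ∈ Set.Ioc (0 : ℝ) 1) : kap lam u ≤ 1 := by
  obtain ⟨h0, h1⟩ := hu
  have h2 : Real.log (lam / (lam - u)) ≤ u := by
    refine (Real.log_le_sub_one_of_pos (div_pos (by linarith) (by linarith))).trans ?_
    rw [sub_le_iff_le_add, div_le_iff₀ (by linarith)]
    nlinarith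
  have h3 : 0 ≤ (1 - u) / u := div_nonneg (by linarith) h0.le
  calc kap lam u ≤ (1 - u) / u * u := mul_le_mul_of_nonneg_left h2 h3
    _ = 1 - u := div_mul_cancel₀ _ h0.ne'
    _ ≤ 1 := by linarith

lemma kap_antitoneOn {lam : ℝ} (hlam : 2 ≤ lam) : AntitoneOn (kap lam) (Set.Ioc 0 1) := by
  have hder : ∀ u ∈ Set.Ioc (0 : ℝ) 1, HasDerivAt (kap lam)
      (((-1 : ℝ) * u - (1 - u) * 1) / u ^ 2 * Real.log (lam / (lam - u)) +
        (1 - u) / u * (((0 * (lam - u) - lam * (-1)) / (lam - u) ^ 2) / (lam / (lam - u)))) u := by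
    intro u hu
    obtain ⟨h0, h1⟩ := hu
    have h2 : HasDerivAt (fun u : ℝ => 1 - u) (-1) u := by
      simpa using (hasDerivAt_id u).const_sub 1
    have h3 : HasDerivAt (fun u : ℝ => lam - u) (-1) u := by
      simpa using (hasDerivAt_id u).const_sub lam
    have h4 := h2.div (hasDerivAt_id u) h0.ne'
    have h5 : lam - u ≠ 0 := by linarith
    have h6 := ((hasDerivAt_const u lam).div h3 h5).log (by
      exact (div_pos (by linarith) (by linarith)).ne')
    exact h4.mul h6
  refine antitoneOn_of_deriv_nonpos (convex_Ioc 0 1)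
    (fun u hu => (hder u hu).continuousAt.continuousWithinAt)
    (fun u hu => (hder u (interior_subset hu)).differentiableAt.differentiableWithinAt)
    fun u hu => ?_
  have hu' := interior_subset hu
  rw [(hder u hu').deriv]
  obtain ⟨h0, h1⟩ := hu'
  have h5 : 0 < lam - u := by linarith
  have hlog : u / lam ≤ Real.log (lam / (lam - u)) := by
    have h := Real.log_le_sub_one_of_pos (div_pos h5 (by linarith : 0 < lam))
    have h6 : Real.log (lam / (lam - u)) = - Real.log ((lam - u) / lam) := by
      rw [← Real.log_inv, inv_div]
    rw [h6]
    have : (lam - u) / lam = 1 - u / lam := by field_simp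
    rw [this] at h ⊢
    linarith
  have h7 : ((-1 : ℝ) * u - (1 - u) * 1) / u ^ 2 * Real.log (lam / (lam - u)) =
      - (Real.log (lam / (lam - u)) / u ^ 2) := by ring
  have h8 : (1 - u) / u * (((0 * (lam - u) - lam * (-1)) / (lam - u) ^ 2) / (lam / (lam - u))) =
      (1 - u) / (u * (lam - u)) := by
    have : lam ≠ 0 := by linarith
    field_simp; ring
  rw [h7, h8]
  have h9 : (1 - u) / (u * (lam - u)) ≤ (u / lam) / u ^ 2 := by
    have hl0 : 0 < lam := by linarith
    have : (u / lam) / u ^ 2 = 1 / (lam * u) := by field_simp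
    rw [this, div_le_div_iff₀ (by positivity) (by positivity)]
    nlinarith [mul_pos h0 h0, mul_nonneg h0.le (by linarith : 0 ≤ lam - 1)]
  have h10 : (u / lam) / u ^ 2 ≤ Real.log (lam / (lam - u)) / u ^ 2 := by gcongr
  linarith

lemma kap_one (lam : ℝ) : kap lam 1 = 0 := by simp [kap]

lemma abs_sum_kap_sub_integral_le {lam : ℝ} (hlam : 2 ≤ lam) {Q : ℕ} (hQ : 0 < Q) :
    |∑ q ∈ Finset.Icc 1 Q, kap lam (q / Q) / Q - ∫ u in (0 : ℝ)..1, kap lam u| ≤ 1 / Q := by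
  have hQ0 : (0 : ℝ) < Q := by exact_mod_cast hQ
  let k : ℝ → ℝ := fun u => if u ≤ 0 then 1 else kap lam u
  have hk : AntitoneOn k (Set.Icc 0 1) := by
    intro x hx y hy hxy
    simp only [k]
    split_ifs with h1 h2 h2
    · exact le_rfl
    · linarith
    · exact kap_le_one hlam ⟨not_le.mp h1, hy.2⟩
    · exact kap_antitoneOn hlam ⟨not_le.mp h2, hx.2⟩ ⟨not_le.mp h1, hy.2⟩ hxy
  have hF : AntitoneOn (fun x : ℝ => k (x / Q)) (Set.Icc (0 : ℝ) (0 + (Q : ℕ))) := by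
    intro x hx y hy hxy
    rw [zero_add] at hx hy
    refine hk ⟨div_nonneg hx.1 hQ0.le, ?_⟩ ⟨div_nonneg hy.1 hQ0.le, ?_⟩ (by gcongr)
    · rw [div_le_one hQ0]; exact hx.2
    · rw [div_le_one hQ0]; exact hy.2
  have h1 := hF.sum_le_integral
  have h2 := hF.integral_le_sum
  have h3 : ∫ x in (0 : ℝ)..(0 + (Q : ℕ)), k (x / Q) = Q * ∫ u in (0 : ℝ)..1, kap lam u := by
    rw [intervalIntegral.integral_comp_div _ hQ0.ne', zero_add, zero_div, div_self hQ0.ne',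
      smul_eq_mul]
    congr 1
    refine intervalIntegral.integral_congr_ae (Eventually.of_forall fun u hu => ?_)
    rw [Set.uIoc_of_le zero_le_one] at hu
    simp only [k, if_neg (not_le.mpr hu.1)]
  rw [h3] at h1 h2
  set S := ∑ q ∈ Finset.Icc 1 Q, kap lam (q / Q) with hS
  have h4 : ∑ i ∈ Finset.range Q, k ((0 + ((i + 1 : ℕ) : ℝ)) / Q) = S := by
    rw [hS, Finset.range_eq_Ico, Finset.sum_Ico_add' (fun i : ℕ => k ((0 + (i : ℝ)) / Q)) 0 Q 1]
    refine Finset.sum_congr (by ext; simp) fun i hi => ?_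
    simp only [Finset.mem_Icc] at hi
    have : ¬ ((0 + (i : ℝ)) / Q ≤ 0) := by
      rw [zero_add, not_le]; exact div_pos (by exact_mod_cast hi.1) hQ0
    simp only [k, if_neg this]
    rw [zero_add]
  have h5 : ∑ i ∈ Finset.range Q, k ((0 + (i : ℝ)) / Q) ≤ S + 1 := by
    have h6 := Finset.sum_range_succ' (fun i : ℕ => k ((0 + (i : ℝ)) / Q)) Q
    rw [Finset.sum_range_succ, h4] at h6
    have h7 : k ((0 + ((0 : ℕ) : ℝ)) / Q) = 1 := by simp [k]
    have h8 : 0 ≤ k ((0 + (Q : ℝ)) / Q) := by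
      rw [zero_add, div_self hQ0.ne']
      simp only [k]
      rw [if_neg (by norm_num), kap_one]
    linarith
  rw [h4] at h1
  rw [← Finset.sum_div, ← hS]
  have h9 : S / Q - ∫ u in (0 : ℝ)..1, kap lam u =
      (S - Q * ∫ u in (0 : ℝ)..1, kap lam u) / Q := by field_simp
  rw [h9, abs_div, abs_of_pos hQ0]
  gcongr
  rw [abs_le]
  constructor <;> linarith

/-- Abel's inequality. -/
lemma abs_sum_mul_le_of_antitone (e k : ℕ → ℝ) {M : ℝ} (n : ℕ)
    (hk : ∀ i, 1 ≤ i → i < n → k (i + 1) ≤ k i) (hk0 : ∀ i, 1 ≤ i → i ≤ n → 0 ≤ k i)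
    (hM : ∀ m, 1 ≤ m → m ≤ n → |∑ i ∈ Finset.Icc 1 m, e i| ≤ M) (hn : 1 ≤ n) :
    |∑ i ∈ Finset.Icc 1 n, e i * k i| ≤ M * k 1 := by
  have hM0 : 0 ≤ M := (abs_nonneg _).trans (hM 1 le_rfl hn)
  have key : ∀ m, 1 ≤ m → m ≤ n →
      |∑ i ∈ Finset.Icc 1 m, e i * k i - (∑ i ∈ Finset.Icc 1 m, e i) * k m| ≤
        M * (k 1 - k m) := by
    intro m hm
    induction m, hm using Nat.le_induction with
    | base => intro _; simp
    | succ m hm ih =>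
      intro hmn
      have h1 := ih (by omega)
      have h2 := hM m hm (by omega)
      have h3 := hk m hm (by omega)
      rw [Finset.sum_Icc_succ_top (by omega), Finset.sum_Icc_succ_top (by omega)]
      have h4 : ∑ i ∈ Finset.Icc 1 m, e i * k i + e (m + 1) * k (m + 1) -
          (∑ i ∈ Finset.Icc 1 m, e i + e (m + 1)) * k (m + 1) =
          (∑ i ∈ Finset.Icc 1 m, e i * k i - (∑ i ∈ Finset.Icc 1 m, e i) * k m) +
          (∑ i ∈ Finset.Icc 1 m, e i) * (k m - k (m + 1)) := by ring
      rw [h4]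
      refine (abs_add_le _ _).trans ?_
      rw [abs_mul, abs_of_nonneg (by linarith : 0 ≤ k m - k (m + 1))]
      have h5 : |∑ i ∈ Finset.Icc 1 m, e i| * (k m - k (m + 1)) ≤ M * (k m - k (m + 1)) :=
        mul_le_mul_of_nonneg_right h2 (by linarith)
      linarith
  have h1 := key n hn le_rfl
  have h2 := hM n hn le_rfl
  have h3 := hk0 n hn le_rfl
  have h4 : |(∑ i ∈ Finset.Icc 1 n, e i) * k n| ≤ M * k n := by
    rw [abs_mul, abs_of_nonneg h3]; gcongr
  have h5 := abs_add_le (∑ i ∈ Finset.Icc 1 n, e i * k i - (∑ i ∈ Finset.Icc 1 n, e i) * k n)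
    ((∑ i ∈ Finset.Icc 1 n, e i) * k n)
  rw [sub_add_cancel] at h5
  linarith

theorem abs_sum_totient_kap_sub_le {l : ℕ} (hl : 2 ≤ l) {lam : ℝ} (hlam : 2 ≤ lam) {Q : ℕ}
    (hQ : 0 < Q) :
    |∑ q ∈ Finset.Icc 1 Q with q.Coprime l, (q.totient : ℝ) / q * (kap lam (q / Q) / Q) -
        Cconst l * ∫ u in (0 : ℝ)..1, kap lam u| ≤
      (l.divisors.card + 4 + |Cconst l|) * (1 + Real.log Q) / Q := by
  have hQ0 : (0 : ℝ) < Q := by exact_mod_cast hQ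
  have hQ1 : (1 : ℝ) ≤ Q := by exact_mod_cast hQ
  have hlogQ := Real.log_nonneg hQ1
  have hmem : ∀ i : ℕ, 1 ≤ i → i ≤ Q → (i : ℝ) / Q ∈ Set.Ioc (0 : ℝ) 1 := by
    intro i h1 h2
    refine ⟨div_pos (by exact_mod_cast h1) hQ0, ?_⟩
    rw [div_le_one hQ0]; exact_mod_cast h2
  have h1 := abs_sum_mul_le_of_antitone
    (fun q => (if q.Coprime l then (q.totient : ℝ) / q else 0) - Cconst l)
    (fun q => kap lam (q / Q) / Q) (M := (l.divisors.card + 4) * (1 + Real.log Q)) Q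
    (by
      intro i h1 h2
      have := kap_antitoneOn hlam (hmem i h1 h2.le) (hmem (i + 1) (by omega) h2) (by
        push_cast; gcongr; linarith)
      gcongr)
    (fun i h1 h2 => div_nonneg (kap_nonneg hlam (hmem i h1 h2)) hQ0.le)
    (by
      intro m h1 h2
      have h3 := abs_sum_totient_div_sub_le hl h1
      rw [Finset.sum_filter] at h3
      rw [Finset.sum_sub_distrib, Finset.sum_const, Nat.card_Icc, nsmul_eq_mul]
      have h4 : Real.log m ≤ Real.log Q :=
        Real.log_le_log (by exact_mod_cast h1) (by exact_mod_cast h2)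
      have h5 : ((m + 1 - 1 : ℕ) : ℝ) * Cconst l = Cconst l * m := by
        rw [Nat.add_sub_cancel, mul_comm]
      rw [h5]
      refine h3.trans ?_
      gcongr) hQ
  have h2 := abs_sum_kap_sub_integral_le hlam hQ
  simp only [sub_mul, Finset.sum_sub_distrib, ite_mul, zero_mul, ← Finset.mul_sum] at h1
  rw [← Finset.sum_filter] at h1
  have h3 : kap lam ((1 : ℕ) / Q) / Q ≤ 1 / Q := by
    gcongr; exact kap_le_one hlam (hmem 1 le_rfl hQ)
  have h4 : |Cconst l * ∑ q ∈ Finset.Icc 1 Q, kap lam (q / Q) / Q -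
      Cconst l * ∫ u in (0 : ℝ)..1, kap lam u| ≤ |Cconst l| * (1 / Q) := by
    rw [← mul_sub, abs_mul]; gcongr
  have h5 := abs_sub_le (∑ q ∈ Finset.Icc 1 Q with q.Coprime l,
    (q.totient : ℝ) / q * (kap lam (q / Q) / Q)) (Cconst l * ∑ q ∈ Finset.Icc 1 Q,
      kap lam (q / Q) / Q) (Cconst l * ∫ u in (0 : ℝ)..1, kap lam u)
  have h6 : (l.divisors.card + 4) * (1 + Real.log Q) * (kap lam ((1 : ℕ) / Q) / Q) ≤
      (l.divisors.card + 4) * (1 + Real.log Q) * (1 / Q) :=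
    mul_le_mul_of_nonneg_left h3 (by positivity)
  have h7 : |Cconst l| * (1 / (Q : ℝ)) ≤ |Cconst l| * (1 + Real.log Q) * (1 / Q) := by
    have : 0 ≤ |Cconst l| * Real.log Q * (1 / (Q : ℝ)) := by positivity
    nlinarith
  calc _ ≤ _ := h5
    _ ≤ (l.divisors.card + 4) * (1 + Real.log Q) * (1 / Q) +
        |Cconst l| * (1 + Real.log Q) * (1 / Q) := by linarith
    _ = _ := by ring

lemma log_sub_log_bounds {x : ℝ} (hx : 1 < x) :
    1 / x ≤ Real.log x - Real.log (x - 1) ∧ Real.log x - Real.log (x - 1) ≤ 1 / (x - 1) := by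
  have h0 : 0 < x := by linarith
  have h1 : 0 < x - 1 := by linarith
  constructor
  · have h := Real.log_le_sub_one_of_pos (div_pos h1 h0)
    rw [Real.log_div h1.ne' h0.ne'] at h
    have : (x - 1) / x = 1 - 1 / x := by field_simp
    linarith
  · have h := Real.log_le_sub_one_of_pos (div_pos h0 h1)
    rw [Real.log_div h0.ne' h1.ne'] at h
    have : x / (x - 1) = 1 + 1 / (x - 1) := by field_simp; ring
    linarith

/-- The average of `1 / t` over the last `q` integers up to `lam * Q`. -/
lemma abs_mean_inv_sub_log_le {lam : ℝ} (hlam : 2 ≤ lam) {q Q T : ℕ} (hq : 0 < q) (hqQ : q ≤ Q)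
    (hT1 : (T : ℝ) ≤ lam * Q) (hT2 : lam * Q < T + 1) (hT : 2 * Q ≤ T) :
    |(q : ℝ)⁻¹ * ∑ v ∈ Finset.range q, 1 / ((T : ℝ) - v) -
      (q : ℝ)⁻¹ * Real.log (lam / (lam - q / Q))| ≤ 1 / (Q : ℝ) ^ 2 := by
  have hq0 : (0 : ℝ) < q := by exact_mod_cast hq
  have hQ0 : (0 : ℝ) < Q := by exact_mod_cast hq.trans_le hqQ
  have hqQ' : (q : ℝ) ≤ Q := by exact_mod_cast hqQ
  have hTQ : 2 * (Q : ℝ) ≤ T := by exact_mod_cast hT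
  set y := lam * Q with hy
  have hlog : Real.log (lam / (lam - q / Q)) =
      ∑ v ∈ Finset.range q, (Real.log (y - v) - Real.log (y - v - 1)) := by
    have h1 : lam / (lam - q / Q) = y / (y - q) := by
      rw [hy]
      have : lam - (q : ℝ) / Q ≠ 0 := by
        have : (q : ℝ) / Q ≤ 1 := by rw [div_le_one hQ0]; exact hqQ'
        intro h; linarith
      have h3 : lam * (Q : ℝ) - q ≠ 0 := by intro h; linarith
      rw [div_eq_div_iff this h3]
      field_simp
    rw [h1, Real.log_div (by intro h; linarith) (by intro h; linarith)]
    have := Finset.sum_range_sub' (fun v : ℕ => Real.log (y - v)) q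
    simp only [Nat.cast_zero, sub_zero] at this
    rw [← this]
    refine Finset.sum_congr rfl fun v _ => ?_
    push_cast; rw [sub_sub]
  rw [hlog, ← mul_sub, ← Finset.sum_sub_distrib, abs_mul, abs_of_pos (inv_pos.mpr hq0),
    inv_mul_le_iff₀ hq0]
  refine (Finset.abs_sum_le_sum_abs _ _).trans ?_
  refine (Finset.sum_le_card_nsmul _ _ (1 / (Q : ℝ) ^ 2) fun v hv => ?_).trans (by simp)
  simp only [Finset.mem_range] at hv
  have hv1 : (v : ℝ) + 1 ≤ q := by exact_mod_cast hv
  have hq1 : (1 : ℝ) ≤ q := by exact_mod_cast hq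
  have ht : (Q : ℝ) ≤ T - v - 1 := by linarith
  obtain ⟨h1, h2⟩ := log_sub_log_bounds (x := y - v) (by linarith)
  have h3 : 1 / ((T : ℝ) - v + 1) ≤ 1 / (y - v) :=
    one_div_le_one_div_of_le (by linarith) (by linarith)
  have h4 : 1 / (y - v - 1) ≤ 1 / ((T : ℝ) - v - 1) :=
    one_div_le_one_div_of_le (by linarith) (by linarith)
  have hQQ : ∀ x : ℝ, Q ≤ x → 1 / x - 1 / (x + 1) ≤ 1 / (Q : ℝ) ^ 2 := by
    intro x hx
    have hx0 : 0 < x := by linarith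
    have : 1 / x - 1 / (x + 1) = 1 / (x * (x + 1)) := by field_simp; ring
    rw [this]
    apply one_div_le_one_div_of_le (by positivity)
    nlinarith
  have h5 := hQQ (T - v) (by linarith)
  have h6 := hQQ (T - v - 1) ht
  rw [sub_add_cancel] at h6
  rw [abs_le]
  constructor <;> linarith

set_option maxHeartbeats 1600000 in
lemma exists_abs_farey_sum_sub_le {l : ℕ} (hl : 2 ≤ l) {δ : ℝ} (hδ : 0 < δ) :
    ∃ C : ℝ, 0 ≤ C ∧ ∀ (Q T : ℕ) (ε lam s : ℝ) (e : ℤ), 0 < Q → 2 ≤ lam → (T : ℝ) ≤ lam * Q →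
      lam * Q < T + 1 → ε * Q ≤ 1 → 1 < ε * (Q + 1) → 0 ≤ s → s ≤ 1 → (e = 1 ∨ e = -1) →
      |∑ q ∈ Finset.Icc 1 Q with q.Coprime l, ∑ b ∈ Finset.range ⌈(1 - s) * q / l⌉₊ with
          b.Coprime q, (1 - ε * q) / (q * lastDenom T e l q b) -
        (1 - s) * (Cconst l / l * ∫ u in (0 : ℝ)..1, kap lam u)| ≤ C * ((Q : ℝ) ^ δ / √Q) := by
  obtain ⟨W, hW, hW'⟩ := exists_kloosterman_weights
  set δ₁ := δ / 4 with hδ₁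
  have hδ₁0 : 0 < δ₁ := by positivity
  obtain ⟨C₁, hC₁0, hC₁⟩ := hW' δ₁ hδ₁0
  obtain ⟨A, hA1, hA⟩ := exists_card_divisors_le hδ₁0
  set D := 1 + 1 / δ₁ with hD
  have hD0 : 0 ≤ D := by positivity
  set E := (l.divisors.card + 4 + |Cconst l|) with hE
  have hE0 : 0 ≤ E := by positivity
  refine ⟨2 * D ^ 2 * A * C₁ + 2 * A * D + 2 + E * D, by positivity, ?_⟩
  intro Q T ε lam s e hQ hlam hT1 hT2 hε1 hε2 hs0 hs1 he
  have hQ0 : (0 : ℝ) < Q := by exact_mod_cast hQ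
  have hQ1 : (1 : ℝ) ≤ Q := by exact_mod_cast hQ
  have hl2 : (2 : ℝ) ≤ l := by exact_mod_cast hl
  have hl0 : (0 : ℝ) < l := by linarith
  have hε0 : 0 < ε := by
    by_contra h
    have : ε * (Q + 1) ≤ 0 := mul_nonpos_of_nonpos_of_nonneg (not_lt.mp h) (by linarith)
    linarith
  have hT : 2 * Q ≤ T := by
    have : (2 * Q : ℝ) < T + 1 := by nlinarith
    have : 2 * Q < T + 1 := by exact_mod_cast this
    omega
  have hTQ : 2 * (Q : ℝ) ≤ T := by exact_mod_cast hT
  set P : ℝ := (Q : ℝ) ^ δ₁ with hP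
  have hP1 : 1 ≤ P := Real.one_le_rpow hQ1 hδ₁0.le
  have hlogP : 1 + Real.log Q ≤ D * P := one_add_log_le_rpow hδ₁0 hQ1
  have hlogQ := Real.log_nonneg hQ1
  have hPδ : (Q : ℝ) ^ δ = P ^ 4 := by
    rw [hP, ← Real.rpow_natCast, ← Real.rpow_mul hQ0.le, hδ₁]; congr 1; push_cast; ring
  -- the comparison for a single denominator
  let X : ℕ → ℝ := fun q => ∑ b ∈ Finset.range ⌈(1 - s) * q / l⌉₊ with b.Coprime q,
    (1 - ε * q) / (q * lastDenom T e l q b)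
  let Y : ℕ → ℝ := fun q => (1 - s) / l * ((q.totient : ℝ) / q * (kap lam (q / Q) / Q))
  have hterm : ∀ q ∈ (Finset.Icc 1 Q).filter (fun q => q.Coprime l), |X q - Y q| ≤
      2 * D ^ 2 * A * P ^ 3 / Q * (W q / q) + 2 * A * P / Q * (1 / q) + 2 / (Q : ℝ) ^ 2 := by
    intro q hq
    simp only [Finset.mem_filter, Finset.mem_Icc] at hq
    obtain ⟨⟨hq1, hqQ⟩, hql⟩ := hq
    have hq0 : (0 : ℝ) < q := by exact_mod_cast hq1
    have hq1' : (1 : ℝ) ≤ q := by exact_mod_cast hq1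
    have hqQ' : (q : ℝ) ≤ Q := by exact_mod_cast hqQ
    have hlogq := Real.log_nonneg hq1'
    have hlogqQ : Real.log q ≤ Real.log Q := Real.log_le_log hq0 hqQ'
    set x := (1 - s) * q / l with hx
    have hx0 : 0 ≤ x := by
      rw [hx]; exact div_nonneg (mul_nonneg (by linarith) hq0.le) hl0.le
    set N := ⌈x⌉₊ with hN
    have hNx : |(N : ℝ) - x| ≤ 1 := by
      rw [abs_le]
      have := Nat.le_ceil x
      have := Nat.ceil_lt_add_one hx0
      constructor <;> linarith
    have hNq : N ≤ q := by
      rw [hN, Nat.ceil_le, hx, div_le_iff₀ hl0]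
      nlinarith
    set cop : ℝ := (((Finset.range N).filter (fun b => b.Coprime q)).card : ℝ) with hcop
    set m := (q : ℝ)⁻¹ * ∑ v ∈ Finset.range q, 1 / ((T : ℝ) - v) with hm
    set S := ∑ b ∈ Finset.range N with b.Coprime q, (1 : ℝ) / lastDenom T e l q b with hS
    have hτ : (q.divisors.card : ℝ) ≤ A * P := by
      refine (hA q hq1).trans ?_
      rw [hP]; gcongr
    have hw0 : 0 ≤ 1 - ε * q := by nlinarith
    have hw1 : 1 - ε * q ≤ 1 := by nlinarith
    have hX : X q = (1 - ε * q) / q * S := by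
      simp only [X, ← hx, ← hN, hS]
      rw [Finset.mul_sum]
      refine Finset.sum_congr rfl fun b _ => ?_
      rw [div_mul_div_comm, mul_one]
    have hm0 : 0 ≤ m := by
      refine mul_nonneg (by positivity) (Finset.sum_nonneg fun v hv => ?_)
      simp only [Finset.mem_range] at hv
      have : (v : ℝ) < q := by exact_mod_cast hv
      exact one_div_nonneg.mpr (by linarith)
    have hm1 : m ≤ 1 / Q := by
      rw [hm, inv_mul_le_iff₀ hq0]
      refine (Finset.sum_le_card_nsmul _ _ (1 / (Q : ℝ)) fun v hv => ?_).trans (by simp)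
      simp only [Finset.mem_range] at hv
      have : (v : ℝ) < q := by exact_mod_cast hv
      exact one_div_le_one_div_of_le hQ0 (by linarith)
    have hφ0 : 0 ≤ (q.totient : ℝ) / q := by positivity
    have hφ1 : (q.totient : ℝ) / q ≤ 1 := by
      rw [div_le_one hq0]; exact_mod_cast Nat.totient_le q
    have e1 : |(1 - ε * q) / q * S - (1 - ε * q) / q * (m * cop)| ≤
        2 * D ^ 2 * A * P ^ 3 / Q * (W q / q) := by
      rw [← mul_sub, abs_mul, abs_of_nonneg (div_nonneg hw0 hq0.le)]
      have h1 := abs_sum_inv_lastDenom_sub_le hq1 hqQ hT (Nat.coprime_comm.mp hql) he hNq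
        (hW q hq1).1 (hW q hq1).2
      have hWq := (hW q hq1).1
      calc _ ≤ 1 / q * (W q * (2 * (D * P)) * (1 / Q * (A * P * (D * P)))) := by
            gcongr
            refine h1.trans ?_
            gcongr
            · linarith
            · linarith
        _ = _ := by ring
    have e2 : |(1 - ε * q) / q * (m * cop) - (1 - ε * q) / q * (m * ((q.totient : ℝ) / q * x))| ≤
        2 * A * P / Q * (1 / q) := by
      rw [← mul_sub, ← mul_sub, abs_mul, abs_mul, abs_of_nonneg (div_nonneg hw0 hq0.le),
        abs_of_nonneg hm0]
      have h1 := abs_card_coprime_range_sub_le hq1 N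
      have h2 : |(q.totient : ℝ) / q * N - (q.totient : ℝ) / q * x| ≤ 1 := by
        rw [← mul_sub, abs_mul, abs_of_nonneg hφ0]
        exact mul_le_one₀ hφ1 (abs_nonneg _) hNx
      have h3 : |cop - (q.totient : ℝ) / q * x| ≤ 2 * A * P := by
        have := abs_sub_le cop ((q.totient : ℝ) / q * N) ((q.totient : ℝ) / q * x)
        nlinarith
      calc _ ≤ 1 / q * (1 / Q * (2 * A * P)) := by gcongr
        _ = _ := by ring
    have e3 : |(1 - ε * q) / q * (m * ((q.totient : ℝ) / q * x)) - Y q| ≤ 2 / (Q : ℝ) ^ 2 := by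
      set L := (q : ℝ)⁻¹ * Real.log (lam / (lam - q / Q)) with hL
      have h1 : |m - L| ≤ 1 / (Q : ℝ) ^ 2 :=
        abs_mean_inv_sub_log_le hlam hq1 hqQ hT1 hT2 hT
      have h2 : kap lam (q / Q) / Q = (1 - q / Q) * L := by
        rw [kap, hL]; field_simp
      have h3 : (1 - ε * q) / q * (m * ((q.totient : ℝ) / q * x)) - Y q =
          (1 - s) / l * ((q.totient : ℝ) / q) * ((1 - ε * q) * m - (1 - q / Q) * L) := by
        simp only [Y]
        rw [h2, hx]; field_simp
      have h4 : |(1 - ε * q) - (1 - (q : ℝ) / Q)| ≤ 1 / Q := by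
        have h5 : (1 - ε * q) - (1 - (q : ℝ) / Q) = q / Q * (1 - ε * Q) := by field_simp; ring
        have h6 : (q : ℝ) / Q ≤ 1 := by rw [div_le_one hQ0]; exact hqQ'
        rw [h5, abs_mul, abs_of_nonneg (by positivity), abs_of_nonneg (by linarith)]
        calc (q : ℝ) / Q * (1 - ε * Q) ≤ 1 * ε := by
              gcongr
              linarith
          _ ≤ 1 / Q := by rw [one_mul, le_div_iff₀ hQ0]; exact hε1
      have h5 : 0 ≤ 1 - (q : ℝ) / Q := by
        have h6 : (q : ℝ) / Q ≤ 1 := by rw [div_le_one hQ0]; exact hqQ'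
        linarith
      have h6 : |(1 - ε * q) * m - (1 - q / Q) * L| ≤ 2 / (Q : ℝ) ^ 2 := by
        have h7 : (1 - ε * q) * m - (1 - q / Q) * L =
            ((1 - ε * q) - (1 - (q : ℝ) / Q)) * m + (1 - q / Q) * (m - L) := by ring
        rw [h7]
        refine (abs_add_le _ _).trans ?_
        rw [abs_mul _ m, abs_mul _ (m - L), abs_of_nonneg hm0, abs_of_nonneg h5]
        calc _ ≤ 1 / Q * (1 / Q) + 1 * (1 / (Q : ℝ) ^ 2) := by
              gcongr
              have : 0 ≤ (q : ℝ) / Q := by positivity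
              linarith
          _ = _ := by ring
      rw [h3, abs_mul]
      have h7 : |(1 - s) / l * ((q.totient : ℝ) / q)| ≤ 1 := by
        have h8 : 0 ≤ (1 - s) / l := div_nonneg (by linarith) hl0.le
        have h9 : (1 - s) / l ≤ 1 := by rw [div_le_one hl0]; linarith
        rw [abs_of_nonneg (mul_nonneg h8 hφ0)]
        exact mul_le_one₀ h9 hφ0 hφ1
      calc _ ≤ 1 * (2 / (Q : ℝ) ^ 2) := by gcongr
        _ = _ := one_mul _
    rw [hX]
    have h1 := abs_sub_le ((1 - ε * q) / q * S) ((1 - ε * q) / q * (m * cop)) (Y q)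
    have h2 := abs_sub_le ((1 - ε * q) / q * (m * cop))
      ((1 - ε * q) / q * (m * ((q.totient : ℝ) / q * x))) (Y q)
    linarith
  have hsum : |∑ q ∈ Finset.Icc 1 Q with q.Coprime l, X q -
      ∑ q ∈ Finset.Icc 1 Q with q.Coprime l, Y q| ≤
      2 * D ^ 2 * A * P ^ 3 / Q * (C₁ * (√Q * P)) + 2 * A * P / Q * (D * P) + 2 / Q := by
    rw [← Finset.sum_sub_distrib]
    refine (Finset.abs_sum_le_sum_abs _ _).trans ((Finset.sum_le_sum hterm).trans ?_)
    calc _ ≤ ∑ q ∈ Finset.Icc 1 Q, (2 * D ^ 2 * A * P ^ 3 / Q * (W q / q) +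
          2 * A * P / Q * (1 / q) + 2 / (Q : ℝ) ^ 2) := by
          refine Finset.sum_le_sum_of_subset_of_nonneg (Finset.filter_subset _ _) ?_
          intro q hq _
          simp only [Finset.mem_Icc] at hq
          have := (hW q hq.1).1
          positivity
      _ = 2 * D ^ 2 * A * P ^ 3 / Q * (∑ q ∈ Finset.Icc 1 Q, W q / q) +
          2 * A * P / Q * (∑ q ∈ Finset.Icc 1 Q, 1 / (q : ℝ)) + 2 / Q := by
          rw [Finset.sum_add_distrib, Finset.sum_add_distrib, Finset.mul_sum, Finset.mul_sum,
            Finset.sum_const, Nat.card_Icc, Nat.add_sub_cancel, nsmul_eq_mul]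
          congr 1
          field_simp
      _ ≤ _ := by
          have h1 := hC₁ Q hQ
          have h2 := (sum_Icc_one_div_le Q).trans hlogP
          gcongr
  have hY : |∑ q ∈ Finset.Icc 1 Q with q.Coprime l, Y q -
      (1 - s) * (Cconst l / l * ∫ u in (0 : ℝ)..1, kap lam u)| ≤ E * (D * P) / Q := by
    have h1 := abs_sum_totient_kap_sub_le hl hlam hQ
    have h2 : ∑ q ∈ Finset.Icc 1 Q with q.Coprime l, Y q -
        (1 - s) * (Cconst l / l * ∫ u in (0 : ℝ)..1, kap lam u) = (1 - s) / l *
        (∑ q ∈ Finset.Icc 1 Q with q.Coprime l, (q.totient : ℝ) / q * (kap lam (q / Q) / Q) -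
        Cconst l * ∫ u in (0 : ℝ)..1, kap lam u) := by
      simp only [Y]
      rw [← Finset.mul_sum]; ring
    have h8 : 0 ≤ (1 - s) / l := div_nonneg (by linarith) hl0.le
    have h9 : (1 - s) / l ≤ 1 := by rw [div_le_one hl0]; linarith
    rw [h2, abs_mul, abs_of_nonneg h8]
    calc _ ≤ 1 * (E * (D * P) / Q) := by
          gcongr
          refine h1.trans ?_
          gcongr
      _ = _ := one_mul _
  have h1 := abs_sub_le (∑ q ∈ Finset.Icc 1 Q with q.Coprime l, X q)
    (∑ q ∈ Finset.Icc 1 Q with q.Coprime l, Y q)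
    ((1 - s) * (Cconst l / l * ∫ u in (0 : ℝ)..1, kap lam u))
  refine h1.trans ?_
  set R := √(Q : ℝ) with hR
  have hR1 : 1 ≤ R := by rw [hR]; exact Real.one_le_sqrt.mpr hQ1
  have hRQ : (Q : ℝ) = R ^ 2 := (Real.sq_sqrt hQ0.le).symm
  have hR0 : 0 < R := by linarith
  have hP4 : P ^ 2 ≤ P ^ 4 := pow_le_pow_right₀ hP1 (by norm_num)
  have hP41 : P ^ 1 ≤ P ^ 4 := pow_le_pow_right₀ hP1 (by norm_num)
  have hP40 : 1 ≤ P ^ 4 := one_le_pow₀ hP1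
  have hQR : 1 / (Q : ℝ) ≤ 1 / R := by
    apply one_div_le_one_div_of_le hR0; rw [hRQ]; nlinarith
  rw [hPδ]
  have k1 : 2 * D ^ 2 * A * P ^ 3 / Q * (C₁ * (R * P)) = 2 * D ^ 2 * A * C₁ * (P ^ 4 / R) := by
    rw [hRQ]; field_simp
  have k2 : 2 * A * P / Q * (D * P) ≤ 2 * A * D * (P ^ 4 / R) := by
    calc _ = 2 * A * D * (P ^ 2 * (1 / Q)) := by ring
      _ ≤ 2 * A * D * (P ^ 4 * (1 / R)) := by gcongr
      _ = _ := by ring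
  have k3 : 2 / (Q : ℝ) ≤ 2 * (P ^ 4 / R) := by
    calc _ = 2 * (1 * (1 / (Q : ℝ))) := by ring
      _ ≤ 2 * (P ^ 4 * (1 / R)) := mul_le_mul_of_nonneg_left
          (mul_le_mul hP40 hQR (one_div_nonneg.mpr hQ0.le) (by linarith)) (by norm_num)
      _ = _ := by ring
  have k4 : E * (D * P) / Q ≤ E * D * (P ^ 4 / R) := by
    calc _ = E * D * (P ^ 1 * (1 / Q)) := by ring
      _ ≤ E * D * (P ^ 4 * (1 / R)) := mul_le_mul_of_nonneg_left
          (mul_le_mul hP41 hQR (one_div_nonneg.mpr hQ0.le) (by linarith))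
          (mul_nonneg hE0 hD0)
      _ = _ := by ring
  have := add_le_add hsum hY
  rw [k1] at this
  linarith

lemma lastDenom_spec {T l q b : ℕ} (e : ℤ) (hq : 0 < q) (hqT : q ≤ T) (h : (l * b).Coprime q) :
    lastDenom T e l q b ≤ T ∧ T < lastDenom T e l q b + q ∧
      (q : ℤ) ∣ (lastDenom T e l q b : ℤ) * (l * b) - e := by
  have : NeZero q := ⟨hq.ne'⟩
  have hv := ZMod.val_lt ((T : ZMod q) - (e : ZMod q) * ((l * b : ℕ) : ZMod q)⁻¹)
  have hcast : ((lastDenom T e l q b : ℕ) : ZMod q) = (e : ZMod q) * ((l * b : ℕ) : ZMod q)⁻¹ := by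
    rw [lastDenom, Nat.cast_sub (by omega), ZMod.natCast_zmod_val]
    ring
  refine ⟨Nat.sub_le _ _, by rw [lastDenom]; omega, ?_⟩
  rw [← ZMod.intCast_zmod_eq_zero_iff_dvd]
  have h1 := ZMod.coe_mul_inv_eq_one (n := q) (l * b) h
  push_cast at hcast h1 ⊢
  rw [hcast]
  linear_combination (e : ZMod q) * h1

lemma exists_partner {q a z e : ℤ} (he : e = 1 ∨ e = -1) (h : q ∣ z * (q - a) - e) :
    ∃ z' : ℤ, e * (z' * q - a * z) = 1 := by
  obtain ⟨t, ht⟩ := h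
  refine ⟨z - t, ?_⟩
  have : (z - t) * q - a * z = e := by linear_combination ht
  rw [this]
  rcases he with rfl | rfl <;> rfl

lemma not_dvd_sub_of_det {l q a z z' e : ℤ} (hl : 2 ≤ l) (hdet : e * (z' * q - a * z) = 1)
    (hla : l ∣ q - a) : ¬ l ∣ z - z' := by
  rintro ⟨t, ht⟩
  obtain ⟨r, hr⟩ := hla
  have : l ∣ 1 := ⟨e * (z * r - t * q), by
    rw [← hdet]; linear_combination e * z * hr - e * q * ht⟩
  have := Int.le_of_dvd one_pos this
  omega

/-- If `u` lies on the correct side of the unimodular pair `(q, a)`, `(z, z')`, then no admissible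
lattice point with abscissa at most `T` comes within `ε` of the line of slope `u`. -/
lemma lt_abs_of_unimodular {l q a z z' e T : ℤ} {ε u : ℝ} (he : e = 1 ∨ e = -1)
    (hdet : e * (z' * q - a * z) = 1) (hla : l ∣ q - a) (hq : 0 < q) (hz : 0 < z)
    (hT : T < z + q) (hε : 0 < ε) (hx : 0 < (e : ℝ) * (q * u - a))
    (hy : ε < (e : ℝ) * (z' - z * u)) {m n : ℤ} (hm : 0 < m) (hmT : m ≤ T)
    (hmn : ¬ l ∣ m - n) : ε < |m * u - n| := by
  have hee : e * e = 1 := by rcases he with rfl | rfl <;> rfl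
  obtain ⟨k, hk⟩ : ∃ k, k = e * (n * q - a * m) := ⟨_, rfl⟩
  obtain ⟨j, hj⟩ : ∃ j, j = e * (z' * m - n * z) := ⟨_, rfl⟩
  have hmk : m = k * z + j * q := by
    rw [hk, hj]; linear_combination -m * hdet
  have hnk : n = k * z' + j * a := by
    rw [hk, hj]; linear_combination -n * hdet
  have hk0 : k ≠ 0 := by
    rintro h0
    rw [h0] at hmk hnk
    exact hmn (by rw [hmk, hnk]; simpa [← mul_sub] using Dvd.dvd.mul_left hla j)
  have hf : (e : ℝ) * (n - m * u) = k * (e * (z' - z * u)) - j * (e * (q * u - a)) := by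
    rw [hmk, hnk]; push_cast; ring
  have habs : |(m : ℝ) * u - n| = |(e : ℝ) * (n - m * u)| := by
    rw [abs_mul, abs_sub_comm]
    rcases he with rfl | rfl <;> simp
  rw [habs, hf]
  rcases lt_or_gt_of_ne hk0 with hk1 | hk1
  · have hj0 : 0 < j := by
      by_contra hcon
      have := mul_nonneg_of_nonpos_of_nonpos (b := q) (a := j) (by omega)
      nlinarith
    have h1 : (k : ℝ) ≤ -1 := by exact_mod_cast (by omega : k ≤ -1)
    have h2 : (0 : ℝ) < j := by exact_mod_cast hj0
    refine lt_of_lt_of_le ?_ (neg_le_abs _)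
    nlinarith [mul_pos h2 hx]
  · have hj0 : j ≤ 0 := by
      by_contra hcon
      have h1 : q ≤ j * q := by nlinarith
      have h2 : z ≤ k * z := by nlinarith
      omega
    have h1 : (1 : ℝ) ≤ k := by exact_mod_cast hk1
    have h2 : (j : ℝ) ≤ 0 := by exact_mod_cast hj0
    refine lt_of_lt_of_le ?_ (le_abs_self _)
    nlinarith [mul_nonneg (neg_nonneg.2 h2) hx.le]

/-- Conversely, if no admissible lattice point with abscissa at most `T` comes within `ε` of the
line of slope `u`, then neither does the last point `(q', a') + J (q, a)`, which stays on its
side of the line. -/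
lemma lt_of_free {l q a q' a' e T : ℤ} {ε u : ℝ} (hl : 2 ≤ l) (he : e = 1 ∨ e = -1)
    (hdet : e * (a' * q - a * q') = 1) (hla : l ∣ q - a) (hq : 0 < q) (hq' : 0 < q')
    (hsum : 1 < ε * (q + q'))
    (hx : 0 < (e : ℝ) * (q * u - a)) (hy : 0 < (e : ℝ) * (a' - q' * u))
    (hfree : ∀ m n : ℤ, 0 < m → m ≤ T → ¬ l ∣ m - n → ε < |m * u - n|)
    (J : ℕ) (hJ : q' + J * q ≤ T) :
    ε < (e : ℝ) * ((a' + J * a) - (q' + J * q) * u) := by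
  have hgood : ∀ j : ℕ, q' + j * q ≤ T →
      ε < |(e : ℝ) * ((a' + j * a) - (q' + j * q) * u)| := by
    intro j hj
    have hd : e * ((a' + j * a) * q - a * (q' + j * q)) = 1 := by
      linear_combination hdet
    have := hfree (q' + j * q) (a' + j * a) (by positivity) hj (not_dvd_sub_of_det hl hd hla)
    rw [abs_sub_comm] at this
    push_cast at this
    rw [abs_mul]
    rcases he with rfl | rfl <;> simpa using this
  have hJ0 : ∀ j : ℕ, j ≤ J → q' + j * q ≤ T := by
    intro j hj
    have : (j : ℤ) * q ≤ J * q := by gcongr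
    omega
  have hq1 : (0 : ℝ) < q := by exact_mod_cast hq
  have hq2 : (0 : ℝ) < q' := by exact_mod_cast hq'
  have hid : (q : ℝ) * (e * (a' - q' * u)) + q' * (e * (q * u - a)) = 1 := by
    have : ((e * (a' * q - a * q') : ℤ) : ℝ) = 1 := by rw [hdet]; norm_num
    push_cast at this
    linear_combination this
  have h0 : ε < (e : ℝ) * (a' - q' * u) := by
    have := hgood 0 (hJ0 0 (Nat.zero_le _))
    simp only [Nat.cast_zero, zero_mul, add_zero] at this
    rwa [abs_of_pos hy] at this
  have hxε : (e : ℝ) * (q * u - a) ≤ ε := by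
    by_contra hcon
    push Not at hcon
    nlinarith [mul_lt_mul_of_pos_left h0 hq1, mul_lt_mul_of_pos_left hcon hq2]
  have key : ∀ j : ℕ, j ≤ J → ε < (e : ℝ) * ((a' + j * a) - (q' + j * q) * u) := by
    intro j
    induction j with
    | zero => intro _; simpa using h0
    | succ j ih =>
      intro hj
      have h1 := ih (by omega)
      have h2 := hgood (j + 1) (hJ0 _ hj)
      have h3 : (e : ℝ) * ((a' + (j + 1 : ℕ) * a) - (q' + (j + 1 : ℕ) * q) * u) =
          e * ((a' + j * a) - (q' + j * q) * u) - e * (q * u - a) := by push_cast; ring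
      rwa [abs_of_pos] at h2
      rw [h3]; linarith
  exact key J le_rfl

lemma lt_qfree_iff {l : ℕ} {ε ω : ℝ} {X : ℝ} {T : ℕ} (h1 : (T : ℝ) ≤ X) (h2 : X < T + 1) :
    ENNReal.ofReal X < qfree l ε ω ↔
      ∀ m n : ℤ, 0 < m → m ≤ T → ¬ (l : ℤ) ∣ m - n → ε < |m * Real.tan ω - n| := by
  have hmem : ∀ q : ℝ, (q, q * Real.tan ω) ∈ Zl l + Vseg ε ↔
      ∃ m n : ℤ, q = m ∧ ¬ (l : ℤ) ∣ m - n ∧ |m * Real.tan ω - n| ≤ ε := by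
    intro q
    simp only [Zl, Vseg, Set.mem_add, Set.mem_ofPred_eq, Set.mem_prod, Set.mem_singleton_iff,
      Set.mem_Icc]
    constructor
    · rintro ⟨_, ⟨m, n, rfl, hmn⟩, ⟨v1, v2⟩, ⟨h3, h4, h5⟩, h6⟩
      simp only [Prod.mk_add_mk, Prod.mk.injEq] at h6 h3 h4 h5
      refine ⟨m, n, by linarith, hmn, ?_⟩
      have : q = m := by linarith
      subst this
      rw [abs_le]; constructor <;> linarith
    · rintro ⟨m, n, rfl, hmn, h⟩
      rw [abs_le] at h
      exact ⟨(m, n), ⟨m, n, rfl, hmn⟩, (0, m * Real.tan ω - n), ⟨rfl, h.1, h.2⟩, by simp⟩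
  constructor
  · intro h m n hm hmT hmn
    by_contra! hcon
    have h3 : (0 : ℝ) < m := by exact_mod_cast hm
    have h4 : qfree l ε ω ≤ ENNReal.ofReal (m : ℝ) :=
      iInf_le (fun q : {q : ℝ // 0 < q ∧ (q, q * Real.tan ω) ∈ Zl l + Vseg ε} =>
        ENNReal.ofReal q.1) ⟨m, h3, (hmem m).2 ⟨m, n, rfl, hmn, hcon⟩⟩
    have h5 : (m : ℝ) ≤ X := le_trans (by exact_mod_cast hmT) h1
    exact absurd (h.trans_le h4) (not_lt.mpr (ENNReal.ofReal_le_ofReal h5))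
  · intro h
    have : ENNReal.ofReal ((T : ℝ) + 1) ≤ qfree l ε ω := by
      refine le_iInf ?_
      rintro ⟨q, hq0, hq⟩
      obtain ⟨m, n, rfl, hmn, hle⟩ := (hmem q).1 hq
      apply ENNReal.ofReal_le_ofReal
      have hm0 : 0 < m := by exact_mod_cast hq0
      by_contra! hcon
      have hcon' : (m : ℝ) < T + 1 := hcon
      have : m < T + 1 := by exact_mod_cast hcon'
      exact absurd (h m n hm0 (by omega) hmn) (not_lt.mpr hle)
    refine lt_of_lt_of_le ?_ this
    exact (ENNReal.ofReal_lt_ofReal_iff (by positivity)).2 h2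

/-- The indices `(q, b)` of the reduced fractions `(q - l b) / q > s` of denominator at most `Q`. -/
noncomputable def fareyIdx (l Q : ℕ) (s : ℝ) : Finset (Σ _ : ℕ, ℕ) :=
  ((Finset.Icc 1 Q).filter (fun q => q.Coprime l)).sigma
    (fun q => (Finset.range ⌈(1 - s) * q / l⌉₊).filter (fun b => b.Coprime q))

noncomputable def fareyPt (l : ℕ) (p : Σ _ : ℕ, ℕ) : ℝ := ((p.1 : ℝ) - l * p.2) / p.1

noncomputable def freeLen (T : ℕ) (e : ℤ) (l : ℕ) (ε : ℝ) (p : Σ _ : ℕ, ℕ) : ℝ :=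
  (1 - ε * p.1) / (p.1 * lastDenom T e l p.1 p.2)

/-- The interval of slopes on one side of `fareyPt l p` that are free of obstacles up to `T`. -/
def freeInt (T : ℕ) (e : ℤ) (l : ℕ) (ε : ℝ) (p : Σ _ : ℕ, ℕ) : Set ℝ :=
  {u | 0 < (e : ℝ) * (u - fareyPt l p) ∧ (e : ℝ) * (u - fareyPt l p) < freeLen T e l ε p}

def freeSet (Q T : ℕ) (e : ℤ) (l : ℕ) (ε s : ℝ) : Set ℝ :=
  ⋃ p ∈ fareyIdx l Q s, freeInt T e l ε p

lemma mem_fareyIdx {l Q : ℕ} (hl : 0 < l) {s : ℝ} {q b : ℕ} :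
    (⟨q, b⟩ : Σ _ : ℕ, ℕ) ∈ fareyIdx l Q s ↔
      0 < q ∧ q ≤ Q ∧ (l * b).Coprime q ∧ s < fareyPt l ⟨q, b⟩ := by
  simp only [fareyIdx, Finset.mem_sigma, Finset.mem_filter, Finset.mem_Icc, Finset.mem_range,
    Nat.lt_ceil, fareyPt, Nat.coprime_mul_iff_left]
  have hl0 : (0 : ℝ) < l := by exact_mod_cast hl
  have key : 0 < q → ((b : ℝ) < (1 - s) * q / l ↔ s < ((q : ℝ) - l * b) / q) := by
    intro hq
    have hq0 : (0 : ℝ) < q := by exact_mod_cast hq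
    rw [lt_div_iff₀ hl0, lt_div_iff₀ hq0]
    constructor <;> intro h <;> nlinarith
  constructor
  · rintro ⟨⟨⟨h1, h2⟩, h3⟩, h4, h5⟩
    exact ⟨h1, h2, ⟨h3.symm, h5⟩, (key h1).1 h4⟩
  · rintro ⟨h1, h2, ⟨h3, h4⟩, h5⟩
    exact ⟨⟨⟨h1, h2⟩, h3.symm⟩, (key h1).2 h5, h4⟩

lemma fareyPt_le_one (l : ℕ) (p : Σ _ : ℕ, ℕ) : fareyPt l p ≤ 1 :=
  div_le_one_of_le₀ (sub_le_self _ (by positivity)) (Nat.cast_nonneg _)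

lemma freeInt_eq {T : ℕ} {e : ℤ} (he : e = 1 ∨ e = -1) (l : ℕ) (ε : ℝ) (p : Σ _ : ℕ, ℕ) :
    freeInt T e l ε p = Set.Ioo (fareyPt l p) (fareyPt l p + freeLen T e l ε p) ∨
      freeInt T e l ε p = Set.Ioo (fareyPt l p - freeLen T e l ε p) (fareyPt l p) := by
  rcases he with rfl | rfl
  · left
    ext u
    simp only [freeInt, Set.mem_ofPred_eq, Set.mem_Ioo, Int.cast_one, one_mul]
    constructor <;> rintro ⟨h1, h2⟩ <;> constructor <;> linarith
  · right
    ext u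
    simp only [freeInt, Set.mem_ofPred_eq, Set.mem_Ioo, Int.cast_one, one_mul, Int.cast_neg,
      neg_mul]
    constructor <;> rintro ⟨h1, h2⟩ <;> constructor <;> linarith

lemma measurableSet_freeInt {T : ℕ} {e : ℤ} (he : e = 1 ∨ e = -1) (l : ℕ) (ε : ℝ)
    (p : Σ _ : ℕ, ℕ) : MeasurableSet (freeInt T e l ε p) := by
  rcases freeInt_eq (T := T) he l ε p with h | h <;> rw [h] <;> exact measurableSet_Ioo

lemma volume_freeInt {T : ℕ} {e : ℤ} (he : e = 1 ∨ e = -1) (l : ℕ) (ε : ℝ) (p : Σ _ : ℕ, ℕ) :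
    volume (freeInt T e l ε p) = ENNReal.ofReal (freeLen T e l ε p) := by
  rcases freeInt_eq (T := T) he l ε p with h | h <;> rw [h, Real.volume_Ioo] <;> congr 1 <;> ring

lemma measurableSet_freeSet (Q T : ℕ) {e : ℤ} (he : e = 1 ∨ e = -1) (l : ℕ) (ε s : ℝ) :
    MeasurableSet (freeSet Q T e l ε s) :=
  Finset.measurableSet_biUnion _ fun _ _ => measurableSet_freeInt he _ _ _

lemma freeLen_nonneg {T : ℕ} (e : ℤ) (l : ℕ) {ε : ℝ} {Q : ℕ} {p : Σ _ : ℕ, ℕ} (hε : 0 ≤ ε)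
    (hεQ : ε * Q ≤ 1) (hpQ : p.1 ≤ Q) : 0 ≤ freeLen T e l ε p := by
  have : (p.1 : ℝ) ≤ Q := by exact_mod_cast hpQ
  exact div_nonneg (by nlinarith) (by positivity)

/-- A free interval is shorter than the gap from its Farey fraction to any other one. -/
lemma freeLen_lt {l Q T q b : ℕ} (e : ℤ) {ε : ℝ} (hε : 0 < ε) (hQT : 2 * Q ≤ T)
    (hq : 0 < q) (hqQ : q ≤ Q) (hc : (l * b).Coprime q) {k : ℕ} (hk : 0 < k) (hkQ : k ≤ Q) :
    freeLen T e l ε ⟨q, b⟩ < 1 / (q * k) := by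
  obtain ⟨h1, h2, -⟩ := lastDenom_spec (T := T) e hq (by omega) hc
  have hz : k < lastDenom T e l q b := by omega
  have hq0 : (0 : ℝ) < q := by exact_mod_cast hq
  have hk0 : (0 : ℝ) < k := by exact_mod_cast hk
  have hz0 : (k : ℝ) < lastDenom T e l q b := by exact_mod_cast hz
  rw [freeLen]
  apply div_lt_div₀
  · nlinarith
  · gcongr
  · norm_num
  · positivity

lemma inv_le_abs_sub {q a q' a' : ℤ} (hq : 0 < q) (hq' : 0 < q') (h : a * q' - a' * q ≠ 0) :
    1 / ((q : ℝ) * q') ≤ |(a : ℝ) / q - a' / q'| := by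
  have h1 : (0 : ℝ) < q := by exact_mod_cast hq
  have h2 : (0 : ℝ) < q' := by exact_mod_cast hq'
  have h3 : (1 : ℝ) ≤ |(a : ℝ) * q' - a' * q| := by
    have := Int.one_le_abs h
    exact_mod_cast this
  have h4 : (a : ℝ) / q - a' / q' = (a * q' - a' * q) / (q * q') := by field_simp
  rw [h4, abs_div, abs_of_pos (mul_pos h1 h2)]
  gcongr

lemma sub_mul_coprime {l q b : ℕ} (h : (l * b).Coprime q) :
    IsCoprime ((q : ℤ) - l * b) q := by
  have h1 : IsCoprime ((l * b : ℕ) : ℤ) (q : ℤ) := Nat.isCoprime_iff_coprime.2 h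
  push_cast at h1
  simpa [sub_eq_add_neg, add_comm] using (h1.neg_left.add_mul_right_left 1)

lemma det_ne_zero_of_ne {l q b q' b' : ℕ} (hl : 0 < l) (hq : 0 < q) (hq' : 0 < q')
    (hc : (l * b).Coprime q) (hc' : (l * b').Coprime q')
    (hne : (⟨q, b⟩ : Σ _ : ℕ, ℕ) ≠ ⟨q', b'⟩) :
    ((q : ℤ) - l * b) * q' - ((q' : ℤ) - l * b') * q ≠ 0 := by
  intro h
  have h1 : ((l * b : ℕ) : ℤ) * q' = (l * b' : ℕ) * q := by push_cast; linarith
  have h2 : l * b * q' = l * b' * q := by exact_mod_cast h1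
  have h3 : q ∣ q' := hc.symm.dvd_of_dvd_mul_left (h2 ▸ Dvd.intro_left _ rfl)
  have h4 : q' ∣ q := hc'.symm.dvd_of_dvd_mul_left (h2 ▸ Dvd.intro_left _ rfl)
  obtain rfl := Nat.dvd_antisymm h3 h4
  have h5 : l * b = l * b' := Nat.eq_of_mul_eq_mul_right hq h2
  have h6 : b = b' := Nat.eq_of_mul_eq_mul_left hl h5
  exact hne (by rw [h6])

lemma abs_sub_lt_of_mem {T : ℕ} {e : ℤ} (he : e = 1 ∨ e = -1) {l : ℕ} {ε : ℝ}
    {p p' : Σ _ : ℕ, ℕ} {u : ℝ} (h : u ∈ freeInt T e l ε p) (h' : u ∈ freeInt T e l ε p') :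
    |fareyPt l p - fareyPt l p'| < max (freeLen T e l ε p) (freeLen T e l ε p') := by
  obtain ⟨h1, h2⟩ := h
  obtain ⟨h3, h4⟩ := h'
  rw [lt_max_iff]
  rcases he with rfl | rfl <;> simp only [Int.cast_one, one_mul, Int.cast_neg, neg_mul] at * <;>
  rcases le_total (fareyPt l p) (fareyPt l p') with h5 | h5
  · left; rw [abs_lt]; constructor <;> linarith
  · right; rw [abs_lt]; constructor <;> linarith
  · right; rw [abs_lt]; constructor <;> linarith
  · left; rw [abs_lt]; constructor <;> linarith

lemma pairwiseDisjoint_freeInt {l Q T : ℕ} (hl : 0 < l) {e : ℤ} (he : e = 1 ∨ e = -1) {ε : ℝ}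
    (hε : 0 < ε) (hQT : 2 * Q ≤ T) (s : ℝ) :
    (fareyIdx l Q s : Set (Σ _ : ℕ, ℕ)).PairwiseDisjoint (freeInt T e l ε) := by
  rintro ⟨q, b⟩ hp ⟨q', b'⟩ hp' hne
  rw [Finset.mem_coe, mem_fareyIdx hl] at hp hp'
  obtain ⟨h1, h2, h3, -⟩ := hp
  obtain ⟨h1', h2', h3', -⟩ := hp'
  rw [Function.onFun, Set.disjoint_left]
  intro u hu hu'
  have h4 := abs_sub_lt_of_mem he hu hu'
  have h5 := det_ne_zero_of_ne hl h1 h1' h3 h3' hne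
  have h6 := inv_le_abs_sub (by exact_mod_cast h1) (by exact_mod_cast h1') h5
  have h7 := freeLen_lt (T := T) e hε hQT h1 h2 h3 h1' h2'
  have h8 := freeLen_lt (T := T) e hε hQT h1' h2' h3' h1 h2
  rw [mul_comm] at h8
  have h9 := h4.trans (max_lt h7 h8)
  rw [fareyPt, fareyPt] at h9
  push_cast at h6
  exact absurd h9 (not_lt.mpr h6)

lemma volume_freeSet {l Q T : ℕ} (hl : 0 < l) {e : ℤ} (he : e = 1 ∨ e = -1) {ε : ℝ}
    (hε : 0 < ε) (hεQ : ε * Q ≤ 1) (hQT : 2 * Q ≤ T) (s : ℝ) :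
    volume (freeSet Q T e l ε s) =
      ENNReal.ofReal (∑ q ∈ Finset.Icc 1 Q with q.Coprime l,
        ∑ b ∈ Finset.range ⌈(1 - s) * q / l⌉₊ with b.Coprime q,
          (1 - ε * q) / (q * lastDenom T e l q b)) := by
  rw [freeSet, measure_biUnion_finset (pairwiseDisjoint_freeInt hl he hε hQT s)
    (fun p _ => measurableSet_freeInt he _ _ _)]
  have : ∀ p ∈ fareyIdx l Q s, 0 ≤ freeLen T e l ε p := by
    rintro ⟨q, b⟩ hp
    rw [mem_fareyIdx hl] at hp
    exact freeLen_nonneg e l hε.le hεQ hp.2.1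
  simp_rw [volume_freeInt he]
  rw [← ENNReal.ofReal_sum_of_nonneg this, fareyIdx, Finset.sum_sigma]
  rfl

lemma abs_measureReal_sub_le {A B S : Set ℝ} (h1 : A \ B ⊆ S) (h2 : B \ A ⊆ S)
    (hA : volume A ≠ ∞) (hB : volume B ≠ ∞) (hS : volume S ≠ ∞) :
    |volume.real A - volume.real B| ≤ volume.real S := by
  have h3 : volume.real A ≤ volume.real B + volume.real S :=
    (measureReal_mono (Set.sdiff_subset_iff.1 h1) (measure_union_ne_top hB hS)).trans
      (measureReal_union_le _ _)
  have h4 : volume.real B ≤ volume.real A + volume.real S :=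
    (measureReal_mono (Set.sdiff_subset_iff.1 h2) (measure_union_ne_top hA hS)).trans
      (measureReal_union_le _ _)
  rw [abs_le]; constructor <;> linarith

lemma freeLen_le {l Q T q b : ℕ} (e : ℤ) {ε : ℝ} (hε : 0 < ε) (hQ : 0 < Q) (hQT : 2 * Q ≤ T)
    (hq : 0 < q) (hqQ : q ≤ Q) (hc : (l * b).Coprime q) :
    freeLen T e l ε ⟨q, b⟩ ≤ 1 / Q := by
  refine (freeLen_lt (T := T) e hε hQT hq hqQ hc hQ le_rfl).le.trans ?_
  have hQ0 : (0 : ℝ) < Q := by exact_mod_cast hQ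
  have hq1 : (1 : ℝ) ≤ q := by exact_mod_cast hq
  apply one_div_le_one_div_of_le hQ0
  nlinarith

lemma abs_volume_freeSet_inter_sub_le {l Q T : ℕ} (hl : 0 < l) {e : ℤ} (he : e = 1 ∨ e = -1)
    {ε s : ℝ} (hε : 0 < ε) (hεQ : ε * Q ≤ 1) (hQ : 0 < Q) (hQT : 2 * Q ≤ T) (hs : 0 ≤ s) :
    |volume.real (freeSet Q T e l ε 0 ∩ Set.Ioc s 1) - volume.real (freeSet Q T e l ε s)| ≤
      3 / Q := by
  have hQ0 : (0 : ℝ) < Q := by exact_mod_cast hQ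
  have hQi : (0 : ℝ) < 1 / Q := by positivity
  have hbd : ∀ q b : ℕ, ∀ u, 0 < q → q ≤ Q → (l * b).Coprime q →
      u ∈ freeInt T e l ε ⟨q, b⟩ → |u - fareyPt l ⟨q, b⟩| ≤ 1 / Q := by
    rintro q b u h1 h2 h3 ⟨h4, h5⟩
    have h6 := freeLen_le (T := T) e hε hQ hQT h1 h2 h3
    rw [abs_le]
    rcases he with rfl | rfl <;> simp only [Int.cast_one, one_mul, Int.cast_neg, neg_mul] at * <;>
      constructor <;> linarith
  have hvol : volume.real (Set.Icc (s - 1 / Q) (s + 1 / Q) ∪ Set.Icc (1 : ℝ) (1 + 1 / Q)) ≤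
      3 / Q := by
    refine (measureReal_union_le _ _).trans ?_
    rw [Real.volume_real_Icc_of_le (by linarith), Real.volume_real_Icc_of_le (by linarith)]
    apply le_of_eq; ring
  refine (abs_measureReal_sub_le ?_ ?_ ?_ ?_ ?_).trans hvol
  · rintro u ⟨⟨hu, hu1, hu2⟩, hu3⟩
    left
    simp only [freeSet, Set.mem_iUnion, exists_prop, not_exists, not_and] at hu hu3
    obtain ⟨⟨q, b⟩, hp, hu⟩ := hu
    have hns := fun h => hu3 ⟨q, b⟩ h hu
    rw [mem_fareyIdx hl] at hp hns
    obtain ⟨h1, h2, h3, h4⟩ := hp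
    have h5 : fareyPt l ⟨q, b⟩ ≤ s := by
      by_contra! hcon
      exact hns ⟨h1, h2, h3, hcon⟩
    have h6 := abs_le.1 (hbd q b u h1 h2 h3 hu)
    constructor <;> linarith
  · rintro u ⟨hu, hu3⟩
    simp only [freeSet, Set.mem_iUnion, exists_prop, Set.mem_inter_iff, not_and] at hu hu3
    obtain ⟨⟨q, b⟩, hp, hu⟩ := hu
    rw [mem_fareyIdx hl] at hp
    obtain ⟨h1, h2, h3, h4⟩ := hp
    have h6 := abs_le.1 (hbd q b u h1 h2 h3 hu)
    have h7 := hu3 ⟨⟨q, b⟩, (mem_fareyIdx hl).2 ⟨h1, h2, h3, hs.trans_lt h4⟩, hu⟩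
    have h8 := fareyPt_le_one l ⟨q, b⟩
    rcases le_or_gt u s with h9 | h9
    · left; constructor <;> linarith
    · right
      have : 1 < u := by
        by_contra! hcon
        exact h7 ⟨h9, hcon⟩
      constructor <;> linarith
  · exact measure_ne_top_of_subset Set.inter_subset_right (by simp)
  · rw [volume_freeSet hl he hε hεQ hQT]; simp
  · exact measure_union_ne_top (by simp) (by simp)

lemma abs_volume_inter_ordConnected_sub_le {B I : Set ℝ} {M E : ℝ} (hI : I ⊆ Set.Icc 0 1)
    (hIc : I.OrdConnected) (hB : MeasurableSet B)
    (h : ∀ s, 0 ≤ s → s ≤ 1 → |volume.real (B ∩ Set.Ioc s 1) - M * (1 - s)| ≤ E) :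
    |volume.real (B ∩ I) - M * volume.real I| ≤ 2 * E := by
  have hE : 0 ≤ E := (abs_nonneg _).trans (h 0 le_rfl zero_le_one)
  rcases I.eq_empty_or_nonempty with rfl | hne
  · simpa using hE
  have hb : BddBelow I := ⟨0, fun x hx => (hI hx).1⟩
  have ha : BddAbove I := ⟨1, fun x hx => (hI hx).2⟩
  obtain ⟨s, hs⟩ : ∃ s, s = sInf I := ⟨_, rfl⟩
  obtain ⟨t, ht⟩ : ∃ t, t = sSup I := ⟨_, rfl⟩
  have hs0 : 0 ≤ s := hs ▸ le_csInf hne fun x hx => (hI hx).1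
  have ht1 : t ≤ 1 := ht ▸ csSup_le hne fun x hx => (hI hx).2
  have hst : s ≤ t := hs ▸ ht ▸ csInf_le_csSup hne hb ha
  have hconn : IsConnected I := ⟨hne, hIc.isPreconnected⟩
  have hae : I =ᵐ[volume] Set.Ioc s t := by
    refine Filter.EventuallyLE.antisymm ?_ ?_
    · refine Filter.EventuallyLE.trans_eq (Filter.Eventually.of_forall ?_)
        (Ioc_ae_eq_Icc (a := s) (b := t)).symm
      rw [hs, ht]
      exact fun x hx => subset_Icc_csInf_csSup hb ha hx
    · refine Filter.EventuallyEq.trans_le (Ioo_ae_eq_Ioc (a := s) (b := t)).symm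
        (Filter.Eventually.of_forall ?_)
      rw [hs, ht]
      exact fun x hx => hconn.Ioo_csInf_csSup_subset hb ha hx
  have h1 : volume.real I = t - s := by
    rw [measureReal_congr hae, Real.volume_real_Ioc_of_le hst]
  have h2 : volume.real (B ∩ I) = volume.real (B ∩ Set.Ioc s t) :=
    measureReal_congr ((ae_eq_refl B).inter hae)
  have h3 : B ∩ Set.Ioc s 1 = (B ∩ Set.Ioc s t) ∪ (B ∩ Set.Ioc t 1) := by
    rw [← Set.inter_union_distrib_left, Set.Ioc_union_Ioc_eq_Ioc hst ht1]
  have h4 : volume.real (B ∩ Set.Ioc s 1) =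
      volume.real (B ∩ Set.Ioc s t) + volume.real (B ∩ Set.Ioc t 1) := by
    rw [h3]
    refine measureReal_union ?_ (hB.inter measurableSet_Ioc)
      (measure_ne_top_of_subset Set.inter_subset_right (by simp))
      (measure_ne_top_of_subset Set.inter_subset_right (by simp))
    exact Disjoint.mono Set.inter_subset_right Set.inter_subset_right
      (Set.Ioc_disjoint_Ioc_of_le le_rfl)
  have h5 := abs_le.1 (h s hs0 (hst.trans ht1))
  have h6 := abs_le.1 (h t (hs0.trans hst) ht1)
  rw [h1, h2, abs_le]
  constructor <;> nlinarith

lemma integrableOn_inv_one_add_sq (A : Set ℝ) :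
    IntegrableOn (fun u : ℝ => 1 / (1 + u ^ 2)) A := by
  simp_rw [one_div]
  exact integrable_inv_one_add_sq.integrableOn

lemma setIntegral_inv_one_add_sq_eq {A : Set ℝ} (hA : MeasurableSet A) :
    ∫ u in A, 1 / (1 + u ^ 2) =
      ∫ t in Set.Ioc (0 : ℝ) 1, volume.real ({u : ℝ | t ≤ 1 / (1 + u ^ 2)} ∩ A) := by
  rw [Integrable.integral_eq_integral_Ioc_meas_le (M := 1) (integrableOn_inv_one_add_sq _)]
  · refine setIntegral_congr_fun measurableSet_Ioc fun t _ => ?_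
    simp only [measureReal_def]
    rw [Measure.restrict_apply' hA]
  · exact Filter.Eventually.of_forall fun u => by simp only [Pi.zero_apply]; positivity
  · refine Filter.Eventually.of_forall fun u => ?_
    simp only
    rw [div_le_one (by positivity)]
    nlinarith [sq_nonneg u]

lemma abs_setIntegral_inter_sub_le {B I : Set ℝ} {M E : ℝ} (hI : I ⊆ Set.Icc 0 1)
    (hIc : I.OrdConnected) (hB : MeasurableSet B)
    (h : ∀ s, 0 ≤ s → s ≤ 1 → |volume.real (B ∩ Set.Ioc s 1) - M * (1 - s)| ≤ E) :
    |(∫ u in B ∩ I, 1 / (1 + u ^ 2)) - (∫ u in I, 1 / (1 + u ^ 2)) * M| ≤ 2 * E := by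
  have hanti : ∀ A : Set ℝ, A ⊆ Set.Icc 0 1 → IntegrableOn
      (fun t : ℝ => volume.real ({u : ℝ | t ≤ 1 / (1 + u ^ 2)} ∩ A)) (Set.Ioc 0 1) := by
    intro A hA
    have : Antitone (fun t : ℝ => volume.real ({u : ℝ | t ≤ 1 / (1 + u ^ 2)} ∩ A)) := by
      intro t t' htt
      refine measureReal_mono ?_ (measure_ne_top_of_subset
        (Set.inter_subset_right.trans hA) (by simp))
      exact Set.inter_subset_inter_left _ fun u hu => htt.trans hu
    exact ((this.antitoneOn (Set.Icc 0 1)).integrableOn_isCompact isCompact_Icc).mono_set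
      Set.Ioc_subset_Icc_self
  rw [setIntegral_inv_one_add_sq_eq (hB.inter hIc.measurableSet),
    setIntegral_inv_one_add_sq_eq hIc.measurableSet,
    ← integral_mul_const, ← integral_sub (hanti _ (Set.inter_subset_right.trans hI))
    ((hanti _ hI).mul_const _)]
  have key : ∀ t ∈ Set.Ioc (0 : ℝ) 1, ‖volume.real ({u : ℝ | t ≤ 1 / (1 + u ^ 2)} ∩ (B ∩ I)) -
      volume.real ({u : ℝ | t ≤ 1 / (1 + u ^ 2)} ∩ I) * M‖ ≤ 2 * E := by
    intro t _
    rw [Real.norm_eq_abs, Set.inter_left_comm, mul_comm]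
    refine abs_volume_inter_ordConnected_sub_le (Set.inter_subset_right.trans hI) ?_ hB h
    rw [Set.ordConnected_iff]
    rintro x ⟨hx, hxI⟩ y ⟨hy, hyI⟩ hxy z ⟨hz1, hz2⟩
    refine ⟨?_, hIc.out hxI hyI ⟨hz1, hz2⟩⟩
    have h1 := (hI hxI).1
    have hy' : t ≤ 1 / (1 + y ^ 2) := hy
    refine le_trans hy' ?_
    gcongr
    linarith
  refine (norm_setIntegral_le_of_norm_le_const (by simp) key).trans ?_
  simp

lemma volume_arctan_image {A : Set ℝ} (hA : MeasurableSet A) :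
    volume.real (Real.arctan '' A) = ∫ u in A, 1 / (1 + u ^ 2) := by
  have := integral_image_eq_integral_abs_deriv_smul hA
    (fun x _ => (Real.hasDerivAt_arctan x).hasDerivWithinAt) Real.arctan_injective.injOn
    (fun _ => (1 : ℝ))
  rw [setIntegral_const, smul_eq_mul, mul_one] at this
  rw [this]
  refine setIntegral_congr_fun hA fun x _ => ?_
  simp only [smul_eq_mul, mul_one]
  exact abs_of_pos (by positivity)

/-- A set of slopes squeezed between `A \ S` and `A` has angular measure within `|S|` of that
of `A`. -/
lemma abs_volume_arctan_image_sub_le {A S X : Set ℝ} (hA : MeasurableSet A)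
    (hS : MeasurableSet S) (hS1 : volume S ≠ ∞) (h1 : A \ S ⊆ X)
    (h2 : X ⊆ A) :
    |volume.real (Real.arctan '' X) - ∫ u in A, 1 / (1 + u ^ 2)| ≤ volume.real S := by
  have hfin2 : ∀ Y : Set ℝ, volume (Real.arctan '' Y) ≠ ∞ := by
    intro Y
    have hY : Real.arctan '' Y ⊆ Set.Icc (-(Real.pi / 2)) (Real.pi / 2) := by
      rintro _ ⟨y, -, rfl⟩
      exact ⟨(Real.neg_pi_div_two_lt_arctan y).le, (Real.arctan_lt_pi_div_two y).le⟩
    exact measure_ne_top_of_subset hY (by simp)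
  have h3 := measureReal_mono (Set.image_mono (f := Real.arctan) h2) (hfin2 A)
  have h4 := measureReal_mono (Set.image_mono (f := Real.arctan) h1) (hfin2 X)
  rw [volume_arctan_image hA] at h3
  rw [volume_arctan_image (hA.diff hS)] at h4
  have h5 := integral_inter_add_sdiff hS (integrableOn_inv_one_add_sq A)
  have h6 : ∫ u in A ∩ S, 1 / (1 + u ^ 2) ≤ volume.real S := by
    have hk : ∀ u ∈ A ∩ S, ‖(1 : ℝ) / (1 + u ^ 2)‖ ≤ 1 := by
      intro u _
      rw [Real.norm_eq_abs, abs_of_pos (by positivity), div_le_one (by positivity)]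
      nlinarith [sq_nonneg u]
    refine (le_abs_self _).trans ((norm_setIntegral_le_of_norm_le_const
      (measure_ne_top_of_subset Set.inter_subset_right hS1).lt_top hk).trans ?_)
    rw [one_mul]
    exact measureReal_mono Set.inter_subset_right hS1
  rw [abs_le]
  constructor
  · linarith
  · have := measureReal_nonneg (μ := (volume : Measure ℝ)) (s := S)
    linarith

lemma finite_FareyQ (Q : ℕ) : (FareyQ Q).Finite := by
  refine Set.Finite.subset (Finset.finite_toSet (((Finset.Icc 0 Q) ×ˢ (Finset.Icc 0 Q)).image
    (fun p : ℕ × ℕ => (p.1 : ℚ) / p.2))) ?_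
  rintro x ⟨h0, h1, h2⟩
  rw [Finset.coe_image, Set.mem_image]
  have h3 : 0 < x.num := Rat.num_pos.2 h0
  have h4 : x.num ≤ x.den := by
    have := Rat.num_div_den x
    rw [← this, div_le_one (by exact_mod_cast x.pos)] at h1
    exact_mod_cast h1
  refine ⟨(x.num.toNat, x.den), ?_, ?_⟩
  · simp only [Finset.coe_product, Set.mem_prod, Finset.coe_Icc, Set.mem_Icc]
    omega
  · simp only
    have : ((x.num.toNat : ℕ) : ℚ) = x.num := by
      rw [← Int.cast_natCast, Int.toNat_of_nonneg h3.le]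
    rw [this, Rat.num_div_den]

lemma exists_consecFarey {Q : ℕ} (hQ : 0 < Q) {u : ℝ} (h0 : 1 / (Q : ℝ) < u) (h1 : u < 1)
    (hu : ∀ x ∈ FareyQ Q, (x : ℝ) ≠ u) :
    ∃ γ γ' : ℚ, ConsecFarey Q γ γ' ∧ (γ : ℝ) < u ∧ u < γ' := by
  have hQ0 : (0 : ℚ) < Q := by exact_mod_cast hQ
  have hmem0 : ((1 : ℚ) / Q) ∈ FareyQ Q := by
    refine ⟨by positivity, ?_, ?_⟩
    · rw [div_le_one hQ0]; exact_mod_cast hQ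
    · have := Rat.den_dvd 1 Q
      rw [Rat.divInt_eq_div] at this
      simp only [Int.cast_one, Int.cast_natCast] at this
      exact Nat.le_of_dvd hQ (by exact_mod_cast this)
  have hmem1 : (1 : ℚ) ∈ FareyQ Q := ⟨one_pos, le_rfl, hQ⟩
  obtain ⟨γ, hγ, hγm⟩ := Set.exists_max_image {x ∈ FareyQ Q | (x : ℝ) < u} id
    ((finite_FareyQ Q).subset (Set.sep_subset _ _)) ⟨_, hmem0, by push_cast; exact h0⟩
  obtain ⟨γ', hγ', hγm'⟩ := Set.exists_min_image {x ∈ FareyQ Q | u < (x : ℝ)} id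
    ((finite_FareyQ Q).subset (Set.sep_subset _ _)) ⟨_, hmem1, by push_cast; exact h1⟩
  refine ⟨γ, γ', ⟨hγ.1, hγ'.1, ?_, ?_⟩, hγ.2, hγ'.2⟩
  · exact_mod_cast hγ.2.trans hγ'.2
  · rintro z hz ⟨hz1, hz2⟩
    rcases lt_or_gt_of_ne (hu z hz) with h | h
    · exact absurd (hγm z ⟨hz, h⟩) (not_le.2 hz1)
    · exact absurd (hγm' z ⟨hz, h⟩) (not_le.2 hz2)

lemma consecFarey_det {Q : ℕ} {γ γ' : ℚ} (h : ConsecFarey Q γ γ') :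
    γ'.num * γ.den - γ.num * γ'.den = 1 ∧ Q < γ.den + γ'.den := by
  obtain ⟨⟨h0, h1, h2⟩, ⟨h0', h1', h2'⟩, hlt, hcons⟩ := h
  obtain ⟨q, hq⟩ : ∃ q : ℤ, q = γ.den := ⟨_, rfl⟩
  obtain ⟨a, ha⟩ : ∃ a : ℤ, a = γ.num := ⟨_, rfl⟩
  obtain ⟨d, hd⟩ : ∃ d : ℤ, d = γ'.den := ⟨_, rfl⟩
  obtain ⟨c, hc⟩ : ∃ c : ℤ, c = γ'.num := ⟨_, rfl⟩
  have hγ : γ = a / q := by rw [ha, hq]; exact_mod_cast (Rat.num_div_den γ).symm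
  have hγ' : γ' = c / d := by rw [hc, hd]; exact_mod_cast (Rat.num_div_den γ').symm
  have hq0 : 0 < q := by rw [hq]; exact_mod_cast γ.pos
  have hd0 : 0 < d := by rw [hd]; exact_mod_cast γ'.pos
  have ha0 : 0 < a := ha ▸ Rat.num_pos.2 h0
  have hqQ : q ≤ Q := by rw [hq]; exact_mod_cast h2
  have hdQ : d ≤ Q := by rw [hd]; exact_mod_cast h2'
  have hq0' : (0 : ℚ) < q := by exact_mod_cast hq0
  have hd0' : (0 : ℚ) < d := by exact_mod_cast hd0
  have haq : a < q := by
    have := hlt.trans_le h1'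
    rw [hγ, div_lt_one hq0'] at this
    exact_mod_cast this
  have hdet0 : a * d < c * q := by
    rw [hγ, hγ', div_lt_div_iff₀ hq0' hd0'] at hlt
    exact_mod_cast hlt
  have hcop : IsCoprime a q := by
    rw [ha, hq, Int.isCoprime_iff_gcd_eq_one]; exact γ.reduced
  have hcop' : IsCoprime c d := by
    rw [hc, hd, Int.isCoprime_iff_gcd_eq_one]; exact γ'.reduced
  obtain ⟨r, s, hrs⟩ := hcop
  obtain ⟨q', hq'⟩ : ∃ q', q' = -r + (Q + r) / q * q := ⟨_, rfl⟩
  obtain ⟨a', ha'⟩ : ∃ a', a' = s + (Q + r) / q * a := ⟨_, rfl⟩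
  have hdet : a' * q - a * q' = 1 := by rw [hq', ha']; linear_combination hrs
  have hdm := Int.emod_add_mul_ediv (Q + r) q
  have hm0 := Int.emod_nonneg (Q + r) hq0.ne'
  have hm1 := Int.emod_lt_of_pos (Q + r) hq0
  have hq'Q : q' ≤ Q := by rw [hq']; linarith
  have hsumQ : Q < q' + q := by rw [hq']; linarith
  have hq'0 : 0 < q' := by linarith
  have hq₁pos : (0 : ℚ) < q' := by exact_mod_cast hq'0
  have ha'0 : 0 < a' := by
    have : 0 < a' * q := by nlinarith
    exact pos_of_mul_pos_left this hq0.le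
  have ha'q : a' ≤ q' := by
    by_contra! hcon
    nlinarith
  have hz : ((a' : ℚ) / q') ∈ FareyQ Q := by
    refine ⟨by positivity, ?_, ?_⟩
    · rw [div_le_one hq₁pos]; exact_mod_cast ha'q
    · have := Int.le_of_dvd hq'0 (Rat.den_dvd a' q')
      rw [Rat.divInt_eq_div] at this
      omega
  have hγz : γ < (a' : ℚ) / q' := by
    rw [hγ, div_lt_div_iff₀ hq0' hq₁pos]
    have : a * q' < a' * q := by linarith
    exact_mod_cast this
  have hle : c * q' ≤ a' * d := by
    by_contra! hcon
    refine hcons _ hz ⟨hγz, ?_⟩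
    rw [hγ', div_lt_div_iff₀ hq₁pos hd0']
    exact_mod_cast hcon
  have heq : c * q' = a' * d := by
    refine le_antisymm hle ?_
    by_contra! hcon
    have e1 : d = q * (a' * d - c * q') + q' * (c * q - a * d) := by
      linear_combination -d * hdet
    have e2 : q ≤ q * (a' * d - c * q') := le_mul_of_one_le_right hq0.le (by linarith)
    have e3 : q' ≤ q' * (c * q - a * d) := le_mul_of_one_le_right hq'0.le (by linarith)
    linarith
  have e1 : (c * q - a * d) * q' = d := by
    linear_combination q * heq + d * hdet
  have e2 : d ∣ q' := hcop'.symm.dvd_of_dvd_mul_left (Dvd.intro_left a' heq.symm)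
  have e3 : q' = d := Int.dvd_antisymm hq'0.le hd0.le (Dvd.intro_left _ e1) e2
  rw [e3] at e1
  have e4 : c * q - a * d = 1 := by
    have : (c * q - a * d) * d = 1 * d := by linarith
    exact mul_right_cancel₀ hd0.ne' this
  rw [← hq, ← ha, ← hd, ← hc]
  refine ⟨e4, ?_⟩
  have : (Q : ℤ) < γ.den + γ'.den := by rw [← hq, ← hd]; linarith
  exact_mod_cast this

lemma mem_freeInt_iff {T l q b : ℕ} {e z' : ℤ} {ε u : ℝ} (hq : 0 < q)
    (hz : 0 < lastDenom T e l q b)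
    (hdet : e * (z' * q - ((q : ℤ) - l * b) * lastDenom T e l q b) = 1) :
    u ∈ freeInt T e l ε ⟨q, b⟩ ↔
      0 < (e : ℝ) * (q * u - ((q : ℤ) - l * b : ℤ)) ∧
        ε < (e : ℝ) * (z' - (lastDenom T e l q b : ℤ) * u) := by
  have hq0 : (0 : ℝ) < q := by exact_mod_cast hq
  have hz0 : (0 : ℝ) < lastDenom T e l q b := by exact_mod_cast hz
  rw [freeInt, Set.mem_ofPred_eq, freeLen, fareyPt]
  simp only
  obtain ⟨x, hx⟩ : ∃ x : ℝ, x = (e : ℝ) * (q * u - ((q : ℤ) - l * b : ℤ)) := ⟨_, rfl⟩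
  have h1 : (e : ℝ) * (u - ((q : ℝ) - l * b) / q) = x / q := by
    rw [hx]; push_cast; field_simp
  have hid : (q : ℝ) * (e * (z' - (lastDenom T e l q b : ℤ) * u)) + lastDenom T e l q b * x = 1 := by
    have : ((e * (z' * q - ((q : ℤ) - l * b) * lastDenom T e l q b) : ℤ) : ℝ) = 1 := by
      rw [hdet]; norm_num
    rw [hx]
    push_cast at this ⊢
    linear_combination this
  rw [h1, ← hx, div_lt_div_iff₀ hq0 (mul_pos hq0 hz0)]
  obtain ⟨y, hy⟩ : ∃ y : ℝ, y = (e : ℝ) * (z' - (lastDenom T e l q b : ℤ) * u) := ⟨_, rfl⟩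
  rw [← hy] at hid ⊢
  constructor
  · rintro ⟨h2, h3⟩
    have h4 : 0 < x := (div_pos_iff_of_pos_right hq0).1 h2
    refine ⟨h4, ?_⟩
    by_contra! hcon
    have h5 : q * y ≤ q * ε := mul_le_mul_of_nonneg_left hcon hq0.le
    have h6 : x * lastDenom T e l q b < 1 - ε * q := by
      have : q * (x * lastDenom T e l q b) < q * (1 - ε * q) := by linarith
      exact lt_of_mul_lt_mul_left this hq0.le
    linarith
  · rintro ⟨h2, h3⟩
    refine ⟨div_pos h2 hq0, ?_⟩
    have h5 : q * ε < q * y := mul_lt_mul_of_pos_left h3 hq0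
    have h6 : x * lastDenom T e l q b < 1 - ε * q := by linarith
    have := mul_lt_mul_of_pos_left h6 hq0
    linarith

lemma mem_freeSet_of_free {l Q T : ℕ} (hl : 2 ≤ l) {e : ℤ} (he : e = 1 ∨ e = -1) {ε u : ℝ}
    (hε : 0 < ε) (hεQ : 1 < ε * (Q + 1)) (hQT : 2 * Q ≤ T) {γ γ' : ℚ} (hγ : γ ∈ FareyCong l)
    (hγQ : γ.den ≤ Q) (hγQ' : γ'.den ≤ Q)
    (hdet : e * (γ'.num * γ.den - γ.num * γ'.den) = 1) (hsum : Q < γ.den + γ'.den)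
    (h1 : 0 < (e : ℝ) * (u - γ)) (h2 : 0 < (e : ℝ) * (γ' - u))
    (hfree : ∀ m n : ℤ, 0 < m → m ≤ T → ¬ (l : ℤ) ∣ m - n → ε < |m * u - n|) :
    u ∈ freeSet Q T e l ε 0 := by
  obtain ⟨hγ0, hγ1, hγl⟩ := hγ
  have hqr : (0 : ℝ) < γ.den := by exact_mod_cast γ.pos
  have hqr' : (0 : ℝ) < γ'.den := by exact_mod_cast γ'.pos
  have hγe : (γ : ℝ) = γ.num / γ.den := Rat.cast_def γ
  have hγe' : (γ' : ℝ) = γ'.num / γ'.den := Rat.cast_def γ'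
  have haq : γ.num ≤ γ.den := by
    have := Rat.num_div_den γ
    rw [← this, div_le_one (by exact_mod_cast γ.pos)] at hγ1
    exact_mod_cast hγ1
  obtain ⟨b, hb⟩ : ∃ b : ℕ, (γ.den : ℤ) - γ.num = l * b := by
    obtain ⟨t, ht⟩ := hγl
    have : 0 ≤ t := by
      by_contra! hcon
      nlinarith
    exact ⟨t.toNat, by rw [ht, Int.toNat_of_nonneg this]⟩
  have hnum : γ.num = (γ.den : ℤ) - l * b := by linarith
  obtain ⟨q, hq⟩ : ∃ q : ℕ, q = γ.den := ⟨_, rfl⟩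
  obtain ⟨q', hq'⟩ : ∃ q' : ℕ, q' = γ'.den := ⟨_, rfl⟩
  obtain ⟨a', ha'⟩ : ∃ a' : ℤ, a' = γ'.num := ⟨_, rfl⟩
  have hcop0 : IsCoprime γ.num (γ.den : ℤ) := by
    rw [Int.isCoprime_iff_gcd_eq_one]; exact γ.reduced
  have hq0 : 0 < q := hq ▸ γ.pos
  have hq0' : 0 < q' := hq' ▸ γ'.pos
  have hnum0 : 0 < γ.num := Rat.num_pos.2 hγ0
  rw [← hq] at hγQ hsum hcop0 hqr
  rw [← hq'] at hγQ' hsum hqr'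
  rw [← hq, ← hq', ← ha', hnum, ← hq] at hdet
  rw [hnum, ← hq] at hcop0 hγe hnum0
  rw [← ha', ← hq'] at hγe'
  have hcopZ : IsCoprime ((l * b : ℕ) : ℤ) (q : ℤ) := by
    have := (hcop0.neg_left.add_mul_right_left 1)
    push_cast
    simpa using this
  have hcop : (l * b).Coprime q := Nat.isCoprime_iff_coprime.1 hcopZ
  obtain ⟨s1, s2, s3⟩ := lastDenom_spec (T := T) e hq0 (by omega) hcop
  obtain ⟨z, hz⟩ : ∃ z, z = lastDenom T e l q b := ⟨_, rfl⟩
  have hee : e * e = 1 := by rcases he with rfl | rfl <;> rfl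
  have hdvd : (q : ℤ) ∣ (z : ℤ) - q' := by
    refine hcopZ.symm.dvd_of_dvd_mul_left ?_
    obtain ⟨t, ht⟩ := s3
    refine ⟨t + a' - q', ?_⟩
    rw [← hz] at ht
    push_cast
    linear_combination ht - e * hdet + (a' * q - (q - l * b) * q') * hee
  obtain ⟨J, hJ⟩ : ∃ J : ℕ, (z : ℤ) = q' + J * q := by
    obtain ⟨t, ht⟩ := hdvd
    have : 0 ≤ t := by
      by_contra! hcon
      have : (q : ℤ) * t ≤ 0 := mul_nonpos_of_nonneg_of_nonpos (by positivity) hcon.le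
      omega
    exact ⟨t.toNat, by rw [Int.toNat_of_nonneg this]; linarith⟩
  have hx : 0 < (e : ℝ) * (((q : ℤ) : ℝ) * u - (((q : ℤ) - l * b : ℤ) : ℝ)) := by
    have := mul_pos hqr h1
    rw [hγe] at this
    have h3 : (q : ℝ) * (e * (u - (((q : ℤ) - l * b : ℤ) : ℝ) / q)) =
      (e : ℝ) * (((q : ℤ) : ℝ) * u - (((q : ℤ) - l * b : ℤ) : ℝ)) := by push_cast; field_simp
    rwa [h3] at this
  have hy : 0 < (e : ℝ) * (a' - ((q' : ℤ) : ℝ) * u) := by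
    have := mul_pos hqr' h2
    rw [hγe'] at this
    have h3 : (q' : ℝ) * (e * ((a' : ℝ) / q' - u)) = (e : ℝ) * (a' - ((q' : ℤ) : ℝ) * u) := by
      push_cast; field_simp
    rwa [h3] at this
  have hsum' : 1 < ε * (((q : ℤ) : ℝ) + ((q' : ℤ) : ℝ)) := by
    refine hεQ.trans_le ?_
    have : ((Q + 1 : ℕ) : ℝ) ≤ ((q + q' : ℕ) : ℝ) := by exact_mod_cast hsum
    push_cast at this ⊢
    exact mul_le_mul_of_nonneg_left this hε.le
  have hfin := lt_of_free (by exact_mod_cast hl) he hdet ⟨b, by ring⟩ (by exact_mod_cast hq0)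
    (by exact_mod_cast hq0') hsum' hx hy hfree J (by rw [← hJ, hz]; exact_mod_cast s1)
  simp only [freeSet, Set.mem_iUnion, exists_prop]
  refine ⟨⟨q, b⟩, (mem_fareyIdx (by omega)).2 ⟨hq0, hγQ, hcop, ?_⟩, ?_⟩
  · rw [fareyPt]
    have : (0 : ℝ) < (((q : ℤ) - l * b : ℤ) : ℝ) := by exact_mod_cast hnum0
    push_cast at this
    exact div_pos this hqr
  · rw [mem_freeInt_iff (z' := a' + J * ((q : ℤ) - l * b)) hq0 (by omega)]
    · refine ⟨by simpa using hx, ?_⟩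
      rw [← hz, hJ]
      push_cast at hfin ⊢
      exact hfin
    · rw [← hz, hJ]
      linear_combination hdet

lemma free_of_mem_freeInt {l Q T q b : ℕ} {e : ℤ} (he : e = 1 ∨ e = -1) {ε u : ℝ}
    (hε : 0 < ε) (hQT : 2 * Q ≤ T) (hq : 0 < q) (hqQ : q ≤ Q) (hc : (l * b).Coprime q)
    (hu : u ∈ freeInt T e l ε ⟨q, b⟩) {m n : ℤ} (hm : 0 < m) (hmT : m ≤ T)
    (hmn : ¬ (l : ℤ) ∣ m - n) : ε < |m * u - n| := by
  obtain ⟨s1, s2, s3⟩ := lastDenom_spec (T := T) e hq (by omega) hc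
  obtain ⟨z', hz'⟩ := exists_partner (a := (q : ℤ) - l * b) he
    (z := lastDenom T e l q b) (by rwa [sub_sub_cancel])
  have hz : 0 < lastDenom T e l q b := by omega
  obtain ⟨h1, h2⟩ := (mem_freeInt_iff hq hz hz').1 hu
  exact lt_abs_of_unimodular he hz' ⟨b, by ring⟩ (by exact_mod_cast hq) (by exact_mod_cast hz)
    (T := T) (by exact_mod_cast s2) hε (by simpa using h1) h2 hm hmT hmn

/-- The exceptional slopes: Farey fractions and those within `1 / Q` of the ends of `I`. -/
noncomputable def edgeSet (Q : ℕ) (I : Set ℝ) : Set ℝ :=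
  (fun x : ℚ => (x : ℝ)) '' FareyQ Q ∪
    (Set.Icc (sInf I) (sInf I + 1 / Q) ∪ Set.Icc (sSup I - 1 / Q) (sSup I))

lemma measurableSet_edgeSet (Q : ℕ) (I : Set ℝ) : MeasurableSet (edgeSet Q I) :=
  ((finite_FareyQ Q).image _).measurableSet.union (measurableSet_Icc.union measurableSet_Icc)

lemma volume_edgeSet_ne_top (Q : ℕ) (I : Set ℝ) : volume (edgeSet Q I) ≠ ∞ :=
  measure_union_ne_top (by rw [((finite_FareyQ Q).image _).measure_zero]; simp)
    (measure_union_ne_top (by simp) (by simp))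

lemma volume_edgeSet_le {Q : ℕ} (I : Set ℝ) : volume.real (edgeSet Q I) ≤ 2 / Q := by
  have hQi : (0 : ℝ) ≤ 1 / Q := by positivity
  refine (measureReal_union_le _ _).trans ?_
  have h0 : volume.real ((fun x : ℚ => (x : ℝ)) '' FareyQ Q) = 0 := by
    rw [measureReal_def, ((finite_FareyQ Q).image _).measure_zero]; rfl
  rw [h0, zero_add]
  refine (measureReal_union_le _ _).trans ?_
  rw [Real.volume_real_Icc_of_le (by linarith), Real.volume_real_Icc_of_le (by linarith)]
  apply le_of_eq; ring

lemma exists_consecFarey_of_mem_freeSet {l Q T : ℕ} (hl : 2 ≤ l) {e : ℤ} (he : e = 1 ∨ e = -1)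
    {ε u : ℝ} (hε : 0 < ε) (hQ : 0 < Q) (hQT : 2 * Q ≤ T) {I : Set ℝ} (hI : I ⊆ Set.Icc 0 1)
    (hIc : I.OrdConnected) (huI : u ∈ I) (hu : u ∈ freeSet Q T e l ε 0)
    (huS : u ∉ edgeSet Q I) :
    (∀ m n : ℤ, 0 < m → m ≤ T → ¬ (l : ℤ) ∣ m - n → ε < |m * u - n|) ∧
      ∃ γ γ' : ℚ, ConsecFarey Q γ γ' ∧ (γ : ℝ) ∈ I ∧ (γ' : ℝ) ∈ I ∧
        ((e = 1 → γ ∈ FareyCong l) ∧ (e = -1 → γ' ∈ FareyCong l)) ∧ (γ : ℝ) < u ∧ u < γ' := by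
  simp only [freeSet, Set.mem_iUnion, exists_prop] at hu
  obtain ⟨⟨q, b⟩, hp, hu⟩ := hu
  rw [mem_fareyIdx (by omega)] at hp
  obtain ⟨h1, h2, h3, h4⟩ := hp
  refine ⟨fun m n hm hmT hmn => free_of_mem_freeInt he hε hQT h1 h2 h3 hu hm hmT hmn, ?_⟩
  have hQ0 : (0 : ℝ) < Q := by exact_mod_cast hQ
  simp only [edgeSet, Set.mem_union, not_or, Set.mem_Icc, not_and_or, not_le, Set.mem_image,
    not_exists] at huS
  obtain ⟨hS1, hS2, hS3⟩ := huS
  have hb : BddBelow I := ⟨0, fun x hx => (hI hx).1⟩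
  have ha : BddAbove I := ⟨1, fun x hx => (hI hx).2⟩
  have hne : I.Nonempty := ⟨u, huI⟩
  have hs0 : 0 ≤ sInf I := le_csInf hne fun x hx => (hI hx).1
  have ht1 : sSup I ≤ 1 := csSup_le hne fun x hx => (hI hx).2
  have hu1 := csInf_le hb huI
  have hu2 := le_csSup ha huI
  have hS2' : sInf I + 1 / Q < u := hS2.resolve_left (not_lt.2 hu1)
  have hS3' : u < sSup I - 1 / Q := hS3.resolve_right (not_lt.2 hu2)
  have hQi : (0 : ℝ) < 1 / Q := by positivity
  obtain ⟨γ, γ', hcons, hγu, huγ⟩ := exists_consecFarey hQ (u := u) (by linarith) (by linarith)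
    (fun x hx h => (hS1 x).elim (fun h' => h' hx) (fun h' => h' h))
  have hq0 : (0 : ℝ) < q := by exact_mod_cast h1
  have hgap : (γ' : ℝ) - γ ≤ 1 / Q := by
    obtain ⟨hd1, hd2⟩ := consecFarey_det hcons
    have e1 : (0 : ℝ) < γ.den := by exact_mod_cast γ.pos
    have e2 : (0 : ℝ) < γ'.den := by exact_mod_cast γ'.pos
    have e3 : (γ' : ℝ) - γ = 1 / (γ.den * γ'.den) := by
      have : ((γ'.num * γ.den - γ.num * γ'.den : ℤ) : ℝ) = 1 := by rw [hd1]; norm_num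
      push_cast at this
      rw [Rat.cast_def γ, Rat.cast_def γ', div_sub_div _ _ e2.ne' e1.ne', mul_comm (γ.den : ℝ)]
      congr 1
      linarith
    rw [e3]
    apply one_div_le_one_div_of_le hQ0
    have e4 : 1 ≤ γ.den := γ.pos
    have e5 : 1 ≤ γ'.den := γ'.pos
    have : Q ≤ γ.den * γ'.den := by nlinarith
    exact_mod_cast this
  have hsub := (IsConnected.Ioo_csInf_csSup_subset ⟨hne, hIc.isPreconnected⟩ hb ha)
  obtain ⟨a, hadef⟩ : ∃ a : ℤ, a = (q : ℤ) - l * b := ⟨_, rfl⟩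
  have hcop : IsCoprime a q := hadef ▸ sub_mul_coprime h3
  have hcopN : Nat.Coprime a.natAbs q := by
    rw [Int.isCoprime_iff_gcd_eq_one] at hcop
    exact hcop
  have ha0 : 0 < a := by
    rw [fareyPt] at h4
    have : (0 : ℝ) < (q : ℝ) - l * b := (div_pos_iff_of_pos_right hq0).1 h4
    rw [hadef]
    exact_mod_cast this
  obtain ⟨x, hx⟩ : ∃ x : ℚ, x = (a : ℚ) / (q : ℤ) := ⟨_, rfl⟩
  have hxnum : x.num = a := by
    rw [hx]; exact Rat.num_div_eq_of_coprime (by exact_mod_cast h1) (by simpa using hcopN)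
  have hxden : (x.den : ℤ) = q := by
    rw [hx]; exact Rat.den_div_eq_of_coprime (by exact_mod_cast h1) (by simpa using hcopN)
  have hxr : (x : ℝ) = fareyPt l ⟨q, b⟩ := by
    rw [hx, fareyPt, hadef]; push_cast; rfl
  have hx0 : 0 < x := Rat.num_pos.1 (hxnum ▸ ha0)
  have hx1 : x ≤ 1 := by
    have := fareyPt_le_one l ⟨q, b⟩
    rw [← hxr] at this
    exact_mod_cast this
  have hxQ : x ∈ FareyQ Q := ⟨hx0, hx1, by omega⟩
  have hxl : x ∈ FareyCong l := ⟨hx0, hx1, by rw [hxnum, hxden, hadef]; exact ⟨b, by ring⟩⟩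
  have hfar : ∀ y ∈ FareyQ Q, y ≠ x → freeLen T e l ε ⟨q, b⟩ < |(x : ℝ) - y| := by
    intro y hy hyx
    refine (freeLen_lt (T := T) e hε hQT h1 h2 h3 y.pos hy.2.2).trans_le ?_
    have hne0 : a * y.den - y.num * q ≠ 0 := by
      intro h0
      apply hyx
      rw [hx, ← Rat.num_div_den y, div_eq_div_iff (by exact_mod_cast y.pos.ne')
        (by exact_mod_cast h1.ne')]
      have : y.num * (q : ℤ) = a * (y.den : ℤ) := by linarith
      exact_mod_cast this
    have := inv_le_abs_sub (q := q) (q' := y.den) (by exact_mod_cast h1)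
      (by exact_mod_cast y.pos) hne0
    rw [Rat.cast_def y, hx]
    push_cast at this ⊢
    exact this
  obtain ⟨hu3, hu4⟩ := hu
  rw [← hxr] at hu3 hu4
  refine ⟨γ, γ', hcons, hsub ⟨by linarith, by linarith⟩, hsub ⟨by linarith, by linarith⟩,
    ⟨?_, ?_⟩, hγu, huγ⟩
  · rintro rfl
    simp only [Int.cast_one, one_mul] at hu3 hu4
    suffices h : γ = x by rw [h]; exact hxl
    by_contra hγx
    have h5 := hfar γ hcons.1 hγx
    rcases lt_or_gt_of_ne hγx with h6 | h6
    · refine hcons.2.2.2 x hxQ ⟨h6, ?_⟩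
      have : (x : ℝ) < γ' := by linarith
      exact_mod_cast this
    · have h7 : (x : ℝ) < γ := by exact_mod_cast h6
      rw [abs_of_neg (by linarith)] at h5
      linarith
  · rintro rfl
    simp only [Int.cast_one, Int.cast_neg, neg_mul, one_mul] at hu3 hu4
    suffices h : γ' = x by rw [h]; exact hxl
    by_contra hγx
    have h5 := hfar γ' hcons.2.1 hγx
    rcases lt_or_gt_of_ne hγx with h6 | h6
    · have h7 : (γ' : ℝ) < x := by exact_mod_cast h6
      rw [abs_of_pos (by linarith)] at h5
      linarith
    · refine hcons.2.2.2 x hxQ ⟨?_, h6⟩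
      have : (γ : ℝ) < x := by linarith
      exact_mod_cast this

section

variable {l Q T : ℕ} {ε lam : ℝ} {I : Set ℝ}

lemma image_arctan_setOf (h1 : (T : ℝ) ≤ lam * Q) (h2 : lam * Q < T + 1) (P : ℝ → Prop) :
    {ω ∈ Real.arctan '' I | ENNReal.ofReal (lam * (Q : ℝ)) < qfree l ε ω ∧ P (Real.tan ω)} =
      Real.arctan '' {u ∈ I | (∀ m n : ℤ, 0 < m → m ≤ T → ¬ (l : ℤ) ∣ m - n →
        ε < |m * u - n|) ∧ P u} := by
  ext ω
  simp only [Set.mem_ofPred_eq, Set.mem_image]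
  constructor
  · rintro ⟨⟨u, hu, rfl⟩, h3, h4⟩
    rw [lt_qfree_iff h1 h2, Real.tan_arctan] at h3
    rw [Real.tan_arctan] at h4
    exact ⟨u, ⟨hu, h3, h4⟩, rfl⟩
  · rintro ⟨u, ⟨hu, h3, h4⟩, rfl⟩
    rw [lt_qfree_iff h1 h2, Real.tan_arctan]
    exact ⟨⟨u, hu, rfl⟩, h3, h4⟩

lemma abs_Gmeas2_sub_setIntegral_le (hl : 2 ≤ l) (hε : 0 < ε) (hQ : Q = ⌊1 / ε⌋₊) (hQ0 : 0 < Q)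
    (hεQ : 1 < ε * (Q + 1)) (hQT : 2 * Q ≤ T) (h1 : (T : ℝ) ≤ lam * Q) (h2 : lam * Q < T + 1)
    (hI : I ⊆ Set.Icc 0 1) (hIc : I.OrdConnected) :
    |Gmeas2 l I ε lam - ∫ u in freeSet Q T 1 l ε 0 ∩ I, 1 / (1 + u ^ 2)| ≤ 2 / Q := by
  have he : (1 : ℤ) = 1 ∨ (1 : ℤ) = -1 := Or.inl rfl
  rw [Gmeas2, ← hQ, image_arctan_setOf h1 h2 (fun v => ∃ γ γ' : ℚ, ConsecFarey Q γ γ' ∧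
    (γ : ℝ) ∈ I ∧ (γ' : ℝ) ∈ I ∧ γ ∈ FareyCong l ∧ (γ : ℝ) < v ∧ v < (γ' : ℝ)),
    ← measureReal_def]
  refine (abs_volume_arctan_image_sub_le ((measurableSet_freeSet Q T he l ε 0).inter
    hIc.measurableSet) (measurableSet_edgeSet Q I)
    (volume_edgeSet_ne_top Q I) ?_ ?_).trans (volume_edgeSet_le I)
  · rintro u ⟨⟨hu, huI⟩, huS⟩
    obtain ⟨h3, γ, γ', h4, h5, h6, h7, h8⟩ :=
      exists_consecFarey_of_mem_freeSet hl he hε hQ0 hQT hI hIc huI hu huS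
    exact ⟨huI, h3, γ, γ', h4, h5, h6, h7.1 rfl, h8⟩
  · rintro u ⟨huI, h3, γ, γ', h4, h5, h6, h7, h8, h9⟩
    obtain ⟨h10, h11⟩ := consecFarey_det h4
    refine ⟨mem_freeSet_of_free hl he hε hεQ hQT h7 h4.1.2.2 h4.2.1.2.2 (by linarith) h11
      ?_ ?_ h3, huI⟩
    · simpa using h8
    · simpa using h9

lemma abs_Gmeas3_sub_setIntegral_le (hl : 2 ≤ l) (hε : 0 < ε) (hQ : Q = ⌊1 / ε⌋₊) (hQ0 : 0 < Q)
    (hεQ : 1 < ε * (Q + 1)) (hQT : 2 * Q ≤ T) (h1 : (T : ℝ) ≤ lam * Q) (h2 : lam * Q < T + 1)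
    (hI : I ⊆ Set.Icc 0 1) (hIc : I.OrdConnected) :
    |Gmeas3 l I ε lam - ∫ u in freeSet Q T (-1) l ε 0 ∩ I, 1 / (1 + u ^ 2)| ≤ 2 / Q := by
  have he : (-1 : ℤ) = 1 ∨ (-1 : ℤ) = -1 := Or.inr rfl
  rw [Gmeas3, ← hQ, image_arctan_setOf h1 h2 (fun v => ∃ γ γ' : ℚ, ConsecFarey Q γ γ' ∧
    (γ : ℝ) ∈ I ∧ (γ' : ℝ) ∈ I ∧ γ' ∈ FareyCong l ∧ (γ : ℝ) < v ∧ v < (γ' : ℝ)),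
    ← measureReal_def]
  refine (abs_volume_arctan_image_sub_le ((measurableSet_freeSet Q T he l ε 0).inter
    hIc.measurableSet) (measurableSet_edgeSet Q I)
    (volume_edgeSet_ne_top Q I) ?_ ?_).trans (volume_edgeSet_le I)
  · rintro u ⟨⟨hu, huI⟩, huS⟩
    obtain ⟨h3, γ, γ', h4, h5, h6, h7, h8⟩ :=
      exists_consecFarey_of_mem_freeSet hl he hε hQ0 hQT hI hIc huI hu huS
    exact ⟨huI, h3, γ, γ', h4, h5, h6, h7.2 rfl, h8⟩
  · rintro u ⟨huI, h3, γ, γ', h4, h5, h6, h7, h8, h9⟩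
    obtain ⟨h10, h11⟩ := consecFarey_det h4
    refine ⟨mem_freeSet_of_free hl he hε hεQ hQT h7 h4.2.1.2.2 h4.1.2.2 (by linarith) (by omega)
      ?_ ?_ h3, huI⟩
    · push_cast; linarith
    · push_cast; linarith

end

lemma exists_abs_setIntegral_freeSet_sub_le {l : ℕ} (hl : 2 ≤ l) {δ : ℝ} (hδ : 0 < δ) :
    ∃ C : ℝ, 0 ≤ C ∧ ∀ (Q T : ℕ) (ε lam : ℝ) (e : ℤ) (I : Set ℝ), 0 < Q → 2 ≤ lam → 0 < ε →
      (T : ℝ) ≤ lam * Q → lam * Q < T + 1 → 2 * Q ≤ T → ε * Q ≤ 1 → 1 < ε * (Q + 1) →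
      (e = 1 ∨ e = -1) → I ⊆ Set.Icc 0 1 → I.OrdConnected →
      |(∫ u in freeSet Q T e l ε 0 ∩ I, 1 / (1 + u ^ 2)) -
        (∫ u in I, 1 / (1 + u ^ 2)) * (Cconst l / l * ∫ u in (0 : ℝ)..1, kap lam u)| ≤
        2 * (C * ((Q : ℝ) ^ δ / √Q) + 3 / Q) := by
  obtain ⟨C, hC0, hC⟩ := exists_abs_farey_sum_sub_le hl hδ
  refine ⟨C, hC0, ?_⟩
  intro Q T ε lam e I hQ hlam hε h1 h2 hQT h3 h4 he hI hIc
  refine abs_setIntegral_inter_sub_le hI hIc (measurableSet_freeSet Q T he l ε 0) ?_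
  intro s hs0 hs1
  have h5 := hC Q T ε lam s e hQ hlam h1 h2 h3 h4 hs0 hs1 he
  have h6 := abs_volume_freeSet_inter_sub_le (s := s) (by omega : 0 < l) he hε h3 hQ hQT hs0
  have h7 : volume.real (freeSet Q T e l ε s) = ∑ q ∈ Finset.Icc 1 Q with q.Coprime l,
        ∑ b ∈ Finset.range ⌈(1 - s) * q / l⌉₊ with b.Coprime q,
          (1 - ε * q) / (q * lastDenom T e l q b) := by
    rw [measureReal_def, volume_freeSet (by omega) he hε h3 hQT, ENNReal.toReal_ofReal]
    refine Finset.sum_nonneg fun q hq => Finset.sum_nonneg fun b _ => ?_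
    exact freeLen_nonneg (T := T) e l (p := ⟨q, b⟩) hε.le h3
      (Finset.mem_Icc.1 (Finset.mem_filter.1 hq).1).2
  rw [← h7] at h5
  rw [mul_comm _ (1 - s)]
  refine (abs_sub_le _ _ _).trans ((add_le_add h6 h5).trans ?_)
  linarith

lemma rpow_div_sqrt_le {ε η : ℝ} {Q : ℕ} (hη : 0 < η) (hη4 : η ≤ 1 / 4) (hε : 0 < ε)
    (hε1 : ε < 1 / 2) (hQ0 : 0 < Q) (hQ : 1 < ε * (Q + 1)) :
    (Q : ℝ) ^ η / √Q ≤ 2 * ε ^ (1 / 2 - η) := by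
  have hQ1 : (1 : ℝ) ≤ Q := by exact_mod_cast hQ0
  have h0 : (0 : ℝ) < Q := by linarith
  have h1 : 1 / (Q : ℝ) ≤ 2 * ε := by
    rw [div_le_iff₀ h0]; nlinarith
  rw [Real.sqrt_eq_rpow, ← Real.rpow_sub h0]
  have h2 : (Q : ℝ) ^ (η - 1 / 2) = (1 / (Q : ℝ)) ^ (1 / 2 - η) := by
    rw [one_div (Q : ℝ), Real.inv_rpow h0.le, ← Real.rpow_neg h0.le]; congr 1; ring
  have h3 : (2 : ℝ) ^ (1 / 2 - η) ≤ 2 := by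
    calc (2 : ℝ) ^ (1 / 2 - η) ≤ 2 ^ (1 : ℝ) :=
          Real.rpow_le_rpow_of_exponent_le (by norm_num) (by linarith)
      _ = 2 := Real.rpow_one 2
  rw [h2]
  calc (1 / (Q : ℝ)) ^ (1 / 2 - η) ≤ (2 * ε) ^ (1 / 2 - η) :=
        Real.rpow_le_rpow (by positivity) h1 (by linarith)
    _ = 2 ^ (1 / 2 - η) * ε ^ (1 / 2 - η) := Real.mul_rpow (by norm_num) hε.le
    _ ≤ 2 * ε ^ (1 / 2 - η) := by gcongr

theorem statement10 (l : ℕ) (hl : 2 ≤ l)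
    (c c₁ δ K : ℝ) (hc : c ∈ Set.Ioo (0 : ℝ) 1) (hc₁ : c₁ ∈ Set.Ioo (0 : ℝ) 1)
    (hδ : 0 < δ) (hK : 1 ≤ K) (Λ : Set ℝ) (hΛc : IsCompact Λ) (hΛ : Λ ⊆ Set.Ici 2) :
    ∃ C > 0, ∃ ε₀ > 0, ∀ ε : ℝ, 0 < ε → ε < ε₀ → ∀ lam ∈ Λ,
      ∀ I : Set ℝ, I ⊆ Set.Icc 0 1 → I.OrdConnected →
      K⁻¹ * ε ^ c ≤ (volume I).toReal → (volume I).toReal ≤ K * ε ^ c →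
      |Gmeas2 l I ε lam - (∫ u in I, 1 / (1 + u ^ 2)) * Cconst l / l *
          ∫ u in (0 : ℝ)..1, ((1 - u) / u) * Real.log (lam / (lam - u))| ≤
        C * ε ^ (min (c + c₁) (1 / 2 - 2 * c₁) - δ) ∧
      |Gmeas3 l I ε lam - (∫ u in I, 1 / (1 + u ^ 2)) * Cconst l / l *
          ∫ u in (0 : ℝ)..1, ((1 - u) / u) * Real.log (lam / (lam - u))| ≤
        C * ε ^ (min (c + c₁) (1 / 2 - 2 * c₁) - δ) := by
  set η : ℝ := min δ (1 / 4) with hη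
  have hη0 : 0 < η := lt_min hδ (by norm_num)
  have hη4 : η ≤ 1 / 4 := min_le_right _ _
  have hηδ : η ≤ δ := min_le_left _ _
  obtain ⟨C, hC0, hC⟩ := exists_abs_setIntegral_freeSet_sub_le hl hη0
  refine ⟨4 * C + 16, by linarith, 1 / 2, by norm_num, ?_⟩
  intro ε hε hε1 lam hlam I hI hIc _ _
  have hlam2 : 2 ≤ lam := hΛ hlam
  obtain ⟨Q, hQ⟩ : ∃ Q : ℕ, Q = ⌊1 / ε⌋₊ := ⟨_, rfl⟩
  have hQ0 : 0 < Q := by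
    rw [hQ, Nat.floor_pos, le_div_iff₀ hε]; linarith
  have hQr : (0 : ℝ) < Q := by exact_mod_cast hQ0
  have hQ1 : (1 : ℝ) ≤ Q := by exact_mod_cast hQ0
  have h3 : ε * Q ≤ 1 := by
    have : (Q : ℝ) ≤ 1 / ε := hQ ▸ Nat.floor_le (by positivity)
    rw [le_div_iff₀ hε] at this
    linarith
  have h4 : 1 < ε * (Q + 1) := by
    have : 1 / ε < (Q : ℝ) + 1 := hQ ▸ Nat.lt_floor_add_one (1 / ε)
    rw [div_lt_iff₀ hε] at this
    linarith
  obtain ⟨T, hT⟩ : ∃ T : ℕ, T = ⌊lam * Q⌋₊ := ⟨_, rfl⟩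
  have h1 : (T : ℝ) ≤ lam * Q := hT ▸ Nat.floor_le (by positivity)
  have h2 : lam * Q < T + 1 := hT ▸ Nat.lt_floor_add_one (lam * Q)
  have hQT : 2 * Q ≤ T := by
    rw [hT, Nat.le_floor_iff (by positivity)]
    push_cast
    exact mul_le_mul_of_nonneg_right hlam2 hQr.le
  have hR := rpow_div_sqrt_le hη0 hη4 hε hε1 hQ0 h4
  have hR' : ε ^ (1 / 2 - η) ≤ ε ^ (min (c + c₁) (1 / 2 - 2 * c₁) - δ) := by
    apply Real.rpow_le_rpow_of_exponent_ge hε (by linarith)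
    have := min_le_right (c + c₁) (1 / 2 - 2 * c₁)
    have := hc₁.1
    linarith
  have hinv : 1 / (Q : ℝ) ≤ (Q : ℝ) ^ η / √Q := by
    have e1 : 1 ≤ √(Q : ℝ) := Real.one_le_sqrt.mpr hQ1
    have e2 : 1 ≤ (Q : ℝ) ^ η := Real.one_le_rpow hQ1 hη0.le
    have e3 : √(Q : ℝ) ≤ Q := by
      rw [Real.sqrt_le_left (by linarith)]; nlinarith
    exact div_le_div₀ (by linarith) e2 (by linarith) e3
  set R := (Q : ℝ) ^ η / √Q with hRdef
  set W := ε ^ (min (c + c₁) (1 / 2 - 2 * c₁) - δ) with hW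
  have hRW : R ≤ 2 * W := by linarith
  have final : ∀ (e : ℤ) (G : ℝ), (e = 1 ∨ e = -1) →
      |G - ∫ u in freeSet Q T e l ε 0 ∩ I, 1 / (1 + u ^ 2)| ≤ 2 / Q →
      |G - (∫ u in I, 1 / (1 + u ^ 2)) * Cconst l / l *
        ∫ u in (0 : ℝ)..1, ((1 - u) / u) * Real.log (lam / (lam - u))| ≤ (4 * C + 16) * W := by
    intro e G he hG
    have h5 := hC Q T ε lam e I hQ0 hlam2 hε h1 h2 hQT h3 h4 he hI hIc
    have h6 : (∫ u in I, 1 / (1 + u ^ 2)) * Cconst l / l *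
        ∫ u in (0 : ℝ)..1, ((1 - u) / u) * Real.log (lam / (lam - u)) =
        (∫ u in I, 1 / (1 + u ^ 2)) * (Cconst l / l * ∫ u in (0 : ℝ)..1, kap lam u) := by
      simp only [kap]; ring
    rw [h6]
    refine (abs_sub_le _ _ _).trans ((add_le_add hG h5).trans ?_)
    have e1 : 2 / (Q : ℝ) = 2 * (1 / Q) := by ring
    have e2 : 3 / (Q : ℝ) = 3 * (1 / Q) := by ring
    rw [e1, e2]
    have e3 : C * R ≤ C * (2 * W) := mul_le_mul_of_nonneg_left hRW hC0
    linarith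
  exact ⟨final 1 _ (Or.inl rfl)
      (abs_Gmeas2_sub_setIntegral_le hl hε hQ hQ0 h4 hQT h1 h2 hI hIc),
    final (-1) _ (Or.inr rfl)
      (abs_Gmeas3_sub_setIntegral_le hl hε hQ hQ0 h4 hQT h1 h2 hI hIc)⟩
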